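/- Let k > 1. For any regular elliptic x ∈ GL_n(F) and any root ξ ∈ E of the characteristic polynomial of x in a degree-n extension E of F, the k-fold matrix Kloosterman sum satisfies: Σ over k-tuples (g₁,…,g_k) ∈ GL_n(F)^k with g₁g₂⋯g_k = x of ψ(tr(g₁+⋯+g_k)) equals (-1)^{(k-1)(n+1)} · q^{(k-1)·n(n-1)/2} · Σ over k-tuples (t₁,…,t_k) ∈ (Eˣ)^k with t₁⋯t_k = ξ of ψ(Tr_{E/F}(t₁+⋯+t_k)). -/

import Mathlib

set_option linter.all false

open scoped BigOperators

namespace KL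

theorem trace_idem {ι : Type*} [Fintype ι] [DecidableEq ι] (P : Matrix ι ι ℂ) (h : P * P = P) :
    ∃ k : ℕ, P.trace = k := by
  have h1 : IsIdempotentElem (Matrix.toLin' P) := by
    unfold IsIdempotentElem
    rw [Module.End.mul_eq_comp, ← Matrix.toLin'_mul, h]
  have h2 := LinearMap.IsIdempotentElem.isProj_range _ h1
  refine ⟨Module.finrank ℂ (LinearMap.range (Matrix.toLin' P)), ?_⟩
  rw [← LinearMap.IsProj.trace h2]
  rw [Matrix.trace_toLin'_eq]

theorem pow_periodic {A : Type*} [Monoid A] {X : A} {N : ℕ} (hX : X ^ (N + 1) = X) (a k : ℕ) :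
    X ^ (a + 1 + N * k) = X ^ (a + 1) := by
  induction k with
  | zero => simp
  | succ k ih =>
    have : a + 1 + N * (k + 1) = (N + 1) + (a + N * k) := by ring
    rw [this, pow_add, hX, ← pow_succ', ← ih]
    congr 1; ring

theorem pow_modEq {A : Type*} [Monoid A] {X : A} {N : ℕ} (hX : X ^ (N + 1) = X) {a b : ℕ}
    (ha : 1 ≤ a) (hb : 1 ≤ b) (hab : a ≡ b [MOD N]) : X ^ a = X ^ b := by
  wlog hle : a ≤ b generalizing a b
  · exact (this hb ha hab.symm (by omega)).symm
  obtain ⟨k, hk⟩ := (Nat.modEq_iff_dvd' hle).1 hab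
  obtain ⟨c, rfl⟩ : ∃ c, a = c + 1 := ⟨a - 1, by omega⟩
  have : b = c + 1 + N * k := by omega
  rw [this, pow_periodic hX]

theorem sum_zeta {N : ℕ} (hN : 0 < N) {ζ : ℂ} (hζ : IsPrimitiveRoot ζ N) (a b : ℕ) :
    ∑ c ∈ Finset.range N, ζ ^ (c * a) * (ζ⁻¹) ^ (c * b) = if a ≡ b [MOD N] then (N : ℂ) else 0 := by
  have h0 : ζ ≠ 0 := hζ.ne_zero hN.ne'
  have h1 : ∀ c, ζ ^ (c * a) * (ζ⁻¹) ^ (c * b) = (ζ ^ a * (ζ⁻¹) ^ b) ^ c := by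
    intro c
    rw [mul_pow, ← pow_mul, ← pow_mul, mul_comm a, mul_comm b]
  simp_rw [h1]
  have key : ζ ^ a * (ζ⁻¹) ^ b = 1 ↔ a ≡ b [MOD N] := by
    have e : ζ ^ a * (ζ⁻¹) ^ b = ζ ^ ((a : ℤ) - b) := by
      rw [zpow_sub₀ h0, zpow_natCast, zpow_natCast, inv_pow, div_eq_mul_inv]
    rw [e, hζ.zpow_eq_one_iff_dvd, show (a ≡ b [MOD N]) ↔ (b ≡ a [MOD N]) from ⟨Nat.ModEq.symm, Nat.ModEq.symm⟩, Nat.modEq_iff_dvd]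
  split_ifs with h
  · rw [key.2 h]; simp
  · have hne : ζ ^ a * (ζ⁻¹) ^ b ≠ 1 := fun hh => h (key.1 hh)
    rw [geom_sum_eq hne]
    have : (ζ ^ a * (ζ⁻¹) ^ b) ^ N = 1 := by
      rw [mul_pow, ← pow_mul, ← pow_mul, mul_comm a, mul_comm b, pow_mul, pow_mul, inv_pow, hζ.pow_eq_one]
      simp
    rw [this]; simp

theorem trace_pow_periodic {ι : Type*} [Fintype ι] [DecidableEq ι] (X : Matrix ι ι ℂ) {N : ℕ}
    (hN : 0 < N) (hX : X ^ (N + 1) = X) {ζ : ℂ} (hζ : IsPrimitiveRoot ζ N) :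
    ∃ m : ℕ → ℕ, ∀ j, 1 ≤ j → (X ^ j).trace = ∑ c ∈ Finset.range N, (m c : ℂ) * ζ ^ (c * j) := by
  have h0 : ζ ≠ 0 := hζ.ne_zero hN.ne'
  have hNC : (N : ℂ) ≠ 0 := by exact_mod_cast hN.ne'
  let P : ℕ → Matrix ι ι ℂ := fun c => (N : ℂ)⁻¹ • ∑ j ∈ Finset.range N, (ζ⁻¹) ^ (c * (j + 1)) • X ^ (j + 1)
  have hXP : ∀ c, X * P c = ζ ^ c • P c := by
    intro c
    simp only [P]
    rw [mul_smul_comm, smul_comm (ζ ^ c)]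
    congr 1
    rw [Finset.mul_sum]
    let f : ℕ → Matrix ι ι ℂ := fun j => (ζ⁻¹) ^ (c * j) • X ^ j
    have e1 : ∀ j ∈ Finset.range N, X * (ζ⁻¹) ^ (c * (j + 1)) • X ^ (j + 1) = ζ ^ c • f (j + 1 + 1) := by
      intro j _
      simp only [f]
      rw [mul_smul_comm, ← pow_succ', smul_smul]
      congr 1
      rw [mul_add c (j+1) 1, pow_add, mul_one, inv_pow _ c]
      field_simp
    rw [Finset.sum_congr rfl e1, ← Finset.smul_sum]
    congr 1
    have e2 := Finset.sum_range_succ (fun j => f (j + 1)) N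
    have e3 := Finset.sum_range_succ' (fun j => f (j + 1)) N
    have e4 : f (N + 1) = f (0 + 1) := by
      simp only [f]
      rw [hX, zero_add, pow_one, mul_add, pow_add, mul_comm c N, pow_mul, inv_pow ζ N, hζ.pow_eq_one]
      simp
    rw [e4] at e2
    exact add_right_cancel (e3.symm.trans e2)
  have hXP2 : ∀ c j, X ^ j * P c = ζ ^ (c * j) • P c := by
    intro c j
    induction j with
    | zero => simp
    | succ j ih => rw [pow_succ', mul_assoc, ih, mul_smul_comm, hXP, smul_smul]; congr 1; ring
  have hidem : ∀ c, P c * P c = P c := by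
    intro c
    conv_lhs => enter [1]; simp only [P]
    rw [smul_mul_assoc, Finset.sum_mul]
    have : ∀ j ∈ Finset.range N, (ζ⁻¹) ^ (c * (j + 1)) • X ^ (j + 1) * P c = P c := by
      intro j _
      rw [smul_mul_assoc, hXP2, smul_smul, ← mul_pow, inv_mul_cancel₀ h0]; simp
    rw [Finset.sum_congr rfl this]
    simp only [Finset.sum_const, Finset.card_range]
    rw [← Nat.cast_smul_eq_nsmul ℂ, smul_smul, inv_mul_cancel₀ hNC, one_smul]
  choose m hm using fun c => trace_idem (P c) (hidem c)
  refine ⟨m, fun j hj => ?_⟩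
  have hsum : X ^ j = ∑ c ∈ Finset.range N, ζ ^ (c * j) • P c := by
    simp only [P]
    simp_rw [smul_comm _ (N : ℂ)⁻¹, ← Finset.smul_sum, Finset.smul_sum, smul_smul]
    rw [Finset.sum_comm]
    have hs : ∀ x, ∑ c ∈ Finset.range N, ((N:ℂ)⁻¹ * (ζ ^ (c * j) * ζ⁻¹ ^ (c * (x + 1)))) • X ^ (x + 1)
        = ((N:ℂ)⁻¹ * (if j ≡ x + 1 [MOD N] then (N:ℂ) else 0)) • X ^ (x + 1) := by
      intro x
      rw [← Finset.sum_smul, ← Finset.mul_sum, sum_zeta hN hζ]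
    simp_rw [hs]
    have hmod : ∀ x ∈ Finset.range N, ((N:ℂ)⁻¹ * (if j ≡ x + 1 [MOD N] then (N:ℂ) else 0)) • X ^ (x + 1)
       = if x = (j - 1) % N then X ^ j else 0 := by
      intro x hx
      have hx' := Finset.mem_range.1 hx
      have : j ≡ x + 1 [MOD N] ↔ x = (j - 1) % N := by
        obtain ⟨i, rfl⟩ : ∃ i, j = i + 1 := ⟨j - 1, by omega⟩
        simp only [Nat.add_sub_cancel]
        constructor
        · intro h
          have := Nat.ModEq.add_right_cancel' 1 h
          unfold Nat.ModEq at this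
          rw [this, Nat.mod_eq_of_lt hx']
        · intro h
          apply Nat.ModEq.add_right
          rw [h]
          exact (Nat.mod_modEq _ _).symm
      split_ifs with h1 h2 h2
      · rw [inv_mul_cancel₀ hNC, one_smul]; exact pow_modEq hX (by omega) hj h1.symm
      · exact absurd (this.1 h1) h2
      · exact absurd (this.2 h2) h1
      · simp
    have hfin : ∑ x ∈ Finset.range N, ((N:ℂ)⁻¹ * (if j ≡ x + 1 [MOD N] then (N:ℂ) else 0)) • X ^ (x + 1) = X ^ j := by
      rw [Finset.sum_congr rfl hmod, Finset.sum_ite_eq']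
      simp [Nat.mod_lt _ hN]
    exact hfin.symm
  rw [hsum, Matrix.trace_sum]
  refine Finset.sum_congr rfl fun c _ => ?_
  rw [Matrix.trace_smul, hm, smul_eq_mul, mul_comm]

theorem int_integral (k : ℤ) : IsIntegral ℤ (k : ℂ) := by
  simpa using (isIntegral_algebraMap (R := ℤ) (A := ℂ) (x := k))

theorem nat_integral (k : ℕ) : IsIntegral ℤ (k : ℂ) := by
  simpa using int_integral k

theorem trace_integral {ι : Type*} [Fintype ι] [DecidableEq ι] (X : Matrix ι ι ℂ) {N : ℕ}
    (hN : 0 < N) (hX : X ^ (N + 1) = X) : IsIntegral ℤ X.trace := by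
  obtain ⟨m, hm⟩ := trace_pow_periodic X hN hX (Complex.isPrimitiveRoot_exp N hN.ne')
  have := hm 1 le_rfl
  rw [pow_one] at this
  rw [this]
  refine IsIntegral.sum _ fun c _ => ?_
  refine IsIntegral.mul (nat_integral _) ?_
  apply IsIntegral.pow
  exact (Complex.isPrimitiveRoot_exp N hN.ne').isIntegral hN

theorem coprime_integral {z : ℂ} {a b : ℕ} (h : Nat.Coprime a b) (ha : IsIntegral ℤ ((a : ℂ) * z))
    (hb : IsIntegral ℤ ((b : ℂ) * z)) : IsIntegral ℤ z := by
  have h1 := Nat.gcd_eq_gcd_ab a b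
  rw [h] at h1
  have h2 : z = (Nat.gcdA a b : ℂ) * ((a : ℂ) * z) + (Nat.gcdB a b : ℂ) * ((b : ℂ) * z) := by
    have : ((1 : ℤ) : ℂ) = ((a : ℤ) : ℂ) * (Nat.gcdA a b : ℂ) + ((b : ℤ) : ℂ) * (Nat.gcdB a b : ℂ) := by
      exact_mod_cast h1
    simp only [Int.cast_one, Int.cast_natCast] at this
    linear_combination z * this
  rw [h2]
  exact ((int_integral _).mul ha).add ((int_integral _).mul hb)

theorem rat_integral {z : ℂ} (r : ℚ) (hz : z = r) (h : IsIntegral ℤ z) : ∃ k : ℤ, z = k := by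
  subst hz
  have h' : IsIntegral ℤ r := by
    have := (isIntegral_algebraMap_iff (R := ℤ) (A := ℚ) (B := ℂ) (algebraMap ℚ ℂ).injective (x := r)).1
    exact this (by simpa using h)
  obtain ⟨k, hk⟩ := IsIntegrallyClosed.isIntegral_iff.1 h'
  exact ⟨k, by rw [← hk]; simp⟩

end KL

namespace KL

def IsClass {G : Type*} [Group G] (f : G → ℂ) : Prop := ∀ g h : G, f (h * g * h⁻¹) = f g

noncomputable def BB {G : Type*} [Group G] (f h : G → ℂ) : ℂ :=
  (Nat.card G : ℂ)⁻¹ * ∑ᶠ g, f g * h g⁻¹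

theorem BB_eq {G : Type*} [Group G] [Fintype G] (f h : G → ℂ) :
    BB f h = (Fintype.card G : ℂ)⁻¹ * ∑ g, f g * h g⁻¹ := by
  rw [BB, finsum_eq_sum_of_fintype, Nat.card_eq_fintype_card]

theorem BB_comm {G : Type*} [Group G] (f h : G → ℂ) : BB f h = BB h f := by
  unfold BB
  congr 1
  rw [← finsum_comp_equiv (Equiv.inv G)]
  simp [mul_comm]

theorem trace_mulLeft_group {G : Type*} [Group G] [Fintype G] (x : MonoidAlgebra ℂ G) :
    LinearMap.trace ℂ _ (LinearMap.mulLeft ℂ x) = (Fintype.card G : ℂ) * x.coeff 1 := by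
  classical
  rw [LinearMap.trace_eq_matrix_trace ℂ (MonoidAlgebra.basis G ℂ), Matrix.trace]
  have : ∀ h : G, (LinearMap.toMatrix (MonoidAlgebra.basis G ℂ) (MonoidAlgebra.basis G ℂ)
      (LinearMap.mulLeft ℂ x)).diag h = x.coeff 1 := by
    intro h
    rw [Matrix.diag_apply, LinearMap.toMatrix_apply]
    have : MonoidAlgebra.basis G ℂ h = MonoidAlgebra.single h 1 := by simp
    rw [this]
    show (x * MonoidAlgebra.single h 1).coeff h = _
    simp [MonoidAlgebra.coeff_mul_single_eq_coeff_mul]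
  rw [Finset.sum_congr rfl fun h _ => this h]
  simp

theorem trace_mulLeft_pi {r : ℕ} {d : Fin r → ℕ} (A : ∀ i, Matrix (Fin (d i)) (Fin (d i)) ℂ) :
    LinearMap.trace ℂ (∀ i, Matrix (Fin (d i)) (Fin (d i)) ℂ) (LinearMap.mulLeft ℂ A) =
      ∑ i, (d i : ℂ) * (A i).trace := by
  classical
  rw [LinearMap.trace_eq_matrix_trace ℂ (Pi.basis fun i => Matrix.stdBasis ℂ (Fin (d i)) (Fin (d i))), Matrix.trace]
  rw [Fintype.sum_sigma]
  refine Finset.sum_congr rfl fun i _ => ?_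
  rw [Fintype.sum_prod_type]
  have : ∀ a b, (LinearMap.toMatrix (Pi.basis fun i => Matrix.stdBasis ℂ (Fin (d i)) (Fin (d i)))
    (Pi.basis fun i => Matrix.stdBasis ℂ (Fin (d i)) (Fin (d i))) (LinearMap.mulLeft ℂ A)).diag ⟨i, (a, b)⟩ = A i a a := by
    intro a b
    rw [Matrix.diag_apply, LinearMap.toMatrix_apply, Pi.basis_repr]
    have : ∀ M : Matrix (Fin (d i)) (Fin (d i)) ℂ, (Matrix.stdBasis ℂ (Fin (d i)) (Fin (d i))).repr M (a, b) = M a b := by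
      intro M
      simp [Matrix.stdBasis]
    rw [this]
    simp [Pi.basis_apply, Matrix.stdBasis_eq_single]
  rw [Finset.sum_congr rfl fun a _ => Finset.sum_congr rfl fun b _ => this a b]
  simp [Matrix.trace, Finset.mul_sum]

theorem wedderburn (G : Type) [Group G] [Fintype G] :
    ∃ (r : ℕ) (d : Fin r → ℕ) (ρ : ∀ i, G →* Matrix (Fin (d i)) (Fin (d i)) ℂ),
      (∀ f : G → ℂ, IsClass f → ∀ g, f g = ∑ i, BB f (fun g => (ρ i g).trace) * (ρ i g).trace) ∧
      (∀ f : G → ℂ, IsClass f → ∀ i, ∃ w : ℂ, ∑ y, f y • ρ i y⁻¹ = w • 1) := by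
  classical
  haveI : NeZero (Nat.card G : ℂ) := ⟨by simp [Nat.card_eq_fintype_card]⟩
  obtain ⟨r, d, hd, ⟨e⟩⟩ := IsSemisimpleRing.exists_algEquiv_pi_matrix_of_isAlgClosed ℂ (MonoidAlgebra ℂ G)
  let ρ : ∀ i, G →* Matrix (Fin (d i)) (Fin (d i)) ℂ := fun i =>
    { toFun := fun g => e (MonoidAlgebra.single g 1) i
      map_one' := by
        have : (MonoidAlgebra.single (1:G) (1:ℂ)) = 1 := rfl
        rw [this, map_one]; rfl
      map_mul' := fun g h => by
        have : (MonoidAlgebra.single (g * h) (1:ℂ)) = MonoidAlgebra.single g 1 * MonoidAlgebra.single h 1 := by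
          simp [MonoidAlgebra.single_mul_single]
        rw [this, map_mul]; rfl }
  have hρ : ∀ i g, ρ i g = e (MonoidAlgebra.single g 1) i := fun i g => rfl
  -- central elements
  let z : (G → ℂ) → MonoidAlgebra ℂ G := fun f => ∑ g, f g • MonoidAlgebra.single g 1
  have hz1 : ∀ f, IsClass f → ∀ x, z f * x = x * z f := by
    intro f hf x
    induction x using MonoidAlgebra.induction_on with
    | of h =>
      simp only [z, Finset.sum_mul, Finset.mul_sum, MonoidAlgebra.of_apply, smul_mul_assoc, mul_smul_comm,
        MonoidAlgebra.single_mul_single, mul_one]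
      rw [← Equiv.sum_comp ((Equiv.mulLeft h).trans (Equiv.mulRight h⁻¹))]
      refine Finset.sum_congr rfl fun g _ => ?_
      simp [hf g h]
    | add a b ha hb => rw [mul_add, ha, hb, add_mul]
    | smul c a ha => rw [mul_smul_comm, ha, smul_mul_assoc]
  have hez : ∀ f i, e (z f) i = ∑ g, f g • ρ i g := by
    intro f i
    simp only [z, map_sum, map_smul, hρ, Finset.sum_apply, Pi.smul_apply]
  have hz2 : ∀ f, IsClass f → ∀ i, ∃ w : ℂ, e (z f) i = w • 1 := by
    intro f hf i
    have : e (z f) i ∈ Set.range (Matrix.scalar (Fin (d i)) : ℂ → _) := by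
      apply Matrix.mem_range_scalar_of_commute_single
      intro a b _
      have h := congrArg (fun y => (e y) i) (hz1 f hf (e.symm (Pi.single i (Matrix.single a b 1))))
      simp only [map_mul, AlgEquiv.apply_symm_apply, Pi.mul_apply, Pi.single_eq_same] at h
      exact h.symm
    obtain ⟨w, hw⟩ := this
    exact ⟨w, by rw [← hw, Matrix.scalar_apply, ← Matrix.smul_one_eq_diagonal]⟩
  have hcl : ∀ f : G → ℂ, IsClass f → IsClass (fun g => f g⁻¹) := by
    intro f hf g h
    have := hf g⁻¹ h
    simp only [mul_inv_rev, inv_inv]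
    rw [← mul_assoc]; exact this
  have htr : ∀ x, (Fintype.card G : ℂ) * x.coeff 1 = ∑ i, (d i : ℂ) * (e x i).trace := by
    intro x
    rw [← trace_mulLeft_group, ← trace_mulLeft_pi, ← LinearMap.trace_conj' _ e.toLinearEquiv]
    congr 1
    refine LinearMap.ext fun y => ?_
    simp [LinearEquiv.conj_apply]
  refine ⟨r, d, ρ, ?_, ?_⟩
  · intro f hf g
    have key := htr (z (fun g => f g⁻¹) * MonoidAlgebra.single g 1)
    rw [MonoidAlgebra.coeff_mul_single_eq_coeff_mul (m := g) (m₁ := (1:G)) (m₂ := g⁻¹) (by intro a _; exact mul_eq_one_iff_eq_inv)] at key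
    have h1 : (z (fun g => f g⁻¹)).coeff g⁻¹ = f g := by
      simp [z, MonoidAlgebra.coeff_single, Finsupp.single_apply, MonoidAlgebra.coeff_sum]
    rw [h1] at key
    have hc : (Fintype.card G : ℂ) ≠ 0 := by simp
    have : f g = (Fintype.card G : ℂ)⁻¹ * ((Fintype.card G : ℂ) * f g) := by field_simp
    rw [this]
    rw [mul_one] at key
    rw [key, Finset.mul_sum]
    refine Finset.sum_congr rfl fun i _ => ?_
    obtain ⟨w, hw⟩ := hz2 _ (hcl f hf) i
    have h2 : (d i : ℂ) * w = ∑ h, f h * (ρ i h⁻¹).trace := by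
      have := congrArg Matrix.trace (hez (fun g => f g⁻¹) i)
      rw [hw] at this
      simp only [Matrix.trace_smul, Matrix.trace_one, Fintype.card_fin, smul_eq_mul, Matrix.trace_sum] at this
      rw [mul_comm, this, ← Equiv.sum_comp (Equiv.inv G)]
      simp
    rw [map_mul, Pi.mul_apply, hw, ← hρ, smul_mul_assoc, one_mul, Matrix.trace_smul, smul_eq_mul, BB_eq, ← h2]
    ring
  · intro f hf i
    obtain ⟨w, hw⟩ := hz2 _ (hcl f hf) i
    refine ⟨w, ?_⟩
    rw [← hw, hez, ← Equiv.sum_comp (Equiv.inv G)]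
    simp

end KL

namespace KL

def Virt (R : Subring ℂ) {G : Type} [Group G] (f : G → ℂ) : Prop :=
  ∀ (ι : Type) [Fintype ι] [DecidableEq ι] (ρ : G →ₙ* Matrix ι ι ℂ),
    BB f (fun g => (ρ g).trace) ∈ R

theorem BB_add {G : Type*} [Group G] [Finite G] (f f' h : G → ℂ) :
    BB (fun g => f g + f' g) h = BB f h + BB f' h := by
  classical
  haveI := Fintype.ofFinite G
  simp only [BB_eq, add_mul, Finset.sum_add_distrib, mul_add]

theorem BB_smul {G : Type*} [Group G] [Finite G] (c : ℂ) (f h : G → ℂ) :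
    BB (fun g => c * f g) h = c * BB f h := by
  classical
  haveI := Fintype.ofFinite G
  simp only [BB_eq, mul_assoc, ← Finset.mul_sum, mul_left_comm]

theorem BB_sum {G : Type*} [Group G] [Finite G] {α : Type*} (s : Finset α) (f : α → G → ℂ) (h : G → ℂ) :
    BB (fun g => ∑ a ∈ s, f a g) h = ∑ a ∈ s, BB (f a) h := by
  classical
  haveI := Fintype.ofFinite G
  simp only [BB_eq, Finset.sum_mul, ← Finset.mul_sum]
  rw [Finset.sum_comm]

theorem Virt.add {R : Subring ℂ} {G : Type} [Group G] [Finite G] {f f' : G → ℂ} (h : Virt R f)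
    (h' : Virt R f') : Virt R (fun g => f g + f' g) := by
  intro ι _ _ ρ
  rw [BB_add]
  exact R.add_mem (h ι ρ) (h' ι ρ)

theorem Virt.smul {R : Subring ℂ} {G : Type} [Group G] [Finite G] {f : G → ℂ} (h : Virt R f)
    {c : ℂ} (hc : c ∈ R) : Virt R (fun g => c * f g) := by
  intro ι _ _ ρ
  rw [BB_smul]
  exact R.mul_mem hc (h ι ρ)

theorem Virt.sum {R : Subring ℂ} {G : Type} [Group G] [Finite G] {α : Type*} {s : Finset α} {f : α → G → ℂ}
    (h : ∀ a ∈ s, Virt R (f a)) : Virt R (fun g => ∑ a ∈ s, f a g) := by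
  intro ι _ _ ρ
  rw [BB_sum]
  exact R.sum_mem fun a ha => h a ha ι ρ

theorem Virt.sub {R : Subring ℂ} {G : Type} [Group G] [Finite G] {f f' : G → ℂ} (h : Virt R f)
    (h' : Virt R f') : Virt R (fun g => f g - f' g) := by
  have := h.add (h'.smul (c := -1) (R.neg_mem R.one_mem))
  simpa [sub_eq_add_neg] using this

/-- idempotent average of a nonunital representation -/
theorem avg_idem {G : Type} [Group G] [Fintype G] {ι : Type} [Fintype ι] [DecidableEq ι]
    (ρ : G →ₙ* Matrix ι ι ℂ) :
    ((Fintype.card G : ℂ)⁻¹ • ∑ g, ρ g) * ((Fintype.card G : ℂ)⁻¹ • ∑ g, ρ g)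
      = (Fintype.card G : ℂ)⁻¹ • ∑ g, ρ g := by
  have hc : (Fintype.card G : ℂ) ≠ 0 := by simp
  have h1 : ∀ g, ρ g * ∑ h, ρ h = ∑ h, ρ h := by
    intro g
    rw [Finset.mul_sum]
    exact Fintype.sum_equiv (Equiv.mulLeft g) _ _ fun x => by simp [map_mul]
  rw [smul_mul_assoc, mul_smul_comm, Finset.sum_mul, Finset.sum_congr rfl fun g _ => h1 g]
  rw [Finset.sum_const, Finset.card_univ, ← Nat.cast_smul_eq_nsmul ℂ, smul_smul, smul_smul]
  congr 1
  field_simp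

/-- linear characters are virtual -/
theorem Virt.char (R : Subring ℂ) {G : Type} [Group G] [Finite G] (θ : G →* ℂ) : Virt R (fun g => θ g) := by
  classical
  haveI := Fintype.ofFinite G
  intro ι _ _ ρ
  let ρ' : G →ₙ* Matrix ι ι ℂ :=
    { toFun := fun g => θ g⁻¹ • ρ g
      map_mul' := fun a b => by
        rw [map_mul, smul_mul_smul_comm, mul_inv_rev, map_mul, mul_comm (θ b⁻¹)] }
  obtain ⟨k, hk⟩ := trace_idem _ (avg_idem ρ')
  rw [BB_eq]
  have : (Fintype.card G : ℂ)⁻¹ * ∑ g, θ g * (ρ g⁻¹).trace = k := by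
    rw [← hk, Matrix.trace_smul, smul_eq_mul, Matrix.trace_sum, ← Equiv.sum_comp (Equiv.inv G)]
    congr 1
    refine Finset.sum_congr rfl fun g _ => ?_
    simp [ρ', Matrix.trace_smul]
  rw [this]
  exact natCast_mem R k

/-- inflation -/
theorem Virt.infl {R : Subring ℂ} {S H : Type} [Group S] [Finite S] [Group H] [Finite H] (π : S →* H)
    (hπ : Function.Surjective π) {f : H → ℂ} (hf : Virt R f) : Virt R (fun g => f (π g)) := by
  classical
  haveI := Fintype.ofFinite S
  haveI := Fintype.ofFinite H
  intro ι _ _ ρ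
  let κ : ℕ := Nat.card π.ker
  have hcard : Fintype.card S = κ * Fintype.card H := by
    rw [← Nat.card_eq_fintype_card, ← Nat.card_eq_fintype_card]
    have := Subgroup.card_eq_card_quotient_mul_card_subgroup π.ker
    rw [this, mul_comm, Nat.card_congr (QuotientGroup.quotientKerEquivOfSurjective π hπ).toEquiv]
  have hS : (Fintype.card S : ℂ) ≠ 0 := by simp
  have hH : (Fintype.card H : ℂ) ≠ 0 := by simp
  have hκ : (κ : ℂ) ≠ 0 := by
    intro h; rw [hcard, Nat.cast_mul, h, zero_mul] at hS; exact hS rfl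
  have hfib : ∀ a : H, (Finset.univ.filter fun g => π g = a).card = κ := by
    intro a
    obtain ⟨g0, hg0⟩ := hπ a
    rw [← Fintype.card_subtype, ← Nat.card_eq_fintype_card]
    refine Nat.card_congr ⟨fun g => ⟨g0⁻¹ * g.1, ?_⟩, fun g => ⟨g0 * g.1, ?_⟩, ?_, ?_⟩
    · have := g.2; simp [MonoidHom.mem_ker, hg0, this]
    · have := g.2; rw [MonoidHom.mem_ker] at this; simp [hg0, this]
    · intro g; simp
    · intro g; simp
  let ρ' : H →ₙ* Matrix ι ι ℂ :=
    { toFun := fun a => (κ : ℂ)⁻¹ • ∑ g ∈ Finset.univ.filter (fun g => π g = a), ρ g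
      map_mul' := fun a b => by
        rw [smul_mul_smul_comm, Finset.sum_mul_sum]
        have : ∀ g ∈ Finset.univ.filter (fun g => π g = a),
            ∑ h ∈ Finset.univ.filter (fun g => π g = b), ρ g * ρ h =
            ∑ h ∈ Finset.univ.filter (fun g => π g = a * b), ρ h := by
          intro g hg
          have hg' : π g = a := by simpa using hg
          refine Finset.sum_bij (fun h _ => g * h) ?_ ?_ ?_ ?_
          · intro h hh; simp at hh ⊢; rw [hg', hh]
          · intro h _ h' _ e; exact mul_left_cancel e
          · intro h hh
            refine ⟨g⁻¹ * h, ?_, by simp⟩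
            simp at hh ⊢; rw [hg', hh]; simp
          · intro h _; rw [map_mul]
        rw [Finset.sum_congr rfl this, Finset.sum_const, hfib, ← Nat.cast_smul_eq_nsmul ℂ, smul_smul]
        congr 1
        field_simp }
  have key := hf ι ρ'
  convert key using 1
  rw [BB_eq, BB_eq, hcard, Nat.cast_mul, mul_inv, mul_comm (κ : ℂ)⁻¹, mul_assoc]
  congr 1
  rw [Finset.mul_sum, ← Finset.sum_fiberwise (s := Finset.univ) (g := π)]
  refine Finset.sum_congr rfl fun a _ => ?_
  simp only [ρ', MulHom.coe_mk, Matrix.trace_smul, Matrix.trace_sum, smul_eq_mul]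
  rw [mul_left_comm, Finset.mul_sum, ← Finset.mul_sum]
  congr 1
  refine Finset.sum_bij (fun g _ => g⁻¹) ?_ ?_ ?_ ?_
  · intro g hg; simp at hg ⊢; exact hg
  · intro g _ g' _ e; exact inv_injective e
  · intro g hg; exact ⟨g⁻¹, by simp at hg ⊢; rw [hg]; simp, by simp⟩
  · intro g hg; simp at hg; rw [hg]


theorem orbit_sum {G X : Type} [Group G] [Finite G] [MulAction G X] [Fintype X] (c : X → ℂ)
    (hc : ∀ (h : G) x, c (h • x) = c x) :
    (Nat.card G : ℂ)⁻¹ * ∑ x, c x =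
      ∑ᶠ ω : MulAction.orbitRel.Quotient G X, (Nat.card (MulAction.stabilizer G ω.out) : ℂ)⁻¹ * c ω.out := by
  classical
  haveI := Fintype.ofFinite G
  haveI : Fintype (MulAction.orbitRel.Quotient G X) := Fintype.ofFinite _
  rw [finsum_eq_sum_of_fintype, ← Finset.sum_fiberwise (s := Finset.univ)
    (g := fun x => (Quotient.mk _ x : MulAction.orbitRel.Quotient G X)), Finset.mul_sum]
  refine Finset.sum_congr rfl fun ω _ => ?_
  have h1 : ∀ x ∈ Finset.univ.filter (fun x => (Quotient.mk _ x : MulAction.orbitRel.Quotient G X) = ω),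
      c x = c ω.out := by
    intro x hx
    simp only [Finset.mem_filter, Finset.mem_univ, true_and] at hx
    have : x ∈ MulAction.orbit G ω.out := by
      rw [← MulAction.orbitRel_apply]
      apply Quotient.exact
      rw [hx, Quotient.out_eq]
    obtain ⟨h, hh⟩ := this
    rw [← hh]; exact hc h _
  rw [Finset.sum_congr rfl h1, Finset.sum_const]
  have h2 : (Finset.univ.filter (fun x => (Quotient.mk _ x : MulAction.orbitRel.Quotient G X) = ω)).card
      = Nat.card (MulAction.orbit G ω.out) := by
    rw [← Fintype.card_subtype, ← Nat.card_eq_fintype_card]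
    refine Nat.card_congr (Equiv.subtypeEquivRight fun x => ?_)
    rw [← MulAction.orbitRel_apply]
    constructor
    · intro h; apply Quotient.exact; rw [h, Quotient.out_eq]
    · intro h; rw [← Quotient.out_eq ω]; exact Quotient.sound h
  have h3 : Nat.card (MulAction.orbit G ω.out) * Nat.card (MulAction.stabilizer G ω.out) = Nat.card G := by
    rw [Nat.card_congr (MulAction.orbitEquivQuotientStabilizer G ω.out)]
    exact (Subgroup.card_eq_card_quotient_mul_card_subgroup _).symm
  have h4 : (Nat.card G : ℂ) ≠ 0 := by simp
  rw [h2, ← h3]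
  rw [← h3] at h4
  push_cast at h4 ⊢
  have h5 := left_ne_zero_of_mul h4
  have h6 := right_ne_zero_of_mul h4
  rw [nsmul_eq_mul]
  field_simp

theorem trace_conj_mulHom {G : Type} [Group G] {ι : Type} [Fintype ι] [DecidableEq ι]
    (ρ : G →ₙ* Matrix ι ι ℂ) (g h : G) : (ρ (h * g * h⁻¹)).trace = (ρ g).trace := by
  rw [map_mul, Matrix.trace_mul_comm, ← map_mul, ← mul_assoc]; simp

open Classical in
/-- induction -/
theorem Virt.ind {R : Subring ℂ} {G X : Type} [Group G] [Finite G] [MulAction G X] [Fintype X]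
    (F : G → X → ℂ) (hF : ∀ g h x, g • x = x → F (h * g * h⁻¹) (h • x) = F g x)
    (hV : ∀ x, Virt R (fun g : MulAction.stabilizer G x => F g x)) :
    Virt R (fun g => ∑ x, if g • x = x then F g x else 0) := by
  haveI := Fintype.ofFinite G
  intro ι _ _ ρ
  set c : X → ℂ := fun x => ∑ g : G, if g • x = x then F g x * (ρ g⁻¹).trace else 0 with hcdef
  have hc : ∀ (h : G) x, c (h • x) = c x := by
    intro h x
    simp only [hcdef]
    refine (Fintype.sum_equiv ((Equiv.mulLeft h).trans (Equiv.mulRight h⁻¹)) _ _ fun g => ?_).symm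
    have e : (h * g * h⁻¹) • h • x = h • x ↔ g • x = x := by
      simp [mul_smul]
    have e2 : (h * g * h⁻¹)⁻¹ = h * g⁻¹ * h⁻¹ := by group
    show (if g • x = x then F g x * (ρ g⁻¹).trace else 0) = if (h * g * h⁻¹) • h • x = h • x then
      F (h * g * h⁻¹) (h • x) * (ρ (h * g * h⁻¹)⁻¹).trace else 0
    by_cases hg : g • x = x
    · rw [if_pos (e.2 hg), if_pos hg, hF g h x hg, e2, trace_conj_mulHom]
    · rw [if_neg (fun h => hg (e.1 h)), if_neg hg]
  have key := orbit_sum c hc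
  have : BB (fun g => ∑ x, if g • x = x then F g x else 0) (fun g => (ρ g).trace)
      = (Nat.card G : ℂ)⁻¹ * ∑ x, c x := by
    rw [BB_eq, Nat.card_eq_fintype_card]
    congr 1
    simp only [hcdef, Finset.sum_mul, ite_mul, zero_mul]
    rw [Finset.sum_comm]
  rw [this, key]
  haveI : Fintype (MulAction.orbitRel.Quotient G X) := Fintype.ofFinite _
  rw [finsum_eq_sum_of_fintype]
  refine R.sum_mem fun ω _ => ?_
  have := hV ω.out ι (ρ.comp ((MulAction.stabilizer G ω.out).subtype : _ →ₙ* G))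
  convert this using 1
  haveI : Fintype (MulAction.stabilizer G ω.out) := Fintype.ofFinite _
  rw [BB_eq, Nat.card_eq_fintype_card]
  congr 1
  simp only [hcdef]
  rw [← Finset.sum_filter]
  refine (Finset.sum_subtype _ (fun g => ?_) _)
  simp [MulAction.mem_stabilizer_iff]

end KL

namespace KL

noncomputable abbrev OO : Subring ℂ := (integralClosure ℤ ℂ).toSubring

theorem mem_OO {z : ℂ} : z ∈ OO ↔ IsIntegral ℤ z := Iff.rfl

theorem walk_sum {ι : Type} [Fintype ι] [DecidableEq ι] (A : Matrix ι ι ℂ) (k : ℕ) :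
    ∀ h : ι → ι → ℂ, ∑ x : Fin (k + 1) → ι, (∏ i : Fin k, A (x i.castSucc) (x i.succ)) * h (x 0) (x (Fin.last k))
      = ∑ a, ∑ b, (A ^ k) a b * h a b := by
  induction k with
  | zero =>
    intro h
    simp only [Finset.univ_eq_empty, Finset.prod_empty, one_mul, pow_zero]
    rw [Fintype.sum_equiv (Equiv.funUnique (Fin 1) ι) _ (fun a => h a a) (fun x => by
      simp [Fin.last])]
    refine Finset.sum_congr rfl fun a _ => ?_
    simp [Matrix.one_apply]
  | succ k ih =>
    intro h
    rw [← Equiv.sum_comp (Fin.consEquiv (fun _ => ι)), Fintype.sum_prod_type, Finset.sum_comm]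
    have := ih (fun c b => ∑ a, A a c * h a b)
    have e : ∀ y : Fin (k+1) → ι, ∑ a : ι, (∏ i : Fin (k+1), A ((Fin.consEquiv (fun _ => ι)) (a, y) i.castSucc) ((Fin.consEquiv (fun _ => ι)) (a, y) i.succ)) *
        h ((Fin.consEquiv (fun _ => ι)) (a, y) 0) ((Fin.consEquiv (fun _ => ι)) (a, y) (Fin.last (k+1)))
        = (∏ i : Fin k, A (y i.castSucc) (y i.succ)) * ∑ a, A a (y 0) * h a (y (Fin.last k)) := by
      intro y
      rw [Finset.mul_sum]
      refine Finset.sum_congr rfl fun a _ => ?_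
      rw [Fin.prod_univ_succ]
      simp only [Fin.consEquiv_apply, Fin.castSucc_zero, Fin.cons_zero, Fin.cons_succ, ← Fin.succ_last, ← Fin.succ_castSucc]
      ring
    rw [Finset.sum_congr rfl fun y _ => e y, this]
    simp only [Finset.mul_sum]
    rw [Finset.sum_congr rfl fun a _ => Finset.sum_comm]
    rw [Finset.sum_comm]
    refine Finset.sum_congr rfl fun a _ => ?_
    rw [Finset.sum_comm]
    refine Finset.sum_congr rfl fun b _ => ?_
    rw [pow_succ', Matrix.mul_apply, Finset.sum_mul]
    refine Finset.sum_congr rfl fun c _ => ?_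
    ring

theorem cyc_walk {ι : Type} [Fintype ι] [DecidableEq ι] (A : Matrix ι ι ℂ) (k : ℕ) :
    ∑ x : Fin (k + 1) → ι, ∏ i : Fin (k + 1), A (x i) (x (i + 1)) = (A ^ (k + 1)).trace := by
  have h := walk_sum A k (fun a b => A b a)
  rw [pow_succ, Matrix.trace]
  simp only [Matrix.diag_apply, Matrix.mul_apply]
  rw [← h]
  refine Finset.sum_congr rfl fun x _ => ?_
  rw [Fin.prod_univ_castSucc]
  simp [Fin.coeSucc_eq_succ]

theorem perm_commute {α : Type} [Fintype α] [DecidableEq α] (e : Equiv.Perm α) (P : Matrix α α ℂ)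
    (h : ∀ p q, P (e p) (e q) = P p q) (hP : P * P = P) :
    IsIntegral ℤ (∑ p, P (e p) p) := by
  have h1 : ∀ k : ℕ, (e ^ k).permMatrix ℂ = (e.permMatrix ℂ) ^ k := by
    intro k
    induction k with
    | zero => simp
    | succ k ih => rw [pow_succ', Matrix.permMatrix_mul, ih, pow_succ]
  set S := e.permMatrix ℂ with hS
  have hSP : S * P = P.submatrix e id := PEquiv.toMatrix_toPEquiv_mul e P
  have hc : Commute S P := by
    show S * P = P * S
    rw [hSP]
    have : P * S = P.submatrix id e.symm := PEquiv.mul_toMatrix_toPEquiv P e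
    rw [this]
    ext p q
    have := h p (e.symm q)
    simpa using this
  have hN : S ^ orderOf e = 1 := by rw [← h1, pow_orderOf_eq_one]; simp
  have hPk : ∀ k : ℕ, P ^ (k + 1) = P := by
    intro k
    induction k with
    | zero => simp
    | succ k ih => rw [pow_succ, ih, hP]
  have := trace_integral (S * P) (N := orderOf e) (orderOf_pos e) (by
    rw [hc.mul_pow, hPk, pow_succ, hN, one_mul])
  rw [hSP] at this
  simpa [Matrix.trace] using this

theorem adams_rep {G : Type} [Group G] [Finite G] {ι : Type} [Fintype ι] [DecidableEq ι]
    (ρ : G →* Matrix ι ι ℂ) (k : ℕ) : Virt OO (fun g => (ρ g ^ (k + 1)).trace) := by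
  classical
  haveI := Fintype.ofFinite G
  intro κ _ _ σ
  let τ : G →ₙ* Matrix ((Fin (k+1) → ι) × κ) ((Fin (k+1) → ι) × κ) ℂ :=
    { toFun := fun g => Matrix.of fun p q => (∏ i, ρ g (p.1 i) (q.1 i)) * σ g⁻¹ q.2 p.2
      map_mul' := fun g h => by
        ext p q
        simp only [Matrix.mul_apply, map_mul, mul_inv_rev, Matrix.of_apply]
        rw [Finset.prod_univ_sum, Fintype.sum_prod_type]
        simp only [Fintype.piFinset_univ, Finset.sum_mul_sum]
        refine Finset.sum_congr rfl fun x _ => ?_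
        refine Finset.sum_congr rfl fun y _ => ?_
        rw [Finset.prod_mul_distrib]
        ring }
  have hτ : ∀ g p q, τ g p q = (∏ i, ρ g (p.1 i) (q.1 i)) * σ g⁻¹ q.2 p.2 := fun g p q => rfl
  let e : Equiv.Perm ((Fin (k+1) → ι) × κ) :=
    Equiv.prodCongr (Equiv.arrowCongr (Equiv.addRight (1 : Fin (k+1))) (Equiv.refl ι)) (Equiv.refl κ)
  have he1 : ∀ p i, (e p).1 (i + 1) = p.1 i := by
    intro p i
    simp [e, Equiv.arrowCongr]
  have he2 : ∀ p, (e p).2 = p.2 := fun p => rfl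
  have key := perm_commute e _ ?_ (avg_idem τ)
  · rw [mem_OO, BB_eq]
    convert key using 1
    simp only [Matrix.smul_apply, Matrix.sum_apply, smul_eq_mul]
    rw [← Finset.mul_sum, Finset.sum_comm]
    congr 1
    refine Finset.sum_congr rfl fun g _ => ?_
    rw [Fintype.sum_prod_type, ← cyc_walk, Matrix.trace, Finset.sum_mul_sum]
    refine Finset.sum_congr rfl fun x _ => ?_
    refine Finset.sum_congr rfl fun y _ => ?_
    rw [hτ, he2]
    congr 1
    refine Fintype.prod_equiv (Equiv.addRight (1 : Fin (k+1))) _ _ fun i => ?_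
    rw [Equiv.coe_addRight, he1]
  · intro p q
    simp only [Matrix.smul_apply, Matrix.sum_apply, smul_eq_mul]
    congr 1
    refine Finset.sum_congr rfl fun g _ => ?_
    rw [hτ, hτ, he2, he2]
    congr 1
    refine (Fintype.prod_equiv (Equiv.addRight (1 : Fin (k+1))) _ _ fun i => ?_).symm
    rw [Equiv.coe_addRight, he1, he1]

theorem Virt.adams {G : Type} [Group G] [Finite G] {f : G → ℂ} (hc : IsClass f) (hf : Virt OO f) (m : ℕ)
    (hm : 0 < m) : Virt OO (fun g => f (g ^ m)) := by
  classical
  haveI := Fintype.ofFinite G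
  obtain ⟨r, d, ρ, h1, -⟩ := wedderburn G
  obtain ⟨k, rfl⟩ : ∃ k, m = k + 1 := ⟨m - 1, by omega⟩
  have : (fun g => f (g ^ (k+1))) = fun g => ∑ i, BB f (fun g => (ρ i g).trace) * (ρ i g ^ (k+1)).trace := by
    funext g
    rw [h1 f hc]
    simp [map_pow]
  rw [this]
  exact Virt.sum fun i _ => (adams_rep (ρ i) k).smul (hf _ (ρ i).toMulHom)

end KL

namespace KL

open Classical in
noncomputable def FF {G : Type} [Group G] [Fintype G] (y : G) (P : Subgroup G) (g : G) : ℂ :=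
  (Fintype.card P : ℂ)⁻¹ * ∑ x : G, ∑ u : P, if g = x * (y * u) * x⁻¹ then 1 else 0

theorem FF_class {G : Type} [Group G] [Fintype G] (y : G) (P : Subgroup G) : IsClass (FF y P) := by
  classical
  intro g h
  unfold FF
  congr 1
  refine (Fintype.sum_equiv (Equiv.mulLeft h) _ _ fun x => ?_).symm
  refine Finset.sum_congr rfl fun u _ => ?_
  refine if_congr ?_ rfl rfl
  show g = _ ↔ h * g * h⁻¹ = h * x * (y * u) * (h * x)⁻¹
  constructor
  · rintro rfl; group
  · intro e
    have : g = h⁻¹ * (h * g * h⁻¹) * h := by group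
    rw [this, e]; group

theorem FF_virt {G : Type} [Group G] [Fintype G] (y : G) (P : Subgroup G)
    (hy : ∀ u ∈ P, y * u = u * y) : Virt OO (FF y P) := by
  classical
  intro ι _ _ ρ
  have hG : (Fintype.card G : ℂ) ≠ 0 := by simp
  have h1 : BB (FF y P) (fun g => (ρ g).trace) = (Fintype.card P : ℂ)⁻¹ * ∑ u : P, (ρ (y * u)⁻¹).trace := by
    rw [BB_eq]
    unfold FF
    simp only [mul_assoc _ _ (Matrix.trace _), ← Finset.mul_sum]
    rw [mul_left_comm]
    congr 1
    simp only [Finset.sum_mul]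
    rw [Finset.sum_comm]
    have : ∀ x : G, ∑ g : G, ∑ u : P, (if g = x * (y * u) * x⁻¹ then (1:ℂ) else 0) * (ρ g⁻¹).trace
        = ∑ u : P, (ρ (y * u)⁻¹).trace := by
      intro x
      rw [Finset.sum_comm]
      refine Finset.sum_congr rfl fun u _ => ?_
      simp only [ite_mul, one_mul, zero_mul, Finset.sum_ite_eq', Finset.mem_univ, if_true]
      have : (x * (y * u) * x⁻¹)⁻¹ = x * (y * (u:G))⁻¹ * x⁻¹ := by group
      rw [this, trace_conj_mulHom]
    rw [Finset.sum_congr rfl fun x _ => this x, Finset.sum_const, Finset.card_univ, nsmul_eq_mul,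
      ← mul_assoc, inv_mul_cancel₀ hG, one_mul]
  have hid := avg_idem (ρ.comp (P.subtype : P →ₙ* G))
  set E := (Fintype.card P : ℂ)⁻¹ • ∑ u, (ρ.comp (P.subtype : P →ₙ* G)) u with hE
  have hpow : ∀ k : ℕ, ρ (y⁻¹) ^ (k + 1) = ρ ((y⁻¹) ^ (k+1)) := by
    intro k
    induction k with
    | zero => simp
    | succ k ih => rw [pow_succ, ih, ← map_mul, ← pow_succ]
  have hcomm : Commute (ρ y⁻¹) E := by
    rw [hE]
    apply Commute.smul_right
    apply Commute.sum_right
    intro u _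
    show ρ y⁻¹ * ρ u = ρ u * ρ y⁻¹
    rw [← map_mul, ← map_mul]
    congr 1
    rw [inv_mul_eq_iff_eq_mul, ← mul_assoc, hy u u.2]; group
  have hPk : ∀ k : ℕ, E ^ (k + 1) = E := by
    intro k
    induction k with
    | zero => simp
    | succ k ih => rw [pow_succ, ih, hid]
  have := trace_integral (ρ y⁻¹ * E) (N := Fintype.card G) Fintype.card_pos (by
    rw [hcomm.mul_pow, hPk, hpow, pow_succ, pow_card_eq_one, one_mul])
  rw [mem_OO, h1]
  convert this using 1
  rw [hE, mul_smul_comm, Matrix.trace_smul, smul_eq_mul]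
  congr 1
  rw [Finset.mul_sum, Matrix.trace_sum]
  rw [← Equiv.sum_comp (Equiv.inv P)]
  refine Finset.sum_congr rfl fun u _ => ?_
  show _ = (ρ y⁻¹ * ρ u).trace
  rw [← map_mul]
  have : (y * ((u⁻¹ : P) : G))⁻¹ = y⁻¹ * u := by
    rw [mul_inv_rev]
    simp
    rw [eq_inv_mul_iff_mul_eq, ← mul_assoc, hy u u.2]; group
  simp only [Equiv.inv_apply]
  rw [this]

theorem pInt {G : Type} [Group G] [Finite G] (p e M : ℕ) [Fact p.Prime]
    (he : 0 < e) (hee : ∀ g : G, (g ^ e) ^ e = g ^ e)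
    (hep : ∀ (g : G) (k : ℕ), g ^ (p ^ k) = 1 → g ^ e = 1)
    (hM : ∀ d : ℕ, d ∣ Nat.card G → Nat.Coprime d p → d ∣ M)
    (κ : G → ℂ) (hκ : IsClass κ) (hκO : ∀ g, κ g ∈ OO) (hκe : ∀ g, κ (g ^ e) = κ g) :
    Virt OO (fun g => (M : ℂ) * κ g) := by
  classical
  haveI := Fintype.ofFinite G
  have hconj : ∀ (g x : G), (x * g * x⁻¹) ^ e = x * g ^ e * x⁻¹ := fun g x => conj_pow
  -- Sylow subgroups of centralizers
  have hP : ∀ y : G, ∃ P : Subgroup G, (∀ u ∈ P, y * u = u * y) ∧ (∀ u ∈ P, u ^ e = 1) ∧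
      ∃ d : ℕ, d ∣ M ∧ d ≠ 0 ∧ Nat.card (Subgroup.centralizer {y}) = d * Nat.card P := by
    intro y
    let S : Sylow p (Subgroup.centralizer {y}) := default
    refine ⟨S.1.map (Subgroup.subtype _), ?_, ?_, S.1.index, ?_, ?_, ?_⟩
    · rintro u ⟨v, hv, rfl⟩
      have := v.2
      rw [Subgroup.mem_centralizer_singleton_iff] at this
      exact this.symm
    · rintro u ⟨v, hv, rfl⟩
      obtain ⟨k, hk⟩ := S.2 ⟨v, hv⟩
      apply hep _ k
      have := congrArg (fun z : S.1 => ((z : Subgroup.centralizer {y}) : G)) hk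
      simpa using this
    · apply hM
      · exact (Subgroup.index_dvd_card S.1).trans (Subgroup.card_subgroup_dvd_card _)
      · rw [Nat.coprime_comm, Nat.Prime.coprime_iff_not_dvd Fact.out]
        exact S.not_dvd_index
    · exact Subgroup.index_ne_zero_of_finite
    · rw [Subgroup.card_map_of_injective (Subgroup.subtype_injective _)]
      rw [mul_comm]
      exact (Subgroup.card_mul_index S.1).symm
  choose P hP1 hP2 d hd hd0 hd2 using hP
  have hF : ∀ y g : G, y ^ e = y → FF y (P y) (g ^ e) = if ConjClasses.mk (g ^ e) = ConjClasses.mk y then (d y : ℂ) else 0 := by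
    intro y g hy
    have h1 : ∀ x : G, ∀ u : P y, (g ^ e = x * (y * u) * x⁻¹) ↔ (u = 1 ∧ g ^ e = x * y * x⁻¹) := by
      intro x u
      constructor
      · intro h
        have h2 : g ^ e = x * y * x⁻¹ := by
          have h3 : (g ^ e) ^ e = x * (y * u) ^ e * x⁻¹ := by rw [h, hconj]
          rw [hee] at h3
          have h4 : (y * (u:G)) ^ e = y := by
            have : Commute y (u : G) := hP1 y u u.2
            rw [this.mul_pow, hy, hP2 y u u.2, mul_one]
          rw [h4] at h3
          exact h3
        refine ⟨?_, h2⟩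
        rw [h2] at h
        have h5 := mul_left_cancel (mul_right_cancel h)
        exact Subtype.ext (by simpa using h5)
      · rintro ⟨rfl, h⟩
        simpa using h
    unfold FF
    simp only [h1]
    have h2 : ∀ x : G, ∑ u : P y, (if (u = 1 ∧ g ^ e = x * y * x⁻¹) then (1:ℂ) else 0) = if g ^ e = x * y * x⁻¹ then 1 else 0 := by
      intro x
      by_cases h : g ^ e = x * y * x⁻¹
      · simp [h]
      · simp [h]
    rw [Finset.sum_congr rfl fun x _ => h2 x]
    by_cases hc : ConjClasses.mk (g ^ e) = ConjClasses.mk y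
    · rw [if_pos hc]
      rw [ConjClasses.mk_eq_mk_iff_isConj, isConj_comm, isConj_iff] at hc
      obtain ⟨x0, hx0⟩ := hc
      have hcount : (Finset.univ.filter fun x : G => g ^ e = x * y * x⁻¹).card = Nat.card (Subgroup.centralizer {y}) := by
        rw [← Fintype.card_subtype, ← Nat.card_eq_fintype_card]
        refine Nat.card_congr ⟨fun x => ⟨x0⁻¹ * x.1, ?_⟩, fun x => ⟨x0 * x.1, ?_⟩, ?_, ?_⟩
        · have := hx0.trans x.2
          rw [Subgroup.mem_centralizer_singleton_iff]
          have h3 : y = x0⁻¹ * (x0 * y * x0⁻¹) * x0 := by group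
          have h4 : x0⁻¹ * x.1 * y = x0⁻¹ * (x.1 * y * (x.1)⁻¹) * x.1 := by group
          rw [h4, ← this]; group
        · have := x.2
          rw [Subgroup.mem_centralizer_singleton_iff] at this
          rw [← hx0]
          have h4 : x0 * x.1 * y * (x0 * x.1)⁻¹ = x0 * (x.1 * y) * (x.1)⁻¹ * x0⁻¹ := by group
          rw [h4, this]; group
        · intro x; simp
        · intro x; simp
      rw [Finset.sum_boole, hcount, hd2, Nat.card_eq_fintype_card]
      have : (Fintype.card (P y) : ℂ) ≠ 0 := by simp
      push_cast
      field_simp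
    · rw [if_neg hc]
      rw [Finset.sum_eq_zero, mul_zero]
      intro x _
      rw [if_neg]
      intro h
      apply hc
      rw [ConjClasses.mk_eq_mk_iff_isConj, isConj_comm, isConj_iff]
      exact ⟨x, h.symm⟩
  have hex : ∀ C : ConjClasses G, ∃ a, ConjClasses.mk a = C := fun C => ConjClasses.exists_rep C
  choose out hout using hex
  have hsum : (fun g => (M : ℂ) * κ g) = fun g => ∑ C : ConjClasses G,
      (if out C ^ e = out C then κ (out C) * ((M / d (out C) : ℕ) : ℂ) else 0) * FF (out C) (P (out C)) (g ^ e) := by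
    funext g
    rw [Finset.sum_eq_single (ConjClasses.mk (g ^ e))]
    · generalize hC : ConjClasses.mk (g ^ e) = C
      have hcj : IsConj (g ^ e) (out C) := by rw [← ConjClasses.mk_eq_mk_iff_isConj, hout, hC]
      obtain ⟨x, hx⟩ := isConj_iff.1 hcj
      have h1 : out C ^ e = out C := by rw [← hx, hconj, hee]
      have h2 : κ (out C) = κ g := by rw [← hx, hκ, hκe]
      rw [if_pos h1, hF _ _ h1, if_pos (by rw [hout, hC]), h2]
      rw [mul_assoc, ← Nat.cast_mul, Nat.div_mul_cancel (hd _), mul_comm]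
    · intro C _ hC
      by_cases h1 : out C ^ e = out C
      · rw [hF _ _ h1, if_neg (show ¬ ConjClasses.mk (g^e) = ConjClasses.mk (out C) from by
          rw [hout]; exact fun h => hC h.symm), mul_zero]
      · rw [if_neg h1, zero_mul]
    · simp
  rw [hsum]
  refine Virt.sum fun C _ => Virt.smul ?_ ?_
  · exact Virt.adams (FF_class _ _) (FF_virt _ _ (hP1 _)) e he
  · split_ifs
    · exact OO.mul_mem (hκO _) (natCast_mem _ _)
    · exact OO.zero_mem

end KL

namespace KL

/-- action of a group on the submodules through a linear representation -/
@[reducible] def subAct {G K U : Type} [Group G] [Field K] [AddCommGroup U] [Module K U]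
    (r : G →* (Module.End K U)ˣ) : MulAction G (Submodule K U) where
  smul g W := W.map ((r g : (Module.End K U)ˣ) : Module.End K U)
  one_smul W := by
    show W.map ((r 1 : (Module.End K U)ˣ) : Module.End K U) = W
    rw [map_one]; exact Submodule.map_id W
  mul_smul a b W := by
    show W.map ((r (a * b) : (Module.End K U)ˣ) : Module.End K U) = (W.map _).map _
    rw [map_mul, ← Submodule.map_comp]; rfl

section torus
variable {K U ι : Type} [Field K] [Fintype K] [AddCommGroup U] [Module K U] [Finite U] [Fintype ι]

noncomputable def pj (v : Module.Basis ι K U) (i : ι) : Module.End K U := (v.coord i).smulRight (v i)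

theorem pj_apply (v : Module.Basis ι K U) (i : ι) (w : U) : pj v i w = v.repr w i • v i := rfl

theorem pj_mul (v : Module.Basis ι K U) (i : ι) : pj v i * pj v i = pj v i := by
  ext w
  simp [pj_apply]

theorem pj_mul' (v : Module.Basis ι K U) (i j : ι) (hij : i ≠ j) : pj v i * pj v j = 0 := by
  ext w
  simp [pj_apply, hij, Finsupp.single_apply, hij.symm]

theorem pj_comm (v : Module.Basis ι K U) (i j : ι) : pj v i * pj v j = pj v j * pj v i := by
  by_cases h : i = j
  · rw [h]
  · rw [pj_mul' v i j h, pj_mul' v j i (Ne.symm h)]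

noncomputable def tau0 (v : Module.Basis ι K U) (i : ι) : Kˣ →* Module.End K U where
  toFun t := 1 + ((t : K) - 1) • pj v i
  map_one' := by simp
  map_mul' a b := by
    rw [mul_add, mul_one, add_mul, one_mul, smul_mul_smul_comm, pj_mul, add_assoc, ← add_smul, ← add_smul]
    congr 2
    push_cast; ring

noncomputable def tau (v : Module.Basis ι K U) (i : ι) : Kˣ →* (Module.End K U)ˣ := (tau0 v i).toHomUnits

theorem tau_apply (v : Module.Basis ι K U) (i : ι) (t : Kˣ) :
   ((tau v i t : (Module.End K U)ˣ) : Module.End K U) = 1 + ((t : K) - 1) • pj v i := rfl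

theorem tau_comm (v : Module.Basis ι K U) (i j : ι) (t : Kˣ) :
   (tau v i t : (Module.End K U)ˣ) * pj v j = pj v j * (tau v i t : (Module.End K U)ˣ) := by
  rw [tau_apply, mul_add, add_mul, one_mul, mul_one, smul_mul_assoc, mul_smul_comm, pj_comm]

theorem fix_iff (v : Module.Basis ι K U) (j : ι) (a : (Module.End K U)ˣ)
    (ha : (a : Module.End K U) * pj v j = pj v j * a) (W : Submodule K U) :
    (W.map (a : Module.End K U) ≤ (W.map (a : Module.End K U)).comap (pj v j)) ↔ W ≤ W.comap (pj v j) := by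
  constructor
  · intro h w hw
    have h1 := h (Submodule.mem_map_of_mem (f := (a : Module.End K U)) hw)
    rw [Submodule.mem_comap] at h1
    obtain ⟨w', hw', e⟩ := h1
    rw [Submodule.mem_comap]
    have h2 : (a : Module.End K U) w' = (a : Module.End K U) (pj v j w) := by
      rw [e]; exact (LinearMap.congr_fun ha w).symm
    have h3 : w' = pj v j w := by
      have := congrArg (fun z => ((a⁻¹ : (Module.End K U)ˣ) : Module.End K U) z) h2
      simpa [← Module.End.mul_apply] using this
    rw [← h3]; exact hw'
  · rintro h _ ⟨w, hw, rfl⟩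
    rw [Submodule.mem_comap]
    exact ⟨pj v j w, h hw, LinearMap.congr_fun ha w⟩

open Classical in
theorem torus_step (v : Module.Basis ι K U) (i : ι) [Fintype (Submodule K U)] (c : Submodule K U → ℂ)
    (hc : ∀ W, c W ∈ OO)
    (hinv : ∀ (t : Kˣ) W, c (W.map (tau v i t : (Module.End K U)ˣ).1) = c W) :
    ∃ z ∈ OO, ∑ W, c W = (∑ W, if W ≤ W.comap (pj v i) then c W else 0) + ((Fintype.card K - 1 : ℕ) : ℂ) * z := by
  letI := subAct (tau v i)
  set c' : Submodule K U → ℂ := fun W => if W ≤ W.comap (pj v i) then 0 else c W with hc'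
  have h1 := orbit_sum (G := Kˣ) (X := Submodule K U) c' (by
    intro t W
    show c' (W.map (tau v i t : (Module.End K U)ˣ).1) = c' W
    simp only [hc']
    rw [hinv]
    refine if_congr (fix_iff v i _ (tau_comm v i i t) W) rfl rfl)
  have hcard : Nat.card Kˣ = Fintype.card K - 1 := by
    rw [Nat.card_eq_fintype_card, Fintype.card_units]
  have hne : ((Nat.card Kˣ : ℕ) : ℂ) ≠ 0 := by exact_mod_cast Nat.card_pos.ne'
  refine ⟨(Nat.card Kˣ : ℂ)⁻¹ * ∑ W, c' W, ?_, ?_⟩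
  · rw [h1]
    haveI : Fintype (MulAction.orbitRel.Quotient Kˣ (Submodule K U)) := Fintype.ofFinite _
    rw [finsum_eq_sum_of_fintype]
    refine OO.sum_mem fun ω _ => ?_
    generalize Quotient.out ω = W
    by_cases hW : W ≤ W.comap (pj v i)
    · simp only [hc', if_pos hW, mul_zero]; exact OO.zero_mem
    · have : Nat.card (MulAction.stabilizer Kˣ W) = 1 := by
        rw [Nat.card_eq_one_iff_unique]
        refine ⟨⟨?_⟩, ⟨1⟩⟩
        suffices H : ∀ t : MulAction.stabilizer Kˣ W, t = 1 by
          intro a b; rw [H a, H b]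
        rintro ⟨t, ht⟩
        have ht' : W.map (tau v i t : (Module.End K U)ˣ).1 = W := ht
        by_contra hne
        apply hW
        have ht1 : (t : K) - 1 ≠ 0 := by
          intro h0
          apply hne
          apply Subtype.ext
          exact Units.ext (sub_eq_zero.1 h0)
        intro w hw
        have h2 : (tau v i t : (Module.End K U)ˣ).1 w ∈ W := by
          rw [← ht']; exact Submodule.mem_map_of_mem hw
        rw [tau_apply] at h2
        have h3 := W.smul_mem ((t : K) - 1)⁻¹ (W.sub_mem h2 hw)
        simpa [smul_smul, inv_mul_cancel₀ ht1] using h3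
      rw [this]
      simp only [hc', if_neg hW, Nat.cast_one, inv_one, one_mul]
      exact hc W
  · rw [← hcard, mul_inv_cancel_left₀ hne, ← Finset.sum_add_distrib]
    refine Finset.sum_congr rfl fun W _ => ?_
    by_cases hW : W ≤ W.comap (pj v i) <;> simp [hc', hW]

open Classical in
theorem torus_congr (v : Module.Basis ι K U) [Fintype (Submodule K U)] (c : Submodule K U → ℂ)
    (hc : ∀ W, c W ∈ OO)
    (hinv : ∀ i (t : Kˣ) W, c (W.map (tau v i t : (Module.End K U)ˣ).1) = c W) :
    ∃ z ∈ OO, ∑ W, c W = (∑ W, if ∀ i, W ≤ W.comap (pj v i) then c W else 0) + ((Fintype.card K - 1 : ℕ) : ℂ) * z := by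
  have key : ∀ S : Finset ι, ∃ z ∈ OO, ∑ W, c W = (∑ W, if ∀ i ∈ S, W ≤ W.comap (pj v i) then c W else 0) + ((Fintype.card K - 1 : ℕ) : ℂ) * z := by
    intro S
    induction S using Finset.induction_on with
    | empty => exact ⟨0, OO.zero_mem, by simp⟩
    | insert i S hi ih =>
      obtain ⟨z, hz, e⟩ := ih
      obtain ⟨z', hz', e'⟩ := torus_step v i (fun W => if ∀ i ∈ S, W ≤ W.comap (pj v i) then c W else 0)
        (fun W => by
          show (if _ then _ else _) ∈ OO
          split_ifs
          · exact hc W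
          · exact OO.zero_mem)
        (fun t W => by
          show (if _ then _ else _) = if _ then _ else _
          rw [hinv]
          refine if_congr ?_ rfl rfl
          refine forall₂_congr fun j _ => fix_iff v j _ (tau_comm v i j t) W)
      refine ⟨z' + z, OO.add_mem hz' hz, ?_⟩
      rw [e, e', mul_add, ← add_assoc]
      congr 2
      refine Finset.sum_congr rfl fun W _ => ?_
      simp only [Finset.forall_mem_insert]
      by_cases h1 : W ≤ W.comap (pj v i) <;> by_cases h2 : ∀ i ∈ S, W ≤ W.comap (pj v i) <;> simp [h1, h2]
  obtain ⟨z, hz, e⟩ := key Finset.univ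
  refine ⟨z, hz, ?_⟩
  rw [e]
  simp only [Finset.mem_univ, forall_true_left]

open Classical in
theorem fixed_sum (v : Module.Basis ι K U) [Fintype (Submodule K U)] (c : Submodule K U → ℂ) :
    (∑ W, if ∀ i, W ≤ W.comap (pj v i) then c W else 0) = ∑ J : Finset ι, c (Submodule.span K (v '' J)) := by
  rw [← Finset.sum_filter]
  symm
  have hmem : ∀ (J : Finset ι) (i : ι), v i ∈ Submodule.span K (v '' J) ↔ i ∈ J := by
    intro J i
    rw [v.mem_span_image]
    simp [Module.Basis.repr_self]
  refine Finset.sum_bij (fun J _ => Submodule.span K (v '' J)) ?_ ?_ ?_ ?_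
  · intro J _
    rw [Finset.mem_filter]
    refine ⟨Finset.mem_univ _, fun i => ?_⟩
    rw [Submodule.span_le]
    rintro _ ⟨j, hj, rfl⟩
    rw [SetLike.mem_coe, Submodule.mem_comap, pj_apply, v.repr_self, Finsupp.single_apply]
    split_ifs with h
    · subst h; rw [one_smul]; exact Submodule.subset_span ⟨_, hj, rfl⟩
    · rw [zero_smul]; exact Submodule.zero_mem _
  · intro J _ J' _ h
    ext i
    rw [← hmem, ← hmem, h]
  · intro W hW
    rw [Finset.mem_filter] at hW
    refine ⟨Finset.univ.filter fun i => v i ∈ W, Finset.mem_univ _, ?_⟩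
    apply le_antisymm
    · rw [Submodule.span_le]
      rintro _ ⟨j, hj, rfl⟩
      simpa using hj
    · intro w hw
      rw [v.mem_span_image]
      intro i hi
      have h1 := hW.2 i hw
      rw [Submodule.mem_comap, pj_apply] at h1
      have h2 := W.smul_mem (v.repr w i)⁻¹ h1
      rw [smul_smul, inv_mul_cancel₀ (by simpa using hi), one_smul] at h2
      simpa using h2
  · intro J _; rfl

end torus
end KL

namespace KL

section diag
variable {K U : Type} [Field K] [Fintype K] [AddCommGroup U] [Module K U]

theorem eigen_span (h : Module.End K U) (hh : h ^ Fintype.card K = h) :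
    ⊤ ≤ Submodule.span K {w | ∃ a : K, h w = a • w} := by
  classical
  have hQ : 1 < Fintype.card K := Fintype.one_lt_card
  have hprod : (∏ a : K, (Polynomial.X - Polynomial.C a)) = (Polynomial.X ^ Fintype.card K - Polynomial.X : Polynomial K) := by
    have h1 := FiniteField.roots_X_pow_card_sub_X K
    have h2 := (FiniteField.X_pow_card_sub_X_natDegree_eq K hQ)
    have h3 := Polynomial.prod_multiset_X_sub_C_of_monic_of_roots_card_eq (p := (Polynomial.X ^ Fintype.card K - Polynomial.X : Polynomial K))
      (Polynomial.monic_X_pow_sub (by rw [Polynomial.degree_X]; exact_mod_cast hQ)) (by rw [h1, h2]; rfl)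
    rw [h1] at h3
    exact h3
  intro w _
  have h1 := Lagrange.sum_basis (F := K) (s := Finset.univ) (v := id) (fun _ _ _ _ e => e) Finset.univ_nonempty
  have h2 : w = ∑ a : K, Polynomial.aeval h (Lagrange.basis Finset.univ id a) w := by
    rw [← LinearMap.sum_apply, ← map_sum, h1, map_one]; rfl
  rw [h2]
  refine Submodule.sum_mem _ fun a _ => Submodule.subset_span ⟨a, ?_⟩
  have h3 : (Polynomial.X - Polynomial.C a) * Lagrange.basis Finset.univ id a = Polynomial.C (Lagrange.nodalWeight Finset.univ id a) * (Polynomial.X ^ Fintype.card K - Polynomial.X) := by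
    rw [Lagrange.basis, ← hprod]
    simp only [Lagrange.basisDivisor, Finset.prod_mul_distrib, Lagrange.nodalWeight, map_prod, id]
    rw [mul_left_comm, Finset.mul_prod_erase Finset.univ (fun b => (Polynomial.X - Polynomial.C b : Polynomial K)) (Finset.mem_univ a)]
  have h4 := LinearMap.congr_fun (congrArg (Polynomial.aeval h) h3) w
  simp only [map_mul, map_sub, Polynomial.aeval_X, Polynomial.aeval_C, map_pow, hh, sub_self, mul_zero, LinearMap.zero_apply,
    Module.End.mul_apply, LinearMap.sub_apply, Module.algebraMap_end_apply] at h4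
  exact sub_eq_zero.1 h4

theorem diag_basis (h : Module.End K U) (hh : h ^ Fintype.card K = h) :
    ∃ (ι : Type) (v : Module.Basis ι K U) (l : ι → K), ∀ i, h (v i) = l i • v i := by
  have hs := eigen_span h hh
  have h2 : ∀ i, ∃ a : K, h (Module.Basis.ofSpan hs i) = a • Module.Basis.ofSpan hs i := fun i =>
    Module.Basis.ofSpan_subset hs ⟨i, rfl⟩
  choose l hl using h2
  exact ⟨_, Module.Basis.ofSpan hs, l, hl⟩

open Classical in
noncomputable def detR (h : Module.End K U) (W : Submodule K U) : K :=
  if hW : ∀ w ∈ W, h w ∈ W then LinearMap.det (h.restrict hW) else 0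

theorem detR_of (h : Module.End K U) (W : Submodule K U) (hW : ∀ w ∈ W, h w ∈ W) :
    detR h W = LinearMap.det (h.restrict hW) := dif_pos hW

theorem detR_conj (h : Module.End K U) (x : (Module.End K U)ˣ) (W : Submodule K U) :
    detR (x.1 * h * (x⁻¹).1) (W.map x.1) = detR h W := by
  classical
  have hx : ∀ w, (x⁻¹).1 (x.1 w) = w := fun w => LinearMap.congr_fun x.inv_mul w
  have hx' : ∀ w, x.1 ((x⁻¹).1 w) = w := fun w => LinearMap.congr_fun x.mul_inv w
  by_cases hW : ∀ w ∈ W, h w ∈ W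
  · have hW' : ∀ w ∈ W.map x.1, (x.1 * h * (x⁻¹).1) w ∈ W.map x.1 := by
      rintro _ ⟨w, hw, rfl⟩
      refine ⟨h w, hW w hw, ?_⟩
      simp only [Module.End.mul_apply]
      rw [hx]
    rw [detR_of _ _ hW, detR_of _ _ hW']
    have hinj : Function.Injective x.1 := fun a b e => by
      have := congrArg (x⁻¹).1 e; rwa [hx, hx] at this
    let e : W ≃ₗ[K] W.map x.1 := Submodule.equivMapOfInjective x.1 hinj W
    rw [← LinearMap.det_conj (h.restrict hW) e]
    congr 1
    refine LinearMap.ext fun w0 => ?_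
    obtain ⟨w, hw⟩ := w0
    obtain ⟨u, hu, rfl⟩ := id hw
    apply Subtype.ext
    have he : e.symm ⟨x.1 u, hw⟩ = ⟨u, hu⟩ := by
      rw [LinearEquiv.symm_apply_eq]; rfl
    simp only [LinearMap.comp_apply, LinearEquiv.coe_coe, he]
    show (x.1 * h * (x⁻¹).1) (x.1 u) = x.1 (h u)
    simp only [Module.End.mul_apply]
    rw [hx]
  · rw [detR, detR, dif_neg hW, dif_neg]
    intro H
    apply hW
    intro w hw
    obtain ⟨u, hu, e⟩ := H (x.1 w) ⟨w, hw, rfl⟩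
    simp only [Module.End.mul_apply] at e
    rw [hx] at e
    have := congrArg (x⁻¹).1 e
    rw [hx, hx] at this
    rwa [← this]

theorem detR_span {ι : Type} (v : Module.Basis ι K U) (h : Module.End K U) (l : ι → K)
    (hl : ∀ i, h (v i) = l i • v i) (J : Finset ι) :
    detR h (Submodule.span K (v '' J)) = ∏ i ∈ J, l i := by
  classical
  have hW : ∀ w ∈ Submodule.span K (v '' J), h w ∈ Submodule.span K (v '' J) := by
    show Submodule.span K (v '' J) ≤ (Submodule.span K (v '' J)).comap h
    rw [Submodule.span_le]
    rintro _ ⟨j, hj, rfl⟩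
    show h (v j) ∈ Submodule.span K (v '' J)
    rw [hl]
    exact Submodule.smul_mem _ _ (Submodule.subset_span ⟨j, hj, rfl⟩)
  rw [detR_of _ _ hW]
  have hli : LinearIndependent K (fun j : J => v j) := v.linearIndependent.comp _ Subtype.val_injective
  have hr : Set.range (fun j : J => v j) = v '' J := by
    ext w; simp
  let b0 := Module.Basis.span hli
  let e : Submodule.span K (Set.range (fun j : J => v j)) ≃ₗ[K] Submodule.span K (v '' J) := LinearEquiv.ofEq _ _ (by rw [hr])
  let b := b0.map e
  have hb : ∀ j : J, ((b j : Submodule.span K (v '' J)) : U) = v j := by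
    intro j
    show ((b0 j : Submodule.span K (Set.range (fun j : J => v j))) : U) = v j
    rw [Module.Basis.span_apply]
  rw [← LinearMap.det_toMatrix b]
  have : LinearMap.toMatrix b b (h.restrict hW) = Matrix.diagonal (fun j : J => l j) := by
    ext i j
    rw [LinearMap.toMatrix_apply]
    have : (h.restrict hW) (b j) = l j • b j := by
      apply Subtype.ext
      show h (b j) = l j • ((b j : Submodule.span K (v '' J)) : U)
      rw [hb, hl]
    rw [this, map_smul, Module.Basis.repr_self, Matrix.diagonal_apply]
    simp [Finsupp.single_apply]
    by_cases hij : i = j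
    · simp [hij]
    · simp [hij, Ne.symm hij]
  rw [this, Matrix.det_diagonal, Finset.prod_coe_sort]

theorem finrank_span_J {ι : Type} (v : Module.Basis ι K U) (J : Finset ι) :
    Module.finrank K (Submodule.span K (v '' J)) = J.card := by
  have hli : LinearIndependent K (fun j : J => v j) := v.linearIndependent.comp _ Subtype.val_injective
  have hr : Set.range (fun j : J => v j) = v '' J := by
    ext w; simp
  rw [← hr, finrank_span_eq_card hli]; simp

open Classical in
noncomputable def piS [Fintype (Submodule K U)] (s : ℕ) (θ : MulChar K ℂ) (h : Module.End K U) : ℂ :=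
  ∑ W : Submodule K U, if Module.finrank K W = s then θ (detR h W) else 0

theorem mulChar_OO (θ : MulChar K ℂ) (x : K) : θ x ∈ OO := by
  classical
  by_cases hx : IsUnit x
  · rw [mem_OO]
    apply IsIntegral.of_pow (n := Fintype.card Kˣ) Fintype.card_pos
    rw [← map_pow, ← hx.unit_spec, ← Units.val_pow_eq_pow_val, pow_card_eq_one]
    simp [isIntegral_one]
  · rw [θ.map_nonunit hx]; exact OO.zero_mem

/-- value of the Grassmannian sum on a diagonalizable element -/
theorem piS_diag [Finite U] [Fintype (Submodule K U)] (s : ℕ) (θ : MulChar K ℂ) (h : Module.End K U)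
    (hh : h ^ Fintype.card K = h) :
    ∃ z ∈ OO, piS s θ h = (h.charpoly.roots.map θ).esymm s + ((Fintype.card K - 1 : ℕ) : ℂ) * z := by
  classical
  obtain ⟨ι, v, l, hl⟩ := diag_basis h hh
  haveI : Finite ι := Module.Finite.finite_basis v
  haveI := Fintype.ofFinite ι
  have hcomm : ∀ i, h * pj v i = pj v i * h := by
    intro i
    apply v.ext
    intro j
    simp only [Module.End.mul_apply, pj_apply, hl, map_smul, v.repr_self, Finsupp.smul_apply, Finsupp.single_apply]
    by_cases hij : j = i
    · simp [hij, hl]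
    · simp [hij]
  obtain ⟨z, hz, e⟩ := torus_congr v (fun W => if Module.finrank K W = s then θ (detR h W) else 0)
    (fun W => by
      show (if _ then _ else _) ∈ OO
      split_ifs
      · exact mulChar_OO _ _
      · exact OO.zero_mem) (fun i t W => by
      show (if _ then _ else _) = if _ then _ else _
      have h1 : Module.finrank K (W.map (tau v i t : (Module.End K U)ˣ).1) = Module.finrank K W := by
        refine (LinearEquiv.finrank_eq (Submodule.equivMapOfInjective (tau v i t : (Module.End K U)ˣ).1 ?_ W)).symm
        intro a b hab
        have := congrArg ((tau v i t)⁻¹ : (Module.End K U)ˣ).1 hab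
        have hx : ∀ w, ((tau v i t)⁻¹ : (Module.End K U)ˣ).1 ((tau v i t).1 w) = w := fun w => LinearMap.congr_fun (tau v i t).inv_mul w
        rwa [hx, hx] at this
      have h2 : h = (tau v i t : (Module.End K U)ˣ).1 * h * ((tau v i t)⁻¹ : (Module.End K U)ˣ).1 := by
        rw [Units.eq_mul_inv_iff_mul_eq, tau_apply, mul_add, add_mul, one_mul, mul_one, smul_mul_assoc, mul_smul_comm, hcomm]
      conv_lhs => rw [h2]
      rw [detR_conj, h1])
  refine ⟨z, hz, ?_⟩
  rw [piS, e, fixed_sum v]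
  congr 1
  have hroots : h.charpoly.roots = Finset.univ.val.map l := by
    rw [← LinearMap.charpoly_toMatrix h v]
    have : LinearMap.toMatrix v v h = Matrix.diagonal l := by
      ext i j
      rw [LinearMap.toMatrix_apply, hl, map_smul, Module.Basis.repr_self, Matrix.diagonal_apply]
      by_cases hij : i = j
      · simp [hij]
      · simp [hij, Finsupp.single_apply, Ne.symm hij]
    rw [this, Matrix.charpoly_diagonal]
    exact Polynomial.roots_multiset_prod_X_sub_C (Finset.univ.val.map l) ▸ (by
      congr 1
      rw [Multiset.map_map]; rfl)
  rw [hroots, Multiset.map_map, Finset.esymm_map_val]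
  rw [← Finset.sum_filter_add_sum_filter_not Finset.univ (fun J : Finset ι => J.card = s), add_comm]
  rw [Finset.sum_eq_zero, zero_add]
  · have : (Finset.univ.filter fun J : Finset ι => J.card = s) = Finset.univ.powersetCard s := by
      ext J; simp [Finset.mem_powersetCard]
    rw [this]
    refine Finset.sum_congr rfl fun J hJ => ?_
    rw [if_pos (by rw [finrank_span_J]; exact (Finset.mem_powersetCard.1 hJ).2), detR_span v h l hl, map_prod]
    rfl
  · intro J hJ
    rw [if_neg (by rw [finrank_span_J]; exact (Finset.mem_filter.1 hJ).2)]

end diag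
end KL

namespace KL

theorem map_eq_iff_stable {K U : Type} [Field K] [AddCommGroup U] [Module K U] [Module.Finite K U]
    (h : (Module.End K U)ˣ) (W : Submodule K U) : W.map h.1 = W ↔ ∀ w ∈ W, h.1 w ∈ W := by
  have hinj : Function.Injective h.1 := fun a b e => by
    have hx : ∀ w, (h⁻¹).1 (h.1 w) = w := fun w => LinearMap.congr_fun h.inv_mul w
    have := congrArg (h⁻¹).1 e; rwa [hx, hx] at this
  constructor
  · intro e w hw
    have := Submodule.mem_map_of_mem (f := h.1) hw
    rwa [e] at this
  · intro H
    apply Submodule.eq_of_le_of_finrank_eq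
    · rintro _ ⟨w, hw, rfl⟩
      exact H w hw
    · exact (LinearEquiv.finrank_eq (Submodule.equivMapOfInjective h.1 hinj W)).symm

theorem piS_virt {R : Subring ℂ} {G K U : Type} [Group G] [Finite G] [Field K] [Fintype K] [AddCommGroup U] [Module K U]
    [Finite U] [Fintype (Submodule K U)] (r : G →* (Module.End K U)ˣ) (s : ℕ) (θ : MulChar K ℂ) :
    Virt R (fun g => piS s θ (r g).1) := by
  classical
  letI := subAct r
  have key := Virt.ind (R := R) (G := G) (X := Submodule K U)
    (fun g W => if Module.finrank K W = s then θ (detR (r g).1 W) else 0)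
    (by
      intro g h W hg
      have h1 : Module.finrank K (h • W : Submodule K U) = Module.finrank K W := by
        refine (LinearEquiv.finrank_eq (Submodule.equivMapOfInjective (r h).1 ?_ W)).symm
        intro a b e
        have hx : ∀ w, ((r h)⁻¹).1 ((r h).1 w) = w := fun w => LinearMap.congr_fun (r h).inv_mul w
        have := congrArg ((r h)⁻¹).1 e; rwa [hx, hx] at this
      have h2 : detR (r (h * g * h⁻¹)).1 (h • W : Submodule K U) = detR (r g).1 W := by
        rw [← detR_conj (r g).1 (r h) W, map_mul, map_mul, map_inv]; rfl
      rw [h1, h2])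
    (by
      intro W
      have hst : ∀ g : MulAction.stabilizer G W, ∀ w ∈ W, (r g).1 w ∈ W := by
        intro g
        rw [← map_eq_iff_stable]; exact g.2
      by_cases hs : Module.finrank K W = s
      · simp only [if_pos hs]
        let χ : MulAction.stabilizer G W →* ℂ :=
          { toFun := fun g => θ (detR (r g).1 W)
            map_one' := by
              rw [detR_of _ _ (hst 1)]
              have : (r ((1 : MulAction.stabilizer G W) : G)).1.restrict (hst 1) = LinearMap.id := by
                ext w; simp
              rw [this, LinearMap.det_id, map_one]
            map_mul' := fun a b => by
              rw [detR_of _ _ (hst _), detR_of _ _ (hst a), detR_of _ _ (hst b), ← map_mul, ← map_mul]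
              congr 2
              ext w
              simp }
        exact Virt.char R χ
      · simp only [if_neg hs]
        have := Virt.smul (R := R) (Virt.char R (1 : MulAction.stabilizer G W →* ℂ)) (c := 0) R.zero_mem
        simpa using this)
  convert key using 2 with g
  rw [piS]
  refine Finset.sum_congr rfl fun W _ => ?_
  by_cases hg : g • W = W
  · rw [if_pos hg]
  · rw [if_neg hg]
    have : detR (r g).1 W = 0 := by
      rw [detR, dif_neg]
      rw [← map_eq_iff_stable]; exact hg
    rw [this, θ.map_zero, ite_self]

theorem charpoly_pow_Q {K U : Type} [Field K] [Fintype K] [AddCommGroup U] [Module K U] [Module.Finite K U]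
    (h : Module.End K U) (m : ℕ) : (h ^ (Fintype.card K ^ m)).charpoly = h.charpoly := by
  classical
  let b := Module.finBasis K U
  induction m with
  | zero => simp
  | succ m ih =>
    rw [pow_succ, pow_mul, ← ih]
    generalize h ^ Fintype.card K ^ m = f
    rw [← LinearMap.charpoly_toMatrix _ b, ← LinearMap.charpoly_toMatrix f b, ← LinearMap.toMatrix_pow,
      FiniteField.Matrix.charpoly_pow_card]

theorem multiset_OO (S : Multiset ℂ) (h : ∀ x ∈ S, x ∈ OO) (s : ℕ) : S.esymm s ∈ OO := by
  rw [Multiset.esymm]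
  apply multiset_sum_mem
  intro x hx
  obtain ⟨T, hT, rfl⟩ := Multiset.mem_map.1 hx
  apply multiset_prod_mem
  intro y hy
  exact h y (Multiset.mem_of_le (Multiset.mem_powersetCard.1 hT).1 hy)

theorem charpoly_conj_unit {F V : Type} [Field F] [AddCommGroup V] [Module F V] [Module.Finite F V]
    (g : Module.End F V) (x : (Module.End F V)ˣ) : (x.1 * g * (x⁻¹).1).charpoly = g.charpoly := by
  let e : V ≃ₗ[F] V := LinearMap.GeneralLinearGroup.toLinearEquiv x
  rw [← LinearEquiv.charpoly_conj e g]
  rfl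

theorem es_virt {F V K : Type} [Field F] [Field K] [Fintype K] [Algebra F K] [AddCommGroup V] [Module F V] [Finite V]
    (p m0 : ℕ) [Fact p.Prime] (hm0 : 0 < m0) (hp : Fintype.card K = p ^ m0)
    (hM : ∀ d, d ∣ Nat.card (Module.End F V)ˣ → Nat.Coprime d p → d ∣ Fintype.card K - 1) (s : ℕ) (θ : MulChar K ℂ) :
    Virt OO (fun g : (Module.End F V)ˣ => ((g.1.charpoly.aroots K).map θ).esymm s) := by
  classical
  let G := (Module.End F V)ˣ
  haveI : Finite F := Finite.of_injective _ (algebraMap F K).injective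
  haveI : Module.Finite F V := Module.Finite.of_finite
  let U := TensorProduct F K V
  haveI : Module.Finite K U := inferInstance
  haveI : Finite U := Module.finite_of_finite K
  haveI : Finite (Submodule K U) := Finite.of_injective (fun W : Submodule K U => (W : Set U)) SetLike.coe_injective
  haveI := Fintype.ofFinite (Submodule K U)
  haveI : Finite (Module.End F V) := Finite.of_injective (fun f : Module.End F V => (f : V → V)) DFunLike.coe_injective
  haveI : Finite G := inferInstance
  let r : G →* (Module.End K U)ˣ := Units.map (Module.End.baseChangeHom F K V).toRingHom.toMonoidHom
  have hr : ∀ g : G, (r g).1.charpoly.roots = g.1.charpoly.aroots K := by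
    intro g
    show (LinearMap.baseChange K g.1).charpoly.roots = _
    rw [LinearMap.charpoly_baseChange]
  set Q := Fintype.card K with hQ
  have hQ1 : 1 < Q := Fintype.one_lt_card
  set NG := Nat.card G with hNG
  have hNG0 : NG ≠ 0 := Nat.card_pos.ne'
  set e := Q ^ NG with he
  have he0 : 0 < e := pow_pos (by omega) _
  have hpp : p.Prime := Fact.out
  -- |G| divides e * (Q - 1)
  have hdvd : NG ∣ e * (Q - 1) := by
    obtain ⟨a, d, hd, hda⟩ := Nat.exists_eq_pow_mul_and_not_dvd hNG0 p hpp.ne_one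
    have h1 : d ∣ Q - 1 := hM d ⟨p ^ a, by rw [mul_comm]; exact hda⟩ ((Nat.Prime.coprime_iff_not_dvd hpp).2 hd).symm
    have h2 : a ≤ m0 * NG := by
      have : a < p ^ a := Nat.lt_pow_self hpp.one_lt
      have h3 : p ^ a ≤ NG := Nat.le_of_dvd (Nat.pos_of_ne_zero hNG0) ⟨d, hda⟩
      nlinarith
    have h4 : p ^ a ∣ e := by
      rw [he, hp, ← pow_mul]
      exact pow_dvd_pow p h2
    have h5 := Nat.mul_dvd_mul h4 h1
    rwa [← hda] at h5
  have hge : ∀ g : G, (g ^ e) ^ (Q - 1) = 1 := by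
    intro g
    rw [← pow_mul]
    exact orderOf_dvd_iff_pow_eq_one.1 ((orderOf_dvd_natCard g).trans hdvd)
  have hgeQ : ∀ g : G, (g ^ e) ^ Q = g ^ e := by
    intro g
    have : Q = (Q - 1) + 1 := by omega
    rw [this, pow_succ, hge, one_mul]
  have hgeQm : ∀ (g : G) (k : ℕ), (g ^ e) ^ (Q ^ k) = g ^ e := by
    intro g k
    induction k with
    | zero => simp
    | succ k ih => rw [pow_succ, pow_mul, ih, hgeQ]
  have hcp : ∀ g : G, (g ^ e).1.charpoly = g.1.charpoly := by
    intro g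
    have h1 : ((r (g ^ e)).1).charpoly = (r g).1.charpoly := by
      rw [map_pow, Units.val_pow_eq_pow_val, he, hQ]
      exact charpoly_pow_Q _ _
    have h2 : ∀ g : G, (r g).1.charpoly = g.1.charpoly.map (algebraMap F K) := fun g =>
      LinearMap.charpoly_baseChange _ _
    rw [h2, h2] at h1
    exact Polynomial.map_injective _ (algebraMap F K).injective h1
  set es : G → ℂ := fun g => ((g.1.charpoly.aroots K).map θ).esymm s with hes
  have hz : ∀ g : G, ∃ z ∈ OO, piS s θ (r (g ^ e)).1 = es g + ((Q - 1 : ℕ) : ℂ) * z := by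
    intro g
    obtain ⟨z, hz, e1⟩ := piS_diag s θ (r (g ^ e)).1 (by
      rw [← Units.val_pow_eq_pow_val, ← map_pow, hgeQ])
    refine ⟨z, hz, ?_⟩
    rw [e1, hr, hcp]
  have hQne : ((Q - 1 : ℕ) : ℂ) ≠ 0 := by
    rw [Nat.cast_ne_zero]; omega
  set κ : G → ℂ := fun g => ((Q - 1 : ℕ) : ℂ)⁻¹ * (piS s θ (r (g ^ e)).1 - es g) with hκ
  have hesc : IsClass es := by
    intro g h
    simp only [hes]
    have : (h * g * h⁻¹ : G).1.charpoly = g.1.charpoly := charpoly_conj_unit g.1 h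
    rw [this]
  have hpic : IsClass (fun g : G => piS s θ (r g).1) := by
    intro g h
    simp only [piS]
    refine (Fintype.sum_equiv (Equiv.ofBijective (fun W : Submodule K U => W.map (r h).1) ?_) _ _ fun W => ?_).symm
    · letI := subAct r
      exact MulAction.bijective h
    · have h1 : Module.finrank K (W.map (r h).1) = Module.finrank K W := by
        refine (LinearEquiv.finrank_eq (Submodule.equivMapOfInjective (r h).1 ?_ W)).symm
        intro a b e
        have hx : ∀ w, ((r h)⁻¹).1 ((r h).1 w) = w := fun w => LinearMap.congr_fun (r h).inv_mul w
        have := congrArg ((r h)⁻¹).1 e; rwa [hx, hx] at this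
      have h2 : detR (r (h * g * h⁻¹)).1 (W.map (r h).1) = detR (r g).1 W := by
        rw [← detR_conj (r g).1 (r h) W, map_mul, map_mul, map_inv]; rfl
      show _ = if Module.finrank K (W.map (r h).1) = s then θ (detR (r (h * g * h⁻¹)).1 (W.map (r h).1)) else 0
      rw [h1, h2]
  have hpie : IsClass (fun g : G => piS s θ (r (g ^ e)).1) := by
    intro g h
    have := hpic (g ^ e) h
    simp only [conj_pow]
    exact this
  have hκv : Virt OO (fun g => ((Q - 1 : ℕ) : ℂ) * κ g) := by
    apply pInt p e (Q - 1) he0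
    · intro g; exact hgeQm g NG
    · intro g k hk
      obtain ⟨j, hj, e1⟩ := (Nat.dvd_prime_pow hpp).1 (orderOf_dvd_of_pow_eq_one hk)
      apply orderOf_dvd_iff_pow_eq_one.1
      rw [e1, he, hp, ← pow_mul]
      apply pow_dvd_pow
      have h3 : j < p ^ j := Nat.lt_pow_self hpp.one_lt
      have h4 : p ^ j ≤ NG := by rw [← e1]; exact Nat.le_of_dvd (Nat.pos_of_ne_zero hNG0) (orderOf_dvd_natCard g)
      nlinarith
    · exact hM
    · intro g h
      have h1 : piS s θ (r ((h * g * h⁻¹) ^ e)).1 = piS s θ (r (g ^ e)).1 := hpie g h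
      simp only [hκ]
      rw [hesc, h1]
    · intro g
      obtain ⟨z, hz1, hz2⟩ := hz g
      simp only [hκ]
      rw [hz2, add_sub_cancel_left, inv_mul_cancel_left₀ hQne]
      exact hz1
    · intro g
      simp only [hκ]
      have h1 : (g ^ e) ^ e = g ^ e := hgeQm g NG
      have h2 : es (g ^ e) = es g := by simp only [hes]; rw [hcp]
      rw [h1, h2]
  have hfin := (Virt.adams hpic (piS_virt (R := OO) r s θ) e he0).sub hκv
  convert hfin using 2 with g
  simp only [hκ]
  rw [mul_inv_cancel_left₀ hQne, sub_sub_cancel]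

end KL

namespace KL

noncomputable def ZZ : Subring ℂ := (Int.castRingHom ℂ).range

theorem mem_ZZ (z : ℂ) : z ∈ ZZ ↔ ∃ k : ℤ, z = k := by
  constructor
  · rintro ⟨k, rfl⟩; exact ⟨k, rfl⟩
  · rintro ⟨k, rfl⟩; exact ⟨k, rfl⟩

theorem rat_of_poly (P : Polynomial ℤ) (N : ℕ) (hN : 0 < N) (ζ z : ℂ) (hζ : IsPrimitiveRoot ζ N)
    (h : ∀ j : ℕ, Nat.Coprime j N → Polynomial.aeval (ζ ^ j) P = z) : ∃ k : ℤ, z = k := by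
  classical
  set Φ := Polynomial.cyclotomic N ℤ with hΦ
  have hmon : Φ.Monic := Polynomial.cyclotomic.monic N ℤ
  set R := P %ₘ Φ with hR
  have hR2 : R + Φ * (P /ₘ Φ) = P := Polynomial.modByMonic_add_div P Φ
  set S : Polynomial ℂ := R.map (Int.castRingHom ℂ) - Polynomial.C z with hS
  have hroot : ∀ x ∈ primitiveRoots N ℂ, S.IsRoot x := by
    intro x hx
    rw [mem_primitiveRoots hN] at hx
    haveI : NeZero N := ⟨hN.ne'⟩
    obtain ⟨j, hj, hjc, rfl⟩ := hζ.isPrimitiveRoot_iff.1 hx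
    have h1 := h j hjc
    rw [← hR2, map_add, map_mul] at h1
    have h2 : Polynomial.aeval (ζ ^ j) Φ = 0 := by
      haveI : NeZero (N : ℂ) := ⟨by exact_mod_cast hN.ne'⟩
      have := (Polynomial.isRoot_cyclotomic_iff (R := ℂ) (μ := ζ ^ j) (n := N)).2 hx
      rw [Polynomial.IsRoot.def, ← Polynomial.map_cyclotomic N (Int.castRingHom ℂ), Polynomial.eval_map] at this
      exact this
    rw [h2, zero_mul, add_zero] at h1
    rw [Polynomial.IsRoot.def, hS, Polynomial.eval_sub, Polynomial.eval_C, Polynomial.eval_map, sub_eq_zero]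
    exact h1
  have hS0 : S = 0 := by
    by_contra hne
    have h1 : (primitiveRoots N ℂ).card ≤ S.roots.toFinset.card := by
      apply Finset.card_le_card
      intro x hx
      rw [Multiset.mem_toFinset, Polynomial.mem_roots hne]
      exact hroot x hx
    rw [hζ.card_primitiveRoots] at h1
    have h2 : S.natDegree < Nat.totient N := by
      have h3 : (R.map (Int.castRingHom ℂ)).degree < (Nat.totient N : WithBot ℕ) := by
        refine lt_of_le_of_lt Polynomial.degree_map_le ?_
        rw [← Polynomial.degree_cyclotomic N ℤ]
        exact Polynomial.degree_modByMonic_lt _ hmon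
      rw [Polynomial.natDegree_lt_iff_degree_lt hne]
      refine lt_of_le_of_lt (Polynomial.degree_sub_le _ _) (max_lt h3 ?_)
      refine lt_of_le_of_lt Polynomial.degree_C_le ?_
      exact_mod_cast Nat.totient_pos.2 hN
    have h3 := S.roots.toFinset_card_le
    have h4 := S.card_roots'
    omega
  refine ⟨R.coeff 0, ?_⟩
  have h1 := congrArg (fun T => Polynomial.coeff T 0) hS0
  simp only [hS, Polynomial.coeff_sub, Polynomial.coeff_map, Polynomial.coeff_C_zero, Polynomial.coeff_zero] at h1
  exact (sub_eq_zero.1 h1).symm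

theorem virtZ_of (G : Type) [Group G] [Finite G] (b : G → ℂ) (N0 : ℕ) (hN0 : 0 < N0)
    (hb : ∀ g : G, ∃ (d : ℕ) (μ : Fin d → ℂ), (∀ i, μ i ^ N0 = 1) ∧ ∀ j : ℕ, 0 < j → b (g ^ j) = ∑ i, μ i ^ j)
    (hv : Virt OO b) : Virt ZZ b := by
  classical
  haveI := Fintype.ofFinite G
  intro ι _ _ ρ
  have hcard : 0 < Fintype.card G := Fintype.card_pos
  set N := N0 * Fintype.card G with hN
  have hNpos : 0 < N := Nat.mul_pos hN0 hcard
  obtain ⟨ζ, hζ⟩ : ∃ ζ : ℂ, IsPrimitiveRoot ζ N := ⟨_, Complex.isPrimitiveRoot_exp N hNpos.ne'⟩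
  have hpow : ∀ (y : G) (k : ℕ), ρ y ^ (k + 1) = ρ (y ^ (k+1)) := by
    intro y k
    induction k with
    | zero => simp
    | succ k ih => rw [pow_succ, ih, ← map_mul, ← pow_succ]
  have hg : ∀ g : G, ∃ P : Polynomial ℤ, ∀ j : ℕ, 0 < j →
      b (g ^ j) * (ρ (g ^ j)⁻¹).trace = Polynomial.aeval (ζ ^ j) P := by
    intro g
    obtain ⟨d, μ, hμ, hbj⟩ := hb g
    let X := Matrix.kronecker (Matrix.diagonal μ) (ρ g⁻¹)
    have hX : ∀ k : ℕ, X ^ (k + 1) = Matrix.kronecker (Matrix.diagonal μ ^ (k+1)) (ρ g⁻¹ ^ (k+1)) := by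
      intro k
      induction k with
      | zero => simp [X]
      | succ k ih =>
        rw [pow_succ, ih, pow_succ _ (k+1), pow_succ _ (k + 1)]
        exact (Matrix.mul_kronecker_mul _ _ _ _).symm
    obtain ⟨m, hm⟩ := trace_pow_periodic X hNpos (by
      rw [hX, hpow, Matrix.diagonal_pow]
      have h1 : μ ^ (N + 1) = μ := by
        funext i
        rw [Pi.pow_apply, pow_succ, hN, pow_mul, hμ, one_pow, one_mul]
      have h2 : g⁻¹ ^ (N + 1) = g⁻¹ := by
        rw [pow_succ, hN, mul_comm, pow_mul, pow_card_eq_one, one_pow, one_mul]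
      rw [h1, h2]) hζ
    refine ⟨∑ c ∈ Finset.range N, Polynomial.C (m c : ℤ) * Polynomial.X ^ c, ?_⟩
    intro j hj
    have h1 : b (g ^ j) * (ρ (g ^ j)⁻¹).trace = (X ^ j).trace := by
      obtain ⟨k, rfl⟩ : ∃ k, j = k + 1 := ⟨j - 1, by omega⟩
      rw [hX, hpow]
      show _ = (Matrix.kroneckerMap (fun x1 x2 => x1 * x2) _ _).trace
      rw [Matrix.trace_kronecker, Matrix.diagonal_pow, Matrix.trace_diagonal, hbj _ hj, inv_pow]
      rfl
    rw [h1, hm j hj, map_sum]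
    refine Finset.sum_congr rfl fun c _ => ?_
    simp only [map_mul, map_pow, Polynomial.aeval_X, Polynomial.aeval_C]
    rw [← pow_mul, mul_comm j c]
    simp
  choose P hP using hg
  have hH : ∃ k : ℤ, ∑ g, b g * (ρ g⁻¹).trace = k := by
    apply rat_of_poly (∑ g, P g) N hNpos ζ _ hζ
    intro j hj
    by_cases hj0 : j = 0
    · subst hj0
      have : N = 1 := by simpa using hj
      have h1 : ζ = 1 := by rw [this] at hζ; exact IsPrimitiveRoot.one_right_iff.1 hζ
      rw [map_sum, h1, one_pow]
      refine Finset.sum_congr rfl fun g _ => ?_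
      have := hP g 1 one_pos
      rw [h1, one_pow, pow_one] at this
      exact this.symm
    · have hjc : (Nat.card G).Coprime j := by
        rw [Nat.card_eq_fintype_card]
        exact (Nat.Coprime.coprime_dvd_right ⟨N0, by rw [hN, mul_comm]⟩ hj).symm
      rw [map_sum]
      refine Fintype.sum_equiv (powCoprime hjc) _ _ fun g => ?_
      rw [powCoprime_apply]
      exact (hP g j (Nat.pos_of_ne_zero hj0)).symm
  obtain ⟨k, hk⟩ := hH
  have hmemOO := hv ι ρ
  rw [mem_OO] at hmemOO
  rw [mem_ZZ]
  apply rat_integral (r := (k : ℚ) / (Fintype.card G : ℚ)) _ hmemOO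
  rw [BB_eq, hk]
  push_cast
  field_simp

theorem diag_roots {K U ι : Type} [Field K] [AddCommGroup U] [Module K U] [Module.Finite K U] [Fintype ι]
    (v : Module.Basis ι K U) (h : Module.End K U) (l : ι → K) (hl : ∀ i, h (v i) = l i • v i) :
    h.charpoly.roots = Finset.univ.val.map l := by
  classical
  rw [← LinearMap.charpoly_toMatrix h v]
  have : LinearMap.toMatrix v v h = Matrix.diagonal l := by
    ext i j
    rw [LinearMap.toMatrix_apply, hl, map_smul, Module.Basis.repr_self, Matrix.diagonal_apply]
    by_cases hij : i = j
    · simp [hij]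
    · simp [hij, Finsupp.single_apply, Ne.symm hij]
  rw [this, Matrix.charpoly_diagonal]
  exact Polynomial.roots_multiset_prod_X_sub_C (Finset.univ.val.map l) ▸ (by
    congr 1
    rw [Multiset.map_map]; rfl)

theorem root_pow {F V K : Type} [Field F] [Field K] [Fintype K] [Algebra F K] [AddCommGroup V] [Module F V] [Finite V]
    [Module.Finite F V] (p m0 : ℕ) [Fact p.Prime] (hm0 : 0 < m0) (hp : Fintype.card K = p ^ m0)
    (hM : ∀ d, d ∣ Nat.card (Module.End F V)ˣ → Nat.Coprime d p → d ∣ Fintype.card K - 1)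
    (g : (Module.End F V)ˣ) :
    ∃ (d : ℕ) (l : Fin d → K), (∀ i, l i ≠ 0) ∧
      ∀ j : ℕ, (g ^ j).1.charpoly.aroots K = Finset.univ.val.map (fun i => l i ^ j) := by
  classical
  let G := (Module.End F V)ˣ
  haveI : Finite F := Finite.of_injective _ (algebraMap F K).injective
  let U := TensorProduct F K V
  haveI : Module.Finite K U := inferInstance
  haveI : Finite U := Module.finite_of_finite K
  haveI : Finite (Module.End F V) := Finite.of_injective (fun f : Module.End F V => (f : V → V)) DFunLike.coe_injective
  haveI : Finite G := inferInstance
  let r : G →* (Module.End K U)ˣ := Units.map (Module.End.baseChangeHom F K V).toRingHom.toMonoidHom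
  have hr : ∀ g : G, (r g).1.charpoly.roots = g.1.charpoly.aroots K := by
    intro g
    show (LinearMap.baseChange K g.1).charpoly.roots = _
    rw [LinearMap.charpoly_baseChange]
  set Q := Fintype.card K with hQ
  have hQ1 : 1 < Q := Fintype.one_lt_card
  set NG := Nat.card G with hNG
  have hNG0 : NG ≠ 0 := Nat.card_pos.ne'
  set e := Q ^ NG with he
  have he0 : 0 < e := pow_pos (by omega) _
  have hpp : p.Prime := Fact.out
  have hdvd : NG ∣ e * (Q - 1) := by
    obtain ⟨a, d, hd, hda⟩ := Nat.exists_eq_pow_mul_and_not_dvd hNG0 p hpp.ne_one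
    have h1 : d ∣ Q - 1 := hM d ⟨p ^ a, by rw [mul_comm]; exact hda⟩ ((Nat.Prime.coprime_iff_not_dvd hpp).2 hd).symm
    have h2 : a ≤ m0 * NG := by
      have : a < p ^ a := Nat.lt_pow_self hpp.one_lt
      have h3 : p ^ a ≤ NG := Nat.le_of_dvd (Nat.pos_of_ne_zero hNG0) ⟨d, hda⟩
      nlinarith
    have h4 : p ^ a ∣ e := by
      rw [he, hp, ← pow_mul]
      exact pow_dvd_pow p h2
    have h5 := Nat.mul_dvd_mul h4 h1
    rwa [← hda] at h5
  have hge : ∀ g : G, (g ^ e) ^ (Q - 1) = 1 := by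
    intro g
    rw [← pow_mul]
    exact orderOf_dvd_iff_pow_eq_one.1 ((orderOf_dvd_natCard g).trans hdvd)
  have hgeQ : ∀ g : G, (g ^ e) ^ Q = g ^ e := by
    intro g
    have : Q = (Q - 1) + 1 := by omega
    rw [this, pow_succ, hge, one_mul]
  obtain ⟨ι, v, l, hl⟩ := diag_basis (r (g ^ e)).1 (by
      rw [← Units.val_pow_eq_pow_val, ← map_pow, hgeQ])
  haveI : Finite ι := Module.Finite.finite_basis v
  haveI := Fintype.ofFinite ι
  let ε := Fintype.equivFin ι
  refine ⟨Fintype.card ι, fun i => l (ε.symm i), fun i h0 => ?_, fun j => ?_⟩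
  · have h1 := hl (ε.symm i)
    rw [show l (ε.symm i) = 0 from h0, zero_smul] at h1
    have h2 : ((r (g ^ e))⁻¹).1 ((r (g ^ e)).1 (v (ε.symm i))) = v (ε.symm i) := LinearMap.congr_fun (r (g ^ e)).inv_mul _
    rw [h1, map_zero] at h2
    exact v.ne_zero _ h2.symm
  · have h1 : (r (g ^ j)).1.charpoly = (r ((g ^ e) ^ j)).1.charpoly := by
      rw [← pow_mul, mul_comm, pow_mul, map_pow r (g ^ j) e, Units.val_pow_eq_pow_val, he, hQ]
      exact (charpoly_pow_Q _ _).symm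
    rw [← hr, h1, map_pow, Units.val_pow_eq_pow_val]
    rw [diag_roots v _ (fun i => l i ^ j)]
    · rw [← Multiset.map_univ_val_equiv ε.symm, Multiset.map_map]; rfl
    · intro i
      clear h1
      induction j with
      | zero => simp
      | succ j ih =>
        rw [pow_succ', Module.End.mul_apply, ih, map_smul, hl, smul_smul, pow_succ]

/-- power sums of eigenvalues -/
noncomputable def bF (K : Type) [Field K] {F V : Type} [Field F] [Algebra F K] [AddCommGroup V] [Module F V]
    [Module.Finite F V] (f : K → ℂ) (g : Module.End F V) : ℂ := ((g.charpoly.aroots K).map f).sum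

theorem bF_virt {F V K : Type} [Field F] [Field K] [Fintype K] [Algebra F K] [AddCommGroup V] [Module F V] [Finite V]
    [Module.Finite F V] (p m0 : ℕ) [Fact p.Prime] (hm0 : 0 < m0) (hp : Fintype.card K = p ^ m0)
    (hM : ∀ d, d ∣ Nat.card (Module.End F V)ˣ → Nat.Coprime d p → d ∣ Fintype.card K - 1) (θ : MulChar K ℂ) :
    Virt ZZ (fun g : (Module.End F V)ˣ => bF K θ g.1) := by
  classical
  haveI : Finite (Module.End F V) := Finite.of_injective (fun f : Module.End F V => (f : V → V)) DFunLike.coe_injective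
  apply virtZ_of _ _ (Fintype.card K - 1) (by have : 1 < Fintype.card K := Fintype.one_lt_card; omega)
  · intro g
    obtain ⟨d, l, hl0, hl⟩ := root_pow p m0 hm0 hp hM g
    refine ⟨d, fun i => θ (l i), fun i => ?_, fun j hj => ?_⟩
    · rw [← map_pow, FiniteField.pow_card_sub_one_eq_one _ (hl0 i), map_one]
    · rw [bF, hl, Multiset.map_map]
      show ∑ i, θ (l i ^ j) = _
      simp only [map_pow]
  · have := es_virt (F := F) (V := V) p m0 hm0 hp hM 1 θ
    convert this using 2 with g
    rw [bF, Multiset.esymm, Multiset.powersetCard_one, Multiset.map_map, Multiset.map_map]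
    congr 1
    refine Multiset.map_congr rfl fun x _ => ?_
    simp

end KL

namespace KL

open Module.Basis in
theorem charpoly_mul {F V : Type} [Field F] [AddCommGroup V] [Module F V] [Module.Finite F V]
    (W : Submodule F V) (e : Module.End F V) (he : ∀ w ∈ W, e w ∈ W) :
    e.charpoly = (e.restrict he).charpoly * (W.mapQ W e he).charpoly := by
  let m := Module.Free.ChooseBasisIndex F W
  let bW : Module.Basis m F W := Module.Free.chooseBasis F W
  let n := Module.Free.ChooseBasisIndex F (V ⧸ W)
  let bQ : Module.Basis n F (V ⧸ W) := Module.Free.chooseBasis F (V ⧸ W)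
  let b := sumQuot bW bQ
  let A : Matrix m m F := LinearMap.toMatrix bW bW (e.restrict he)
  let B : Matrix m n F := Matrix.of fun i l ↦
    ((sumQuot bW bQ).repr (e ((sumQuot bW bQ) (Sum.inr l)))) (Sum.inl i)
  let D : Matrix n n F := LinearMap.toMatrix bQ bQ (W.mapQ W e he)
  suffices LinearMap.toMatrix b b e = Matrix.fromBlocks A B 0 D by
    rw [← LinearMap.charpoly_toMatrix e b, this, ← LinearMap.charpoly_toMatrix (e.restrict he) bW,
      ← LinearMap.charpoly_toMatrix _ bQ, Matrix.charpoly_fromBlocks_zero₂₁]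
  ext u v
  cases u with
  | inl i =>
    cases v with
    | inl k =>
      simp only [b, sumQuot_inl, Matrix.fromBlocks_apply₁₁, A, LinearMap.toMatrix_apply]
      apply sumQuot_repr_inl_of_mem
    | inr l => simp [b, LinearMap.toMatrix_apply, Matrix.fromBlocks_apply₁₂, B]
  | inr j =>
    cases v with
    | inl k =>
      suffices W.mkQ (e (bW k)) = 0 by simp [LinearMap.toMatrix_apply, b, this]
      rw [← LinearMap.mem_ker, Submodule.ker_mkQ]
      exact he _ (Submodule.coe_mem (bW k))
    | inr l =>
      simp only [LinearMap.toMatrix_apply, sumQuot_repr_inr,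
        Matrix.fromBlocks_apply₂₂, b, D]
      rw [← sumQuot_inr bW bQ l, W.mapQ_apply]
      simp

section inst
variable {F V : Type} [Field F] [AddCommGroup V] [Module F V] [Finite V]
instance endFinite : Finite (Module.End F V) :=
  Finite.of_injective (fun f : Module.End F V => (f : V → V)) DFunLike.coe_injective
noncomputable instance subFintype : Fintype (Submodule F V) := Fintype.ofFinite _
noncomputable instance endFintype : Fintype (Module.End F V) := Fintype.ofFinite _
noncomputable instance glFintype : Fintype (Module.End F V)ˣ := Fintype.ofFinite _
end inst

theorem charpoly_congr {F V V' : Type} [Field F] [AddCommGroup V] [Module F V] [Module.Finite F V]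
    [AddCommGroup V'] [Module F V'] [Module.Finite F V'] (e : V ≃ₗ[F] V') (g : Module.End F V) (g' : Module.End F V')
    (h : ∀ v, e (g v) = g' (e v)) : g.charpoly = g'.charpoly := by
  have : g' = e.conj g := by
    ext w
    obtain ⟨v, rfl⟩ := e.surjective w
    rw [← h, LinearEquiv.conj_apply_apply, e.symm_apply_apply]
  rw [this, LinearEquiv.charpoly_conj]

section bF
variable {F K : Type} [Field F] [Field K] [Algebra F K]

theorem bF_congr {V V' : Type} [AddCommGroup V] [Module F V] [Module.Finite F V]
    [AddCommGroup V'] [Module F V'] [Module.Finite F V'] (f : K → ℂ) (e : V ≃ₗ[F] V') (g : Module.End F V) (g' : Module.End F V')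
    (h : ∀ v, e (g v) = g' (e v)) : bF K f g = bF K f g' := by
  rw [bF, bF, charpoly_congr e g g' h]

theorem bF_add {V : Type} [AddCommGroup V] [Module F V] [Module.Finite F V] (f : K → ℂ)
    (W : Submodule F V) (e : Module.End F V) (he : ∀ w ∈ W, e w ∈ W) :
    bF K f e = bF K f (e.restrict he) + bF K f (W.mapQ W e he) := by
  unfold bF
  rw [charpoly_mul W e he, Polynomial.aroots_mul, Multiset.map_add, Multiset.sum_add]
  exact mul_ne_zero (LinearMap.charpoly_monic _).ne_zero (LinearMap.charpoly_monic _).ne_zero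

theorem bF_zero {V : Type} [AddCommGroup V] [Module F V] [Module.Finite F V] (f : K → ℂ) (g : Module.End F V)
    (h : Module.finrank F V = 0) : bF K f g = 0 := by
  have : g.charpoly = 1 := by
    apply Polynomial.eq_one_of_monic_natDegree_zero (LinearMap.charpoly_monic _)
    rw [LinearMap.charpoly_natDegree, h]
  simp [bF, this]

theorem bF_lin {V : Type} [AddCommGroup V] [Module F V] [Module.Finite F V] {ι : Type} (s : Finset ι) (c : ι → ℂ) (f : ι → K → ℂ) (g : Module.End F V) :
    bF K (fun x => ∑ i ∈ s, c i * f i x) g = ∑ i ∈ s, c i * bF K (f i) g := by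
  unfold bF
  rw [Multiset.sum_map_sum]
  exact Finset.sum_congr rfl fun i _ => Multiset.sum_map_mul_left

end bF

open Classical in
noncomputable def RR {F : Type} (K : Type) [Field F] [Field K] [Algebra F K] (f : K → ℂ) :
    ℕ → ∀ (V : Type) [AddCommGroup V] [Module F V] [Finite V], Module.End F V → ℂ
  | 0, _, _, _, _, _ => 0
  | m+1, V, _, _, _, g => bF K f g - ∑ W : Submodule F V,
      if h : (W ≠ ⊥ ∧ W ≠ ⊤) ∧ ∀ w ∈ W, g w ∈ W then RR K f m W (g.restrict h.2) else 0

section R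
variable {F K : Type} [Field F] [Field K] [Algebra F K] (f : K → ℂ)

theorem RR_zero (m : ℕ) (V : Type) [AddCommGroup V] [Module F V] [Finite V] (g : Module.End F V)
    (h : Module.finrank F V = 0) : RR K f m V g = 0 := by
  cases m with
  | zero => rfl
  | succ m =>
    rw [RR, bF_zero f g h, zero_sub, neg_eq_zero]
    refine Finset.sum_eq_zero fun W _ => dif_neg ?_
    rintro ⟨⟨h1, -⟩, -⟩
    haveI := Module.finrank_zero_iff.1 h
    exact h1 (Subsingleton.elim _ _)

theorem RR_stab (m : ℕ) : ∀ (m' : ℕ) (V : Type) [AddCommGroup V] [Module F V] [Finite V] (g : Module.End F V),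
    Module.finrank F V ≤ m → Module.finrank F V ≤ m' → RR K f m V g = RR K f m' V g := by
  induction m with
  | zero =>
    intro m' V _ _ _ g h1 h2
    rw [RR_zero f _ V g (by omega), RR_zero f _ V g (by omega)]
  | succ m ih =>
    intro m' V _ _ _ g h1 h2
    cases m' with
    | zero => rw [RR_zero f _ V g (by omega), RR_zero f _ V g (by omega)]
    | succ m' =>
      rw [RR, RR]
      congr 1
      refine Finset.sum_congr rfl fun W _ => ?_
      by_cases h : (W ≠ ⊥ ∧ W ≠ ⊤) ∧ ∀ w ∈ W, g w ∈ W
      · rw [dif_pos h, dif_pos h]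
        have := Submodule.finrank_lt h.1.2
        exact ih m' W _ (by omega) (by omega)
      · rw [dif_neg h, dif_neg h]

variable {V : Type} [AddCommGroup V] [Module F V] [Finite V]

noncomputable def R (K : Type) [Field K] [Algebra F K] (f : K → ℂ) (g : Module.End F V) : ℂ := RR K f (Module.finrank F V) V g

open Classical in
noncomputable def Rr (K : Type) [Field K] [Algebra F K] (f : K → ℂ) (g : Module.End F V) (W : Submodule F V) : ℂ :=
  if h : ∀ w ∈ W, g w ∈ W then R K f (g.restrict h) else 0

open Classical in
theorem R_rec (g : Module.End F V) : R K f g = bF K f g - ∑ W : Submodule F V, if W ≠ ⊥ ∧ W ≠ ⊤ then Rr K f g W else 0 := by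
  have : R K f g = RR K f (Module.finrank F V + 1) V g := RR_stab f _ _ _ _ le_rfl (by omega)
  rw [this, RR]
  congr 1
  refine Finset.sum_congr rfl fun W _ => ?_
  unfold Rr
  by_cases h1 : W ≠ ⊥ ∧ W ≠ ⊤
  · rw [if_pos h1]
    by_cases h2 : ∀ w ∈ W, g w ∈ W
    · rw [dif_pos ⟨h1, h2⟩, dif_pos h2]
      exact RR_stab f _ _ _ _ (Submodule.finrank_le W) le_rfl
    · rw [dif_neg h2, dif_neg (fun h => h2 h.2)]
  · rw [if_neg h1, dif_neg (fun h => h1 h.1)]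

theorem R_zero (g : Module.End F V) (h : Module.finrank F V = 0) : R K f g = 0 := RR_zero f _ V g h

theorem RR_congr (m : ℕ) : ∀ (V V' : Type) [AddCommGroup V] [Module F V] [Finite V] [AddCommGroup V'] [Module F V'] [Finite V']
    (e : V ≃ₗ[F] V') (g : Module.End F V) (g' : Module.End F V')
    (h : ∀ v, e (g v) = g' (e v)), RR K f m V g = RR K f m V' g' := by
  classical
  induction m with
  | zero => intros; rfl
  | succ m ih =>
    intro V V' _ _ _ _ _ _ e g g' h
    rw [RR, RR, bF_congr f e g g' h]
    congr 1
    refine Fintype.sum_equiv (Submodule.orderIsoMapComap e).toEquiv _ _ fun W => ?_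
    have hW' : (Submodule.orderIsoMapComap e).toEquiv W = W.map (e : V →ₗ[F] V') := rfl
    rw [hW']
    have e1 : (W.map (e : V →ₗ[F] V')) ≠ ⊥ ↔ W ≠ ⊥ := not_congr (map_eq_bot_iff (Submodule.orderIsoMapComap e))
    have e2 : (W.map (e : V →ₗ[F] V')) ≠ ⊤ ↔ W ≠ ⊤ := not_congr (map_eq_top_iff (Submodule.orderIsoMapComap e))
    have e3 : (∀ w ∈ (W.map (e : V →ₗ[F] V')), g' w ∈ (W.map (e : V →ₗ[F] V'))) ↔ ∀ w ∈ W, g w ∈ W := by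
      constructor
      · intro h1 w hw
        obtain ⟨w', hw', hh⟩ := h1 (e w) ⟨w, hw, rfl⟩
        rw [← h] at hh
        rwa [← e.injective hh]
      · rintro h1 _ ⟨w, hw, rfl⟩
        exact ⟨g w, h1 w hw, h w⟩
    by_cases hW : (W ≠ ⊥ ∧ W ≠ ⊤) ∧ ∀ w ∈ W, g w ∈ W
    · rw [dif_pos hW, dif_pos ⟨⟨e1.2 hW.1.1, e2.2 hW.1.2⟩, e3.2 hW.2⟩]
      refine ih _ _ (e.submoduleMap W) _ _ ?_
      rintro ⟨w, hw⟩
      apply Subtype.ext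
      exact h w
    · rw [dif_neg hW, dif_neg]
      rintro ⟨⟨h1, h2⟩, h3⟩
      exact hW ⟨⟨e1.1 h1, e2.1 h2⟩, e3.1 h3⟩

theorem R_congr {V' : Type} [AddCommGroup V'] [Module F V'] [Finite V']
    (e : V ≃ₗ[F] V') (g : Module.End F V) (g' : Module.End F V')
    (h : ∀ v, e (g v) = g' (e v)) : R K f g = R K f g' := by
  unfold R
  rw [← e.finrank_eq]
  exact RR_congr f _ _ _ e g g' h

theorem Rr_of (g : Module.End F V) (W : Submodule F V) (h : ∀ w ∈ W, g w ∈ W) : Rr K f g W = R K f (g.restrict h) := dif_pos h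

theorem Rr_of_not (g : Module.End F V) (W : Submodule F V) (h : ¬ ∀ w ∈ W, g w ∈ W) : Rr K f g W = 0 := dif_neg h

theorem Rr_top (g : Module.End F V) : Rr K f g ⊤ = R K f g := by
  rw [Rr_of f g ⊤ (fun _ _ => trivial)]
  exact R_congr f (Submodule.topEquiv) _ _ (fun v => rfl)

theorem Rr_bot (g : Module.End F V) : Rr K f g ⊥ = 0 := by
  by_cases h : ∀ w ∈ (⊥ : Submodule F V), g w ∈ (⊥ : Submodule F V)
  · rw [Rr_of f g ⊥ h]
    exact R_zero f _ (by simp)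
  · exact Rr_of_not f g ⊥ h

/-- fundamental relation -/
theorem bF_eq_sum (g : Module.End F V) : bF K f g = ∑ W : Submodule F V, Rr K f g W := by
  classical
  have h := R_rec f g
  by_cases h0 : (⊥ : Submodule F V) = ⊤
  · have h1 : Module.finrank F V = 0 := by
      rw [← finrank_top F V, ← h0, finrank_bot]
    rw [bF_zero f g h1]
    symm
    refine Finset.sum_eq_zero fun W _ => ?_
    have : W = ⊥ := by
      apply le_bot_iff.1; rw [h0]; exact le_top
    rw [this, Rr_bot]
  · have h2 : ∑ W : Submodule F V, Rr K f g W = ∑ W : Submodule F V, ((if W ≠ ⊥ ∧ W ≠ ⊤ then Rr K f g W else 0) + if W = ⊤ then Rr K f g ⊤ else 0) := by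
      refine Finset.sum_congr rfl fun W _ => ?_
      by_cases h3 : W = ⊤
      · subst h3; simp
      · by_cases h4 : W = ⊥
        · subst h4; simp [h0, Rr_bot]
        · simp [h3, h4]
    rw [h2, Finset.sum_add_distrib, Finset.sum_ite_eq' Finset.univ ⊤ (fun _ => Rr K f g ⊤), if_pos (Finset.mem_univ _), Rr_top, h]
    ring

theorem Rr_sub (g : Module.End F V) (A : Submodule F V) (hA : ∀ w ∈ A, g w ∈ A) (B : Submodule F A) :
    Rr K f (g.restrict hA) B = Rr K f g (B.map A.subtype) := by
  have e3 : (∀ w ∈ B.map A.subtype, g w ∈ B.map A.subtype) ↔ ∀ w ∈ B, (g.restrict hA) w ∈ B := by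
    constructor
    · intro h1 w hw
      obtain ⟨w', hw', hh⟩ := h1 (w : V) ⟨w, hw, rfl⟩
      have : w' = g.restrict hA w := Subtype.ext hh
      rwa [← this]
    · rintro h1 _ ⟨w, hw, rfl⟩
      exact ⟨_, h1 w hw, rfl⟩
  by_cases h : ∀ w ∈ B, (g.restrict hA) w ∈ B
  · rw [Rr_of f _ _ h, Rr_of f _ _ (e3.2 h)]
    refine R_congr f (Submodule.equivMapOfInjective A.subtype A.injective_subtype B) _ _ ?_
    rintro ⟨w, hw⟩
    rfl
  · rw [Rr_of_not f _ _ h, Rr_of_not f _ _ (fun h' => h (e3.1 h'))]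

open Classical in
theorem bF_restrict_eq_sum (g : Module.End F V) (A : Submodule F V) (hA : ∀ w ∈ A, g w ∈ A) :
    bF K f (g.restrict hA) = ∑ W : Submodule F V, if W ≤ A then Rr K f g W else 0 := by
  rw [bF_eq_sum, ← Finset.sum_filter]
  refine Finset.sum_bij (fun B _ => B.map A.subtype) ?_ ?_ ?_ ?_
  · intro B _
    simp only [Finset.mem_filter, Finset.mem_univ, true_and]
    exact Submodule.map_subtype_le A B
  · intro B _ B' _ h
    exact Submodule.map_injective_of_injective A.injective_subtype h
  · intro W hW
    simp only [Finset.mem_filter, Finset.mem_univ, true_and] at hW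
    refine ⟨W.comap A.subtype, Finset.mem_univ _, ?_⟩
    rw [Submodule.map_comap_subtype]
    exact inf_eq_right.2 hW
  · intro B _
    exact Rr_sub f g A hA B

end R

section props
variable {F K : Type} [Field F] [Field K] [Algebra F K]

theorem RR_lin {ι : Type} (s : Finset ι) (c : ι → ℂ) (f : ι → K → ℂ) (m : ℕ) :
    ∀ (V : Type) [AddCommGroup V] [Module F V] [Finite V] (g : Module.End F V),
    RR K (fun x => ∑ i ∈ s, c i * f i x) m V g = ∑ i ∈ s, c i * RR K (f i) m V g := by
  classical
  induction m with
  | zero => intros; simp [RR]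
  | succ m ih =>
    intro V _ _ _ g
    simp only [RR, mul_sub, Finset.sum_sub_distrib, bF_lin]
    congr 1
    simp only [Finset.mul_sum]
    rw [Finset.sum_comm]
    refine Finset.sum_congr rfl fun W _ => ?_
    split_ifs with h
    · exact ih W _
    · simp

variable {V : Type} [AddCommGroup V] [Module F V] [Finite V]

theorem R_lin {ι : Type} (s : Finset ι) (c : ι → ℂ) (f : ι → K → ℂ) (g : Module.End F V) :
    R K (fun x => ∑ i ∈ s, c i * f i x) g = ∑ i ∈ s, c i * R K (f i) g := RR_lin s c f _ V g

theorem R_vanish (f : K → ℂ) (m : ℕ) :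
    ∀ (V : Type) [AddCommGroup V] [Module F V] [Finite V] (g : Module.End F V),
    (∀ x, Polynomial.aeval x g.charpoly = 0 → f x = 0) → RR K f m V g = 0 := by
  classical
  induction m with
  | zero => intros; simp [RR]
  | succ m ih =>
    intro V _ _ _ g h
    rw [RR]
    have h1 : bF K f g = 0 := by
      unfold bF
      apply Multiset.sum_eq_zero
      intro x hx
      obtain ⟨y, hy, rfl⟩ := Multiset.mem_map.1 hx
      exact h y (Polynomial.mem_aroots.1 hy).2
    rw [h1, zero_sub, neg_eq_zero]
    refine Finset.sum_eq_zero fun W _ => ?_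
    split_ifs with hW
    · apply ih W
      intro x hx
      apply h
      rw [charpoly_mul W g hW.2, map_mul, hx, zero_mul]
    · rfl

theorem R_irr (f : K → ℂ) (g : Module.End F V) (hg : Irreducible g.charpoly) : R K f g = bF K f g := by
  classical
  rw [R_rec, sub_eq_self]
  refine Finset.sum_eq_zero fun W _ => ?_
  split_ifs with hW
  · apply Rr_of_not
    intro h
    have h1 := charpoly_mul W g h
    rw [h1] at hg
    rcases hg.isUnit_or_isUnit rfl with h2 | h2
    · have := (LinearMap.charpoly_monic (g.restrict h)).eq_one_of_isUnit h2
      have h3 := LinearMap.charpoly_natDegree (g.restrict h)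
      rw [this, Polynomial.natDegree_one] at h3
      exact hW.1 (Submodule.finrank_eq_zero.1 h3.symm)
    · have := (LinearMap.charpoly_monic (W.mapQ W g h)).eq_one_of_isUnit h2
      have h3 := LinearMap.charpoly_natDegree (W.mapQ W g h)
      rw [this, Polynomial.natDegree_one] at h3
      have h4 := Submodule.finrank_quotient_add_finrank W
      apply hW.2
      apply Submodule.eq_top_of_finrank_eq
      omega
  · rfl

theorem R_class (f : K → ℂ) (g : Module.End F V) (x : (Module.End F V)ˣ) : R K f (x.1 * g * (x⁻¹).1) = R K f g := by
  symm
  refine R_congr f (LinearMap.GeneralLinearGroup.toLinearEquiv x) _ _ fun v => ?_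
  show x.1 (g v) = x.1 (g ((x⁻¹).1 (x.1 v)))
  rw [show (x⁻¹).1 (x.1 v) = v from LinearMap.congr_fun x.inv_mul v]

end props
end KL

namespace KL

section
variable {F K : Type} [Field F] [Field K] [Algebra F K] (f : K → ℂ)
variable {V : Type} [AddCommGroup V] [Module F V] [Finite V]

theorem Rr_conj (g : Module.End F V) (x : (Module.End F V)ˣ) (W : Submodule F V) :
    Rr K f (x.1 * g * (x⁻¹).1) (W.map x.1) = Rr K f g W := by
  have hx : ∀ w, (x⁻¹).1 (x.1 w) = w := fun w => LinearMap.congr_fun x.inv_mul w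
  have e3 : (∀ w ∈ W.map x.1, (x.1 * g * (x⁻¹).1) w ∈ W.map x.1) ↔ ∀ w ∈ W, g w ∈ W := by
    constructor
    · intro h1 w hw
      obtain ⟨w', hw', hh⟩ := h1 (x.1 w) ⟨w, hw, rfl⟩
      have hh2 : x.1 w' = x.1 (g w) := by
        rw [hh]; show x.1 (g ((x⁻¹).1 (x.1 w))) = _; rw [hx]
      have := congrArg (x⁻¹).1 hh2
      rw [hx, hx] at this
      rwa [← this]
    · rintro h1 _ ⟨w, hw, rfl⟩
      refine ⟨g w, h1 w hw, ?_⟩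
      show x.1 (g w) = x.1 (g ((x⁻¹).1 (x.1 w)))
      rw [hx]
  by_cases h : ∀ w ∈ W, g w ∈ W
  · rw [Rr_of f _ _ h, Rr_of f _ _ (e3.2 h)]
    symm
    refine R_congr f (Submodule.equivMapOfInjective x.1 (fun a b hab => by rw [← hx a, ← hx b, hab]) W) _ _ ?_
    rintro ⟨w, hw⟩
    apply Subtype.ext
    show x.1 (g w) = x.1 (g ((x⁻¹).1 (x.1 w)))
    rw [hx]
  · rw [Rr_of_not f _ _ h, Rr_of_not f _ _ (fun h' => h (e3.1 h'))]

theorem lift_unit (W : Submodule F V) (y : (Module.End F W)ˣ) : ∃ x : (Module.End F V)ˣ, ∀ w : W, x.1 w = y.1 w := by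
  obtain ⟨C, hC⟩ := Submodule.exists_isCompl W
  let e := Submodule.prodEquivOfIsCompl W C hC
  let z : V ≃ₗ[F] V := e.symm.trans (((LinearMap.GeneralLinearGroup.toLinearEquiv y).prodCongr (LinearEquiv.refl F C)).trans e)
  refine ⟨LinearMap.GeneralLinearGroup.ofLinearEquiv z, fun w => ?_⟩
  show z w = _
  have h1 : e.symm w = (w, 0) := by
    rw [LinearEquiv.symm_apply_eq]; simp [e]
  show e (((LinearMap.GeneralLinearGroup.toLinearEquiv y).prodCongr (LinearEquiv.refl F C)) (e.symm w)) = _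
  rw [h1]
  show e (y.1 w, 0) = _
  simp [e]

theorem R_virt (n : ℕ) (hb : ∀ (V : Type) [AddCommGroup V] [Module F V] [Finite V], Module.finrank F V ≤ n →
      Virt ZZ (fun g : (Module.End F V)ˣ => bF K f g.1)) :
    ∀ (m : ℕ) (V : Type) [AddCommGroup V] [Module F V] [Finite V], Module.finrank F V ≤ m → m ≤ n →
      Virt ZZ (fun g : (Module.End F V)ˣ => R K f g.1) := by
  classical
  intro m
  induction m with
  | zero =>
    intro V _ _ _ h1 h2
    have : (fun g : (Module.End F V)ˣ => R K f g.1) = fun g => bF K f g.1 := by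
      funext g
      rw [R_zero f _ (by omega), bF_zero f _ (by omega)]
    rw [this]
    exact hb V (by omega)
  | succ m ih =>
    intro V _ _ _ h1 h2
    letI : MulAction (Module.End F V)ˣ (Submodule F V) := subAct (MonoidHom.id _)
    have key : Virt ZZ (fun g : (Module.End F V)ˣ => ∑ W : Submodule F V, if g • W = W then (if W ≠ ⊥ ∧ W ≠ ⊤ then Rr K f g.1 W else 0) else 0) := by
      apply Virt.ind (R := ZZ) (fun (g : (Module.End F V)ˣ) (W : Submodule F V) => if W ≠ ⊥ ∧ W ≠ ⊤ then Rr K f g.1 W else 0)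
      · intro g h W _
        have e1 : h • W ≠ ⊥ ↔ W ≠ ⊥ := by
          have : h • (⊥ : Submodule F V) = ⊥ := Submodule.map_bot _
          rw [Ne, Ne, ← this, MulAction.injective h |>.eq_iff, this]
        have e2 : h • W ≠ ⊤ ↔ W ≠ ⊤ := by
          have : h • (⊤ : Submodule F V) = ⊤ := by
            show Submodule.map h.1 ⊤ = ⊤
            rw [Submodule.map_top, LinearMap.range_eq_top]
            intro v
            exact ⟨(h⁻¹).1 v, LinearMap.congr_fun h.mul_inv v⟩
          rw [Ne, Ne, ← this, MulAction.injective h |>.eq_iff, this]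
        simp only [e1, e2]
        split_ifs
        · exact Rr_conj f g.1 h W
        · rfl
      · intro W
        by_cases hW : W ≠ ⊥ ∧ W ≠ ⊤
        · simp only [if_pos hW]
          have hst : ∀ g : MulAction.stabilizer (Module.End F V)ˣ W, ∀ w ∈ W, g.1.1 w ∈ W := fun g =>
            (map_eq_iff_stable g.1 W).1 g.2
          let π0 : MulAction.stabilizer (Module.End F V)ˣ W →* Module.End F W :=
            { toFun := fun g => g.1.1.restrict (hst g)
              map_one' := by ext w; rfl
              map_mul' := fun a b => by ext w; rfl }
          let π := π0.toHomUnits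
          have hsurj : Function.Surjective π := by
            intro y
            obtain ⟨x, hx⟩ := lift_unit W y
            have hxs : ∀ w ∈ W, x.1 w ∈ W := fun w hw => by
              rw [hx ⟨w, hw⟩]; exact (y.1 ⟨w, hw⟩).2
            refine ⟨⟨x, (map_eq_iff_stable x W).2 hxs⟩, ?_⟩
            apply Units.ext
            refine LinearMap.ext fun w => Subtype.ext ?_
            exact hx w
          have hlt := Submodule.finrank_lt hW.2
          have h3 := Virt.infl π hsurj (ih W (by omega) (by omega))
          have h4 : (fun g : MulAction.stabilizer (Module.End F V)ˣ W => Rr K f g.1.1 W) = fun g => R K f (π g).1 := by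
            funext g
            exact Rr_of f g.1.1 W (hst g)
          rw [h4]
          exact h3
        · simp only [if_neg hW]
          intro ι _ _ ρ
          have : BB (fun _ : MulAction.stabilizer (Module.End F V)ˣ W => (0:ℂ)) (fun g => (ρ g).trace) = 0 := by
            simp [BB]
          rw [this]; exact ZZ.zero_mem
    have h5 : (fun g : (Module.End F V)ˣ => R K f g.1) = fun g : (Module.End F V)ˣ => bF K f g.1 - ∑ W : Submodule F V, if g • W = W then (if W ≠ ⊥ ∧ W ≠ ⊤ then Rr K f g.1 W else 0) else 0 := by
      funext g
      rw [R_rec]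
      congr 1
      refine Finset.sum_congr rfl fun W _ => ?_
      by_cases h6 : g • W = W
      · rw [if_pos h6]
      · rw [if_neg h6, Rr_of_not f _ _ (fun h7 => h6 ((map_eq_iff_stable g W).2 h7)), ite_self]
    rw [h5]
    exact (hb V (by omega)).sub key
end
end KL

namespace KL

theorem sum_surj_zero {A B : Type} [AddGroup A] [AddGroup B] [Fintype A] [Fintype B] (r : A →+ B) (hr : Function.Surjective r)
    (φ : B → ℂ) (h : ∑ b, φ b = 0) : ∑ a, φ (r a) = 0 := by
  classical
  rw [← Finset.sum_fiberwise (s := Finset.univ) (g := r)]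
  have h1 : ∀ b : B, ∑ a with r a = b, φ (r a) = ((Finset.univ.filter fun a => r a = 0).card : ℂ) * φ b := by
    intro b
    rw [Finset.sum_congr rfl (g := fun _ => φ b) (fun a ha => by rw [(Finset.mem_filter.1 ha).2]), Finset.sum_const, nsmul_eq_mul]
    congr 2
    exact AddMonoidHom.card_fiber_eq_of_mem_range r (hr b) (hr 0)
  rw [Finset.sum_congr rfl (fun b _ => h1 b), ← Finset.mul_sum, h, mul_zero]

theorem factor_ext {F M N P : Type} [Field F] [AddCommGroup M] [Module F M] [AddCommGroup N] [Module F N] [AddCommGroup P] [Module F P]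
    (j : M →ₗ[F] N) (y : M →ₗ[F] P) (h : LinearMap.ker j ≤ LinearMap.ker y) : ∃ z : N →ₗ[F] P, ∀ m, z (j m) = y m := by
  obtain ⟨z, hz⟩ := LinearMap.exists_extend (p := LinearMap.range j)
    (((LinearMap.ker j).liftQ y h).comp (j.quotKerEquivRange.symm : LinearMap.range j →ₗ[F] M ⧸ LinearMap.ker j))
  refine ⟨z, fun m => ?_⟩
  have := LinearMap.congr_fun hz ⟨j m, m, rfl⟩
  refine Eq.trans this ?_
  show ((LinearMap.ker j).liftQ y h) (j.quotKerEquivRange.symm ⟨j m, m, rfl⟩) = _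
  have h2 : j.quotKerEquivRange.symm ⟨j m, m, rfl⟩ = Submodule.Quotient.mk m := by
    rw [LinearEquiv.symm_apply_eq]; rfl
  rw [h2]; rfl

section
variable {F : Type} [Field F] {V : Type} [AddCommGroup V] [Module F V] [Finite V]

def HH (A : Submodule F V) : Submodule F (Module.End F V) where
  carrier := {u | (∀ a ∈ A, u a = 0) ∧ ∀ v, u v ∈ A}
  add_mem' := by
    rintro u v ⟨h1, h2⟩ ⟨h3, h4⟩
    exact ⟨fun a ha => by simp [h1 a ha, h3 a ha], fun w => A.add_mem (h2 w) (h4 w)⟩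
  zero_mem' := ⟨fun a _ => rfl, fun v => A.zero_mem⟩
  smul_mem' := by
    rintro c u ⟨h1, h2⟩
    exact ⟨fun a ha => by simp [h1 a ha], fun w => A.smul_mem c (h2 w)⟩

instance quotFinite (A : Submodule F V) : Finite (V ⧸ A) := Finite.of_surjective _ (Submodule.mkQ_surjective A)

noncomputable instance HHfin (A : Submodule F V) : Fintype (HH A) := Fintype.ofFinite _

def Prim (v : Module.End F V → ℂ) : Prop := ∀ A : Submodule F V, A ≠ ⊥ → A ≠ ⊤ → ∀ p : Module.End F V,
  (∀ w ∈ A, p w ∈ A) → ∑ u : HH A, v (p + u) = 0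

/-- projection killing W, identity on A -/
theorem exists_proj (A W : Submodule F V) (h : W ⊓ A = ⊥) : ∃ P : Module.End F V, (∀ a ∈ A, P a = a) ∧ (∀ w ∈ W, P w = 0) ∧ ∀ v, P v ∈ A := by
  obtain ⟨z, hz⟩ := factor_ext (W.mkQ.comp A.subtype) (LinearMap.id : A →ₗ[F] A) (by
    intro a ha
    have h1 : (a : V) ∈ W := by
      rw [LinearMap.mem_ker] at ha
      exact (Submodule.Quotient.mk_eq_zero W).1 ha
    have h2 : (a : V) ∈ W ⊓ A := ⟨h1, a.2⟩
    rw [h, Submodule.mem_bot] at h2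
    rw [LinearMap.mem_ker]
    exact Subtype.ext h2)
  refine ⟨A.subtype.comp (z.comp W.mkQ), fun a ha => ?_, fun w hw => ?_, fun v => ?_⟩
  · have := hz ⟨a, ha⟩
    exact congrArg Subtype.val this
  · show ((z (W.mkQ w) : A) : V) = 0
    have : W.mkQ w = 0 := (Submodule.Quotient.mk_eq_zero W).2 hw
    rw [this]; simp
  · exact (z (W.mkQ v)).2

section main
variable {K : Type} [Field K] [Algebra F K] (f : K → ℂ) (A : Submodule F V) (p : Module.End F V)

theorem stab_add (hA : ∀ w ∈ A, p w ∈ A) (u : HH A) : ∀ w ∈ A, (p + u.1) w ∈ A := fun w hw => A.add_mem (hA w hw) (u.2.2 w)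

theorem prim_b (hA : ∀ w ∈ A, p w ∈ A) (u : HH A) : bF K f (p + u.1) = bF K f (p.restrict hA) + bF K f (A.mapQ A p hA) := by
  rw [bF_add f A (p + u.1) (stab_add A p hA u)]
  congr 2
  · refine LinearMap.ext fun w => Subtype.ext ?_
    show p w + u.1 w = p w
    rw [u.2.1 w w.2, add_zero]
  · refine LinearMap.ext fun v => ?_
    obtain ⟨v, rfl⟩ := Submodule.Quotient.mk_surjective _ v
    show A.mkQ ((p + u.1) v) = A.mkQ (p v)
    rw [← sub_eq_zero, ← map_sub, Submodule.mkQ_apply, Submodule.Quotient.mk_eq_zero]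
    show p v + u.1 v - p v ∈ A
    rw [add_sub_cancel_left]
    exact u.2.2 v

theorem claim1 (u : HH A) (W : Submodule F V) (hW : W ≤ A) : Rr K f (p + u.1) W = Rr K f p W := by
  have h1 : ∀ w ∈ W, (p + u.1) w = p w := fun w hw => by
    show p w + u.1 w = p w
    rw [u.2.1 w (hW hw), add_zero]
  by_cases h : ∀ w ∈ W, p w ∈ W
  · rw [Rr_of f _ _ h, Rr_of f _ _ (fun w hw => by rw [h1 w hw]; exact h w hw)]
    congr 1
    exact LinearMap.ext fun w => Subtype.ext (h1 w w.2)
  · rw [Rr_of_not f _ _ h, Rr_of_not f _ _ (fun h' => h fun w hw => by rw [← h1 w hw]; exact h' w hw)]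

theorem claim3 (W : Submodule F V) (hW : ¬ W ≤ A) (hW2 : W ⊓ A ≠ ⊥) (ih : Prim (fun g : Module.End F W => R K f g))
    (hA : ∀ w ∈ A, p w ∈ A) : ∑ u : HH A, Rr K f (p + u.1) W = 0 := by
  classical
  by_cases h0 : ∃ u0 : HH A, ∀ w ∈ W, (p + u0.1) w ∈ W
  swap
  · push Not at h0
    refine Finset.sum_eq_zero fun u _ => Rr_of_not f _ _ ?_
    intro h1
    obtain ⟨w, hw, h2⟩ := h0 u
    exact h2 (h1 w hw)
  obtain ⟨u0, h0⟩ := h0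
  set p0 := p + u0.1 with hp0
  rw [← Equiv.sum_comp (Equiv.addLeft u0) (fun u : HH A => Rr K f (p + u.1) W)]
  show ∑ u : HH A, Rr K f (p + (u0.1 + u.1)) W = 0
  simp only [← add_assoc, ← hp0]
  let A' : Submodule F W := A.comap W.subtype
  have hA'1 : A' ≠ ⊥ := by
    intro h
    apply hW2
    rw [← le_bot_iff]
    rintro w ⟨hw1, hw2⟩
    have : (⟨w, hw1⟩ : W) ∈ A' := hw2
    rw [h, Submodule.mem_bot] at this
    exact congrArg Subtype.val this
  have hA'2 : A' ≠ ⊤ := by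
    intro h
    apply hW
    intro w hw
    have : (⟨w, hw⟩ : W) ∈ A' := by rw [h]; trivial
    exact this
  have hst : ∀ w ∈ A', (p0.restrict h0) w ∈ A' := fun w hw => stab_add A p hA u0 _ hw
  have hih := ih A' hA'1 hA'2 (p0.restrict h0) hst
  let H1 : AddSubgroup (HH A) :=
    { carrier := {u | ∀ w ∈ W, u.1 w ∈ W}
      add_mem' := fun {a b} ha hb w hw => W.add_mem (ha w hw) (hb w hw)
      zero_mem' := fun w hw => W.zero_mem
      neg_mem' := fun {a} ha w hw => W.neg_mem (ha w hw) }
  let r : H1 →+ HH A' :=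
    { toFun := fun u => ⟨u.1.1.restrict u.2, fun a ha => Subtype.ext (u.1.2.1 _ ha), fun v => u.1.2.2 _⟩
      map_zero' := rfl
      map_add' := fun a b => rfl }
  have hr : Function.Surjective r := by
    intro y
    obtain ⟨z, hz⟩ := factor_ext (A.mkQ.comp W.subtype) (y.1.codRestrict A' y.2.2) (by
      intro a ha
      have h1 : (a : V) ∈ A := by
        rw [LinearMap.mem_ker] at ha
        exact (Submodule.Quotient.mk_eq_zero A).1 ha
      rw [LinearMap.mem_ker]
      exact Subtype.ext (y.2.1 a h1))
    have hz' : ∀ w : W, ((z (A.mkQ w)).1).1 = (y.1 w).1 := fun w => congrArg (fun t => t.1.1) (hz w)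
    refine ⟨⟨⟨W.subtype.comp (A'.subtype.comp (z.comp A.mkQ)), fun a ha => ?_, fun v => (z (A.mkQ v)).2⟩, fun w hw => (z (A.mkQ w)).1.2⟩, ?_⟩
    · show (((z (A.mkQ a)) : W) : V) = 0
      rw [show A.mkQ a = 0 from (Submodule.Quotient.mk_eq_zero A).2 ha]; simp
    · apply Subtype.ext
      refine LinearMap.ext fun w => Subtype.ext ?_
      exact hz' w
  haveI : Fintype H1 := Fintype.ofFinite _
  have h2 := sum_surj_zero r hr (fun y => R K f (p0.restrict h0 + y.1)) hih
  have h3 : ∑ u : HH A, Rr K f (p0 + u.1) W = ∑ u : HH A, if u ∈ H1 then Rr K f (p0 + u.1) W else 0 := by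
    refine Finset.sum_congr rfl fun u _ => ?_
    by_cases hu : u ∈ H1
    · rw [if_pos hu]
    · rw [if_neg hu]
      apply Rr_of_not
      intro h4
      apply hu
      intro w hw
      have := W.sub_mem (h4 w hw) (h0 w hw)
      rwa [LinearMap.add_apply, add_sub_cancel_left] at this
  rw [h3, ← Finset.sum_filter, ← h2, Finset.sum_subtype (p := fun u => u ∈ H1) _ (by simp)]
  refine Finset.sum_congr rfl fun u _ => ?_
  rw [Rr_of f _ _ (fun w hw => W.add_mem (h0 w hw) (u.2 w hw))]
  rfl

/-- submodules over `B` -/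
def Over (B : Submodule F (V ⧸ A)) (W : Submodule F V) : Prop := W ⊓ A = ⊥ ∧ W.map A.mkQ = B

theorem over_inj {B : Submodule F (V ⧸ A)} {W : Submodule F V} (h : Over A B W) : Function.Injective (A.mkQ.comp W.subtype) := by
  rw [← LinearMap.ker_eq_bot, ← le_bot_iff]
  intro a ha
  have h1 : (a : V) ∈ A := by
    rw [LinearMap.mem_ker] at ha
    exact (Submodule.Quotient.mk_eq_zero A).1 ha
  have h2 : (a : V) ∈ W ⊓ A := ⟨a.2, h1⟩
  rw [h.1, Submodule.mem_bot] at h2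
  rw [Submodule.mem_bot]
  exact Subtype.ext h2

theorem over_mem {B : Submodule F (V ⧸ A)} {W : Submodule F V} (h : Over A B W) (w : V) (hw : w ∈ W) : A.mkQ w ∈ B := by
  rw [← h.2]; exact ⟨w, hw, rfl⟩

theorem over_dec {B : Submodule F (V ⧸ A)} {W : Submodule F V} (h : Over A B W) (v : V) (hv : A.mkQ v ∈ B) : ∃ w ∈ W, v - w ∈ A := by
  rw [← h.2] at hv
  obtain ⟨w, hw, hh⟩ := hv
  refine ⟨w, hw, ?_⟩
  rw [← Submodule.Quotient.mk_eq_zero A, ← Submodule.mkQ_apply, map_sub, hh, sub_self]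

noncomputable def overEquiv {B : Submodule F (V ⧸ A)} {W : Submodule F V} (h : Over A B W) : W ≃ₗ[F] B :=
  LinearEquiv.ofBijective ((A.mkQ.comp W.subtype).codRestrict B (fun w => over_mem A h w w.2)) (by
    constructor
    · intro a b hab
      exact over_inj A h (congrArg Subtype.val hab)
    · rintro ⟨b, hb⟩
      rw [← h.2] at hb
      obtain ⟨w, hw, rfl⟩ := hb
      exact ⟨⟨w, hw⟩, rfl⟩)

theorem over_exists (B : Submodule F (V ⧸ A)) : ∃ W, Over A B W := by
  obtain ⟨s, hs⟩ := A.mkQ.exists_rightInverse_of_surjective (LinearMap.range_eq_top.2 (Submodule.mkQ_surjective A))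
  have hs' : ∀ b, A.mkQ (s b) = b := fun b => LinearMap.congr_fun hs b
  refine ⟨B.map s, ?_, ?_⟩
  · rw [← le_bot_iff]
    rintro _ ⟨⟨b, hb, rfl⟩, h2⟩
    have h3 : A.mkQ (s b) = 0 := (Submodule.Quotient.mk_eq_zero A).2 h2
    rw [hs'] at h3
    rw [Submodule.mem_bot, h3, map_zero]
  · rw [← Submodule.map_comp, hs, Submodule.map_id]

/-- subgroup of `HH A` killing the preimage of `B` -/
def H0 (B : Submodule F (V ⧸ A)) : AddSubgroup (HH A) where
  carrier := {u | ∀ v, A.mkQ v ∈ B → u.1 v = 0}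
  add_mem' := fun {a b} ha hb v hv => by
    show a.1 v + b.1 v = 0
    rw [ha v hv, hb v hv, add_zero]
  zero_mem' := fun v hv => rfl
  neg_mem' := fun {a} ha v hv => by
    show - a.1 v = 0
    rw [ha v hv, neg_zero]

theorem mem_H0 {B : Submodule F (V ⧸ A)} {W : Submodule F V} (h : Over A B W) (u : HH A) : u ∈ H0 A B ↔ ∀ w ∈ W, u.1 w = 0 := by
  constructor
  · intro h1 w hw
    exact h1 w (over_mem A h w hw)
  · intro h1 v hv
    obtain ⟨w, hw, h2⟩ := over_dec A h v hv
    rw [← sub_add_cancel v w, map_add, u.2.1 _ h2, h1 w hw, add_zero]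

theorem fiber_card {H X : Type} [AddCommGroup H] [Finite H] [Finite X] (N : AddSubgroup H) (φ : H → X) (hs : Function.Surjective φ)
    (hφ : ∀ a b, φ a = φ b ↔ b - a ∈ N) : Nat.card X * Nat.card N = Nat.card H := by
  rw [AddSubgroup.card_eq_card_quotient_mul_card_addSubgroup N]
  congr 1
  symm
  refine Nat.card_congr (Equiv.ofBijective (Quotient.lift φ fun a b hab => ?_) ⟨?_, ?_⟩)
  · rw [hφ]
    have := QuotientAddGroup.leftRel_apply.1 hab
    rwa [neg_add_eq_sub] at this
  · rintro ⟨a⟩ ⟨b⟩ hab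
    apply Quotient.sound
    apply QuotientAddGroup.leftRel_apply.2
    rw [neg_add_eq_sub]
    exact (hφ a b).1 hab
  · intro x
    obtain ⟨a, rfl⟩ := hs x
    exact ⟨Quotient.mk _ a, rfl⟩

theorem over_card (B : Submodule F (V ⧸ A)) : Nat.card {W // Over A B W} * Nat.card (H0 A B) = Nat.card (HH A) := by
  obtain ⟨W0, hW0⟩ := over_exists A B
  obtain ⟨P0, hP1, hP2, hP3⟩ := exists_proj A W0 hW0.1
  have key : ∀ h : HH A, Over A B (W0.map (LinearMap.id + h.1)) := by
    intro h
    constructor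
    · rw [← le_bot_iff]
      rintro _ ⟨⟨w, hw, rfl⟩, h2⟩
      have h2' : w + h.1 w ∈ A := h2
      have h3 : w ∈ A := by
        have := A.sub_mem h2' (h.2.2 w)
        rwa [add_sub_cancel_right] at this
      have h4 : w ∈ W0 ⊓ A := ⟨hw, h3⟩
      rw [hW0.1, Submodule.mem_bot] at h4
      rw [h4]; simp
    · rw [← Submodule.map_comp, ← hW0.2]
      congr 1
      refine LinearMap.ext fun v => ?_
      show A.mkQ (v + h.1 v) = A.mkQ v
      rw [map_add, show A.mkQ (h.1 v) = 0 from (Submodule.Quotient.mk_eq_zero A).2 (h.2.2 v), add_zero]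
  refine fiber_card (H0 A B) (fun h => (⟨_, key h⟩ : {W // Over A B W})) ?_ ?_
  · rintro ⟨W, hW⟩
    obtain ⟨P, hQ1, hQ2, hQ3⟩ := exists_proj A W hW.1
    have hh : -(P.comp (LinearMap.id - P0)) ∈ HH A := by
      refine ⟨fun a ha => ?_, fun v => A.neg_mem (hQ3 _)⟩
      show - P (a - P0 a) = 0
      rw [hP1 a ha, sub_self, map_zero, neg_zero]
    set h : HH A := ⟨-(P.comp (LinearMap.id - P0)), hh⟩
    refine ⟨h, ?_⟩
    · apply Subtype.ext
      show W0.map (LinearMap.id + h.1) = W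
      apply Submodule.eq_of_le_of_finrank_eq
      · rintro _ ⟨w, hw, rfl⟩
        show w + - P (w - P0 w) ∈ W
        rw [hP2 w hw, sub_zero]
        obtain ⟨w', hw', h2⟩ := over_dec A hW w (over_mem A hW0 w hw)
        have h3 : P w = w - w' := by
          have := hQ1 _ h2
          rw [map_sub, hQ2 w' hw', sub_zero] at this
          exact this
        rw [h3]
        have : w + -(w - w') = w' := by abel
        rw [this]; exact hw'
      · rw [(overEquiv A (key h)).finrank_eq, (overEquiv A hW).finrank_eq]
  · intro a b
    rw [mem_H0 A hW0, Subtype.mk_eq_mk]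
    constructor
    · intro h w hw
      have h1 : w + a.1 w ∈ W0.map (LinearMap.id + b.1) := by
        rw [← h]; exact ⟨w, hw, rfl⟩
      have h2 : w + b.1 w ∈ W0.map (LinearMap.id + b.1) := ⟨w, hw, rfl⟩
      have h3 := Submodule.sub_mem _ h2 h1
      have h4 : w + b.1 w - (w + a.1 w) = (b - a).1 w := by
        show _ = b.1 w - a.1 w
        abel
      rw [h4] at h3
      have h5 : (b - a).1 w ∈ W0.map (LinearMap.id + b.1) ⊓ A := ⟨h3, (b - a).2.2 w⟩
      rw [(key b).1, Submodule.mem_bot] at h5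
      exact h5
    · intro h
      apply SetLike.ext'
      show (LinearMap.id + a.1 : V →ₗ[F] V) '' (W0 : Set V) = (LinearMap.id + b.1 : V →ₗ[F] V) '' (W0 : Set V)
      apply Set.image_congr
      intro w hw
      have : b.1 w - a.1 w = 0 := h w hw
      show w + a.1 w = w + b.1 w
      rw [sub_eq_zero.1 this]

theorem over_stab_card (B : Submodule F (V ⧸ A)) (W : Submodule F V) (hW : Over A B W) (hA : ∀ w ∈ A, p w ∈ A)
    (hB : ∀ b ∈ B, A.mapQ A p hA b ∈ B) :
    Nat.card {u : HH A // ∀ w ∈ W, (p + u.1) w ∈ W} = Nat.card (H0 A B) := by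
  obtain ⟨P, hQ1, hQ2, hQ3⟩ := exists_proj A W hW.1
  have hu1 : -(P.comp (p.comp (LinearMap.id - P))) ∈ HH A := by
    refine ⟨fun a ha => ?_, fun v => A.neg_mem (hQ3 _)⟩
    show - P (p (a - P a)) = 0
    rw [hQ1 a ha, sub_self, map_zero, map_zero, neg_zero]
  set u0 : HH A := ⟨_, hu1⟩ with hu0
  have hst0 : ∀ w ∈ W, (p + u0.1) w ∈ W := by
    intro w hw
    show p w + - P (p (w - P w)) ∈ W
    rw [hQ2 w hw, sub_zero]
    obtain ⟨w', hw', h2⟩ := over_dec A hW (p w) (hB _ (over_mem A hW w hw))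
    have h3 : P (p w) = p w - w' := by
      have := hQ1 _ h2
      rw [map_sub, hQ2 w' hw', sub_zero] at this
      exact this
    rw [h3]
    have : p w + -(p w - w') = w' := by abel
    rw [this]; exact hw'
  refine Nat.card_congr ⟨fun u => ⟨u.1 - u0, ?_⟩, fun u => ⟨u.1 + u0, ?_⟩, fun u => Subtype.ext (sub_add_cancel _ _), fun u => Subtype.ext (add_sub_cancel_right _ _)⟩
  · rw [mem_H0 A hW]
    intro w hw
    have h1 := W.sub_mem (u.2 w hw) (hst0 w hw)
    have h2 : (p + u.1.1) w - (p + u0.1) w = (u.1 - u0).1 w := by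
      show p w + u.1.1 w - (p w + u0.1 w) = u.1.1 w - u0.1 w
      abel
    rw [h2] at h1
    have h5 : (u.1 - u0).1 w ∈ W ⊓ A := ⟨h1, (u.1 - u0).2.2 w⟩
    rw [hW.1, Submodule.mem_bot] at h5
    exact h5
  · intro w hw
    have h1 : (p + (u.1 + u0).1) w = (p + u0.1) w + u.1.1 w := by
      show p w + (u.1.1 w + u0.1 w) = p w + u0.1 w + u.1.1 w
      abel
    rw [h1, (mem_H0 A hW u.1).1 u.2 w hw, add_zero]
    exact hst0 w hw

theorem over_Rr (B : Submodule F (V ⧸ A)) (W : Submodule F V) (hW : Over A B W) (hA : ∀ w ∈ A, p w ∈ A) (u : HH A)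
    (hu : ∀ w ∈ W, (p + u.1) w ∈ W) : Rr K f (p + u.1) W = Rr K f (A.mapQ A p hA) B := by
  have hq : ∀ w, A.mapQ A p hA (A.mkQ w) = A.mkQ ((p + u.1) w) := by
    intro w
    show A.mkQ (p w) = A.mkQ (p w + u.1 w)
    rw [map_add, show A.mkQ (u.1 w) = 0 from (Submodule.Quotient.mk_eq_zero A).2 (u.2.2 w), add_zero]
  have hB : ∀ b ∈ B, A.mapQ A p hA b ∈ B := by
    intro b hb
    rw [← hW.2] at hb
    obtain ⟨w, hw, rfl⟩ := hb
    rw [hq]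
    exact over_mem A hW _ (hu w hw)
  rw [Rr_of f _ _ hu, Rr_of f _ _ hB]
  refine R_congr f (overEquiv A hW) _ _ fun w => Subtype.ext ?_
  exact (hq w).symm

open Classical in
theorem claim2 (hA : ∀ w ∈ A, p w ∈ A) (B : Submodule F (V ⧸ A)) :
    (∑ W : Submodule F V, if Over A B W then ∑ u : HH A, Rr K f (p + u.1) W else 0) = (Nat.card (HH A) : ℂ) * Rr K f (A.mapQ A p hA) B := by
  by_cases hB : ∀ b ∈ B, A.mapQ A p hA b ∈ B
  · rw [← over_card A B]
    have h1 : ∀ W : Submodule F V, Over A B W → ∑ u : HH A, Rr K f (p + u.1) W = (Nat.card (H0 A B) : ℂ) * Rr K f (A.mapQ A p hA) B := by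
      intro W hW
      rw [← over_stab_card A p B W hW hA hB, Nat.card_eq_fintype_card, Fintype.card_subtype, ← nsmul_eq_mul, ← Finset.sum_const, Finset.sum_filter]
      refine Finset.sum_congr rfl fun u _ => ?_
      split_ifs with h
      · exact over_Rr f A p B W hW hA u h
      · exact Rr_of_not f _ _ h
    rw [← Finset.sum_filter, Finset.sum_congr rfl (fun W hW => h1 W (Finset.mem_filter.1 hW).2), Finset.sum_const, nsmul_eq_mul,
      ← Fintype.card_subtype, ← Nat.card_eq_fintype_card]
    push_cast; ring
  · rw [Rr_of_not f _ _ hB, mul_zero]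
    refine Finset.sum_eq_zero fun W _ => ?_
    split_ifs with hW
    · refine Finset.sum_eq_zero fun u _ => ?_
      by_cases hu : ∀ w ∈ W, (p + u.1) w ∈ W
      · rw [over_Rr f A p B W hW hA u hu, Rr_of_not f _ _ hB]
      · exact Rr_of_not f _ _ hu
    · rfl
end main
end

theorem R_prim {F K : Type} [Field F] [Field K] [Algebra F K] (f : K → ℂ) (n : ℕ) :
    ∀ (V : Type) [AddCommGroup V] [Module F V] [Finite V], Module.finrank F V ≤ n → Prim (fun g : Module.End F V => R K f g) := by
  classical
  induction n with
  | zero =>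
    intro V _ _ _ h A h1 h2 p hp
    apply Finset.sum_eq_zero
    intro u _
    exact R_zero f (p + u.1) (by omega)
  | succ n ih =>
    intro V _ _ _ h A h1 h2 p hA
    have e1 : ∀ u : HH A, R K f (p + u.1) = bF K f (p.restrict hA) + bF K f (A.mapQ A p hA) - ∑ W : Submodule F V, if W ≠ ⊤ then Rr K f (p + u.1) W else 0 := by
      intro u
      rw [← prim_b f A p hA u, bF_eq_sum, eq_sub_iff_add_eq, ← Rr_top]
      have h3 := Finset.sum_erase_add Finset.univ (fun W => Rr K f (p + u.1) W) (Finset.mem_univ (⊤ : Submodule F V))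
      rw [← h3, add_comm, ← Finset.sum_filter]
      have : (Finset.univ.filter fun W : Submodule F V => W ≠ ⊤) = Finset.univ.erase ⊤ := by ext W; simp
      rw [this]
    have e2 : ∀ W : Submodule F V, (∑ u : HH A, if W ≠ ⊤ then Rr K f (p + u.1) W else 0) =
        (Nat.card (HH A) : ℂ) * (if W ≤ A then Rr K f p W else 0) + if W ⊓ A = ⊥ then ∑ u : HH A, Rr K f (p + u.1) W else 0 := by
      intro W
      have hc : W ≤ A → ∑ u : HH A, Rr K f (p + u.1) W = (Nat.card (HH A) : ℂ) * Rr K f p W := by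
        intro h3
        rw [Finset.sum_congr rfl (fun u _ => claim1 f A p u W h3), Finset.sum_const, nsmul_eq_mul, Finset.card_univ, Nat.card_eq_fintype_card]
      by_cases h3 : W ≤ A
      · have h4 : W ≠ ⊤ := by rintro rfl; exact h2 (top_le_iff.1 h3)
        by_cases h5 : W ⊓ A = ⊥
        · have : W = ⊥ := by rw [← h5, inf_eq_left.2 h3]
          subst this
          simp [Rr_bot]
        · simp only [if_pos h4, if_pos h3, if_neg h5, hc h3, add_zero]
      · by_cases h4 : W = ⊤
        · subst h4
          simp [h3, h1]
        · by_cases h5 : W ⊓ A = ⊥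
          · simp [h3, h4, h5]
          · have hlt := Submodule.finrank_lt h4
            simp only [if_pos h4, if_neg h3, if_neg h5, mul_zero, add_zero, ne_eq, h4, not_false_eq_true, if_true]
            exact claim3 f A p W h3 h5 (ih W (by omega)) hA
    rw [Finset.sum_congr rfl (fun u _ => e1 u), Finset.sum_sub_distrib, Finset.sum_comm (s := Finset.univ (α := HH A)),
      Finset.sum_congr rfl (fun W _ => e2 W), Finset.sum_add_distrib (s := (Finset.univ : Finset (Submodule F V))), ← Finset.mul_sum, ← bF_restrict_eq_sum f p A hA,
      Finset.sum_const, nsmul_eq_mul, Finset.card_univ, ← Nat.card_eq_fintype_card]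
    have e3 : (∑ W : Submodule F V, if W ⊓ A = ⊥ then ∑ u : HH A, Rr K f (p + u.1) W else 0) = (Nat.card (HH A) : ℂ) * bF K f (A.mapQ A p hA) := by
      rw [bF_eq_sum, Finset.mul_sum, Finset.sum_congr rfl (fun B _ => (claim2 f A p hA B).symm), Finset.sum_comm]
      refine Finset.sum_congr rfl fun W _ => ?_
      by_cases h5 : W ⊓ A = ⊥
      · rw [if_pos h5, Finset.sum_eq_single (W.map A.mkQ), if_pos ⟨h5, rfl⟩]
        · intro B _ hB
          exact if_neg (fun h => hB h.2.symm)
        · intro h; exact absurd (Finset.mem_univ _) h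
      · rw [if_neg h5]
        exact (Finset.sum_eq_zero fun B _ => if_neg fun h => h5 h.1).symm
    rw [e3]
    ring
end KL

namespace KL

section
variable {F : Type} [Field F] {V : Type} [AddCommGroup V] [Module F V] [Finite V]

open scoped Classical in
theorem prim_sum {v : Module.End F V → ℂ} (hv : Prim v) (A : Submodule F V) (h1 : A ≠ ⊥) (h2 : A ≠ ⊤) (χ : Module.End F V → ℂ)
    (hχ : ∀ g, (∀ w ∈ A, g w ∈ A) → ∀ u : HH A, χ (g + u.1) = χ g) :
    (∑ g : Module.End F V, if ∀ w ∈ A, g w ∈ A then χ g * v g else 0) = 0 := by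
  have hst : ∀ (g : Module.End F V) (u : HH A), (∀ w ∈ A, (g + u.1) w ∈ A) ↔ (∀ w ∈ A, g w ∈ A) := by
    intro g u
    refine forall₂_congr fun w hw => ?_
    rw [LinearMap.add_apply, u.2.1 w hw, add_zero]
  have key : (Nat.card (HH A) : ℂ) * (∑ g : Module.End F V, if ∀ w ∈ A, g w ∈ A then χ g * v g else 0) = 0 := by
    have e1 : ∑ u : HH A, (∑ g : Module.End F V, if ∀ w ∈ A, g w ∈ A then χ g * v g else 0) = 0 := by
      have e2 : ∀ u : HH A, (∑ g : Module.End F V, if ∀ w ∈ A, g w ∈ A then χ g * v g else 0) =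
          ∑ g : Module.End F V, if ∀ w ∈ A, g w ∈ A then χ g * v (g + u.1) else 0 := by
        intro u
        rw [← Equiv.sum_comp (Equiv.addRight u.1) (fun g : Module.End F V => if ∀ w ∈ A, g w ∈ A then χ g * v g else 0)]
        refine Finset.sum_congr rfl fun g _ => ?_
        show (if ∀ w ∈ A, (g + u.1) w ∈ A then χ (g + u.1) * v (g + u.1) else 0) = _
        by_cases hg : ∀ w ∈ A, g w ∈ A
        · rw [if_pos hg, if_pos ((hst g u).2 hg), hχ g hg]
        · rw [if_neg hg, if_neg (fun h => hg ((hst g u).1 h))]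
      rw [Finset.sum_congr rfl (fun u _ => e2 u), Finset.sum_comm]
      refine Finset.sum_eq_zero fun g _ => ?_
      by_cases hg : ∀ w ∈ A, g w ∈ A
      · rw [Finset.sum_congr rfl (fun u _ => if_pos hg), ← Finset.mul_sum, hv A h1 h2 g hg, mul_zero]
      · exact Finset.sum_eq_zero fun u _ => if_neg hg
    rw [Finset.sum_const, nsmul_eq_mul, Finset.card_univ, ← Nat.card_eq_fintype_card] at e1
    exact e1
  refine (mul_eq_zero.1 key).resolve_left ?_
  exact Nat.cast_ne_zero.2 Nat.card_pos.ne'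

theorem HH_trace (A : Submodule F V) (u : HH A) : LinearMap.trace F V u.1 = 0 := by
  have h : IsNilpotent u.1 := ⟨2, by
    rw [pow_two]
    exact LinearMap.ext fun v => u.2.1 _ (u.2.2 v)⟩
  exact (LinearMap.isNilpotent_trace_of_isNilpotent h).eq_zero

theorem stab_inv (A : Submodule F V) (h : (Module.End F V)ˣ) (hh : ∀ w ∈ A, h.1 w ∈ A) : ∀ w ∈ A, (h⁻¹).1 w ∈ A := by
  intro w hw
  have := (map_eq_iff_stable h A).2 hh
  rw [← this] at hw
  obtain ⟨a, ha, rfl⟩ := hw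
  rw [show (h⁻¹).1 (h.1 a) = a from LinearMap.congr_fun h.inv_mul a]
  exact ha

theorem HH_mul (A : Submodule F V) (a b : Module.End F V) (ha : ∀ w ∈ A, a w ∈ A) (hb : ∀ w ∈ A, b w ∈ A) (u : HH A) :
    a * u.1 * b ∈ HH A := by
  refine ⟨fun w hw => ?_, fun w => ha _ (u.2.2 _)⟩
  show a (u.1 (b w)) = 0
  rw [u.2.1 _ (hb w hw), map_zero]

noncomputable def TT (ψ : AddChar F ℂ) (v : Module.End F V → ℂ) (x : Module.End F V) : ℂ :=
  ∑ h : (Module.End F V)ˣ, ψ (LinearMap.trace F V (x * (h⁻¹).1)) * v h.1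

theorem sum_units (φ : Module.End F V → ℂ) (h0 : ∀ g, ¬ IsUnit g → φ g = 0) :
    ∑ h : (Module.End F V)ˣ, φ h.1 = ∑ g : Module.End F V, φ g := by
  classical
  rw [← Finset.sum_subset (Finset.subset_univ (Finset.univ.map ⟨fun h : (Module.End F V)ˣ => h.1, Units.val_injective⟩)), Finset.sum_map]
  · rfl
  · intro g _ hg
    apply h0
    rintro ⟨u, rfl⟩
    exact hg (Finset.mem_map.2 ⟨u, Finset.mem_univ _, rfl⟩)

open scoped Classical in
theorem HH_psi (ψ : AddChar F ℂ) (hψ : ∃ a : F, ψ a ≠ 1) (A : Submodule F V) (h : (Module.End F V)ˣ) :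
    ∑ u : HH A, ψ (LinearMap.trace F V (u.1 * (h⁻¹).1)) = if (∀ w ∈ A, h.1 w ∈ A) then (Nat.card (HH A) : ℂ) else 0 := by
  split_ifs with hh
  · have : ∀ u : HH A, ψ (LinearMap.trace F V (u.1 * (h⁻¹).1)) = 1 := by
      intro u
      have h1 := HH_mul A 1 (h⁻¹).1 (fun w hw => hw) (stab_inv A h hh) u
      rw [one_mul] at h1
      rw [HH_trace A ⟨_, h1⟩, AddChar.map_zero_eq_one]
    rw [Finset.sum_congr rfl (fun u _ => this u), Finset.sum_const, nsmul_eq_mul, Finset.card_univ, Nat.card_eq_fintype_card, mul_one]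
  · -- find a ∈ A with h⁻¹ a ∉ A
    have h1 : ∃ a ∈ A, (h⁻¹).1 a ∉ A := by
      by_contra hc
      push Not at hc
      apply hh
      have := stab_inv A h⁻¹ hc
      simpa using this
    obtain ⟨a, ha, ha2⟩ := h1
    obtain ⟨l, hl1, hl2⟩ := Submodule.exists_le_ker_of_notMem ha2
    obtain ⟨c, hc⟩ := hψ
    have hu : (l.smulRight ((c * (l ((h⁻¹).1 a))⁻¹) • a)) ∈ HH A := by
      refine ⟨fun w hw => ?_, fun w => ?_⟩
      · show l w • _ = (0 : V)
        rw [show l w = 0 from hl2 hw, zero_smul]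
      · exact A.smul_mem _ (A.smul_mem _ ha)
    set u0 : HH A := ⟨_, hu⟩ with hu0
    have ht : LinearMap.trace F V (u0.1 * (h⁻¹).1) = c := by
      rw [LinearMap.trace_mul_comm]
      have : (h⁻¹).1 * u0.1 = l.smulRight ((h⁻¹).1 ((c * (l ((h⁻¹).1 a))⁻¹) • a)) := by
        refine LinearMap.ext fun w => ?_
        show (h⁻¹).1 (l w • _) = l w • _
        rw [map_smul]
      rw [this, LinearMap.trace_smulRight, map_smul, map_smul, smul_eq_mul, mul_assoc, inv_mul_cancel₀ hl1, mul_one]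
    have e : ∑ u : HH A, ψ (LinearMap.trace F V (u.1 * (h⁻¹).1)) = ψ c * ∑ u : HH A, ψ (LinearMap.trace F V (u.1 * (h⁻¹).1)) := by
      conv_lhs => rw [← Equiv.sum_comp (Equiv.addLeft u0) (fun u : HH A => ψ (LinearMap.trace F V (u.1 * (h⁻¹).1)))]
      rw [Finset.mul_sum]
      refine Finset.sum_congr rfl fun u _ => ?_
      show ψ (LinearMap.trace F V ((u0.1 + u.1) * (h⁻¹).1)) = _
      rw [add_mul, map_add, AddChar.map_add_eq_mul, ht]
    have e2 : (1 - ψ c) * ∑ u : HH A, ψ (LinearMap.trace F V (u.1 * (h⁻¹).1)) = 0 := by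
      rw [sub_mul, one_mul, ← e, sub_self]
    exact (mul_eq_zero.1 e2).resolve_left (sub_ne_zero.2 (Ne.symm hc))

theorem TT_prim (ψ : AddChar F ℂ) (hψ : ∃ a : F, ψ a ≠ 1) {v : Module.End F V → ℂ} (hv : Prim v) : Prim (TT ψ v) := by
  classical
  intro A h1 h2 p hp
  unfold TT
  rw [Finset.sum_comm]
  have e1 : ∀ h : (Module.End F V)ˣ, ∑ u : HH A, ψ (LinearMap.trace F V ((p + u.1) * (h⁻¹).1)) * v h.1 =
      (Nat.card (HH A) : ℂ) * (if ∀ w ∈ A, h.1 w ∈ A then ψ (LinearMap.trace F V (p * (h⁻¹).1)) * v h.1 else 0) := by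
    intro h
    have : ∀ u : HH A, ψ (LinearMap.trace F V ((p + u.1) * (h⁻¹).1)) * v h.1 = (ψ (LinearMap.trace F V (p * (h⁻¹).1)) * v h.1) * ψ (LinearMap.trace F V (u.1 * (h⁻¹).1)) := by
      intro u
      rw [add_mul, map_add, AddChar.map_add_eq_mul]; ring
    rw [Finset.sum_congr rfl (fun u _ => this u), ← Finset.mul_sum, HH_psi ψ hψ]
    split_ifs <;> ring
  rw [Finset.sum_congr rfl (fun h _ => e1 h), ← Finset.mul_sum]
  refine mul_eq_zero_of_right _ ?_
  have e2 := prim_sum hv A h1 h2 (fun g => if IsUnit g then ψ (LinearMap.trace F V (p * Ring.inverse g)) else 0) ?_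
  · rw [← sum_units] at e2
    · refine Eq.trans ?_ e2
      refine Finset.sum_congr rfl fun h _ => ?_
      rw [if_pos h.isUnit, Ring.inverse_unit]
    · intro g hg
      simp [hg]
  · intro g hg u
    have hst : ∀ w ∈ A, (g + u.1) w ∈ A := stab_add A g hg u
    by_cases hgu : IsUnit g
    · obtain ⟨h, rfl⟩ := hgu
      have hi := stab_inv A h hg
      have hw := HH_mul A (h⁻¹).1 1 hi (fun w hw => hw) u
      rw [mul_one] at hw
      have hsq : (h⁻¹).1 * u.1 * ((h⁻¹).1 * u.1) = 0 := LinearMap.ext fun x => hw.1 _ (hw.2 x)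
      have hm : h.1 * (h⁻¹).1 = 1 := h.mul_inv
      have hm2 : (h⁻¹).1 * h.1 = 1 := h.inv_mul
      let k : (Module.End F V)ˣ := ⟨h.1 + u.1, (1 - (h⁻¹).1 * u.1) * (h⁻¹).1, by
        have : h.1 + u.1 = h.1 * (1 + (h⁻¹).1 * u.1) := by rw [mul_add, mul_one, ← mul_assoc, hm, one_mul]
        rw [this, mul_assoc, ← mul_assoc (1 + _), show (1 + (h⁻¹).1 * u.1) * (1 - (h⁻¹).1 * u.1) = 1 by
          rw [mul_sub, add_mul _ _ ((h⁻¹).1 * u.1), hsq]; simp, one_mul, hm], by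
        have : h.1 + u.1 = h.1 * (1 + (h⁻¹).1 * u.1) := by rw [mul_add, mul_one, ← mul_assoc, hm, one_mul]
        rw [this, mul_assoc, ← mul_assoc _ h.1, hm2, one_mul, mul_add, sub_mul _ _ ((h⁻¹).1 * u.1), hsq]; simp⟩
      have hk : h.1 + u.1 = k.1 := rfl
      show (if IsUnit (h.1 + u.1) then ψ (LinearMap.trace F V (p * Ring.inverse (h.1 + u.1))) else 0) = _
      rw [hk, if_pos k.isUnit, if_pos h.isUnit, Ring.inverse_unit, Ring.inverse_unit]
      show ψ (LinearMap.trace F V (p * ((1 - (h⁻¹).1 * u.1) * (h⁻¹).1))) = _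
      have h3 := HH_mul A (p * (h⁻¹).1) (h⁻¹).1 (fun w hw => hp _ (hi w hw)) hi u
      rw [sub_mul, one_mul, mul_sub, map_sub, ← mul_assoc, ← mul_assoc, HH_trace A ⟨_, h3⟩, sub_zero]
    · have : ¬ IsUnit (g + u.1) := by
        rintro ⟨h, hh⟩
        apply hgu
        have hi := stab_inv A h (by rw [hh]; exact hst)
        have hw := HH_mul A (h⁻¹).1 1 hi (fun w hw => hw) u
        rw [mul_one] at hw
        have hn : IsNilpotent ((h⁻¹).1 * u.1) := ⟨2, by rw [pow_two]; exact LinearMap.ext fun x => hw.1 _ (hw.2 x)⟩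
        have hm : h.1 * (h⁻¹).1 = 1 := h.mul_inv
        have : g = h.1 * (1 - (h⁻¹).1 * u.1) := by
          rw [mul_sub, mul_one, ← mul_assoc, hm, one_mul, hh, add_sub_cancel_right]
        rw [this]
        exact h.isUnit.mul hn.isUnit_one_sub
      show (if IsUnit (g + u.1) then _ else (0:ℂ)) = if IsUnit g then _ else 0
      rw [if_neg this, if_neg hgu]

theorem TT_class (ψ : AddChar F ℂ) {v : Module.End F V → ℂ} (hv : ∀ g (x : (Module.End F V)ˣ), v (x.1 * g * (x⁻¹).1) = v g)
    (g : Module.End F V) (x : (Module.End F V)ˣ) : TT ψ v (x.1 * g * (x⁻¹).1) = TT ψ v g := by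
  unfold TT
  rw [← Equiv.sum_comp (MulAut.conj x).toEquiv (fun h : (Module.End F V)ˣ => ψ (LinearMap.trace F V ((x.1 * g * (x⁻¹).1) * (h⁻¹).1)) * v h.1)]
  refine Finset.sum_congr rfl fun h _ => ?_
  show ψ (LinearMap.trace F V ((x.1 * g * (x⁻¹).1) * ((x * h * x⁻¹)⁻¹).1)) * v (x.1 * h.1 * (x⁻¹).1) = _
  rw [hv]
  congr 2
  have : (x.1 * g * (x⁻¹).1) * ((x * h * x⁻¹)⁻¹).1 = x.1 * (g * (h⁻¹).1 * (x⁻¹).1) := by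
    rw [show (x * h * x⁻¹)⁻¹ = x * h⁻¹ * x⁻¹ by group]
    show x.1 * g * (x⁻¹).1 * (x.1 * (h⁻¹).1 * (x⁻¹).1) = _
    have hm2 : (x⁻¹).1 * x.1 = 1 := x.inv_mul
    simp only [mul_assoc]
    rw [← mul_assoc (x⁻¹).1 x.1, hm2, one_mul]
  rw [this, LinearMap.trace_mul_comm, mul_assoc, show (x⁻¹).1 * x.1 = 1 from x.inv_mul, mul_one]

end
end KL

namespace KL

theorem ann_root {F K V : Type} [Field F] [Field K] [Algebra F K] [AddCommGroup V] [Module F V] [Module.Finite F V] (g : Module.End F V)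
    (c : Polynomial F) (hc : Polynomial.aeval g c = 0) (l : K) (hl : Polynomial.aeval l g.charpoly = 0) : Polynomial.aeval l c = 0 := by
  set G : Module.End K (TensorProduct F K V) := LinearMap.baseChange K g with hG
  have h1 : G.HasEigenvalue l := by
    rw [Module.End.hasEigenvalue_iff_isRoot_charpoly, hG, LinearMap.charpoly_baseChange]
    rw [Polynomial.IsRoot.def, Polynomial.eval_map_algebraMap]
    exact hl
  obtain ⟨x, hx⟩ := h1.exists_hasEigenvector
  have h2 := Module.End.aeval_apply_of_hasEigenvector (p := c.map (algebraMap F K)) hx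
  have h3 : Polynomial.aeval G (c.map (algebraMap F K)) = 0 := by
    rw [Polynomial.aeval_map_algebraMap]
    have h4 := Polynomial.aeval_algHom_apply (Module.End.baseChangeHom F K V) g c
    rw [hc, map_zero] at h4
    exact h4
  rw [h3, LinearMap.zero_apply, Polynomial.eval_map_algebraMap] at h2
  exact (smul_eq_zero.1 h2.symm).resolve_right hx.2

section
variable {F : Type} [Field F] {V : Type} [AddCommGroup V] [Module F V]

theorem aeval_agree (W : Submodule F V) (g g' : Module.End F V) (h1 : ∀ w ∈ W, g w ∈ W) (h2 : ∀ w ∈ W, g' w = g w) (p : Polynomial F) :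
    ∀ w ∈ W, Polynomial.aeval g' p w = Polynomial.aeval g p w ∧ Polynomial.aeval g p w ∈ W := by
  induction p using Polynomial.induction_on with
  | C a => intro w hw; simp only [Polynomial.aeval_C]; exact ⟨trivial, W.smul_mem a hw⟩
  | add p q hp hq =>
    intro w hw
    simp only [map_add, LinearMap.add_apply]
    exact ⟨by rw [(hp w hw).1, (hq w hw).1], W.add_mem (hp w hw).2 (hq w hw).2⟩
  | monomial n a h =>
    intro w hw
    have e : ∀ k : Module.End F V, Polynomial.aeval k (Polynomial.C a * Polynomial.X ^ (n+1)) w = Polynomial.aeval k (Polynomial.C a * Polynomial.X ^ n) (k w) := by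
      intro k
      rw [pow_succ, ← mul_assoc, map_mul, Polynomial.aeval_X]; rfl
    rw [e, e, h2 w hw]
    exact h _ (h1 w hw)

variable [Finite V]

theorem charpoly_HH (A : Submodule F V) (p : Module.End F V) (hA : ∀ w ∈ A, p w ∈ A) (u : HH A) : (p + u.1).charpoly = p.charpoly := by
  rw [charpoly_mul A (p + u.1) (stab_add A p hA u), charpoly_mul A p hA]
  congr 2
  · refine LinearMap.ext fun w => Subtype.ext ?_
    show p w + u.1 w = p w
    rw [u.2.1 w w.2, add_zero]
  · refine LinearMap.ext fun v => ?_
    obtain ⟨v, rfl⟩ := Submodule.Quotient.mk_surjective _ v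
    show A.mkQ ((p + u.1) v) = A.mkQ (p v)
    rw [← sub_eq_zero, ← map_sub, Submodule.mkQ_apply, Submodule.Quotient.mk_eq_zero]
    show p v + u.1 v - p v ∈ A
    rw [add_sub_cancel_left]
    exact u.2.2 v

/-- polynomial differences under `HH` -/
theorem aeval_HH (A : Submodule F V) (p : Module.End F V) (hA : ∀ w ∈ A, p w ∈ A) (u : HH A) (c : Polynomial F) (v : V) :
    Polynomial.aeval (p + u.1) c v - Polynomial.aeval p c v ∈ A := by
  induction c using Polynomial.induction_on generalizing v with
  | C a => simp only [Polynomial.aeval_C]; rw [show ∀ x : V, x - x = 0 from sub_self]; exact A.zero_mem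
  | add c d hc hd =>
    simp only [map_add, LinearMap.add_apply]
    have := A.add_mem (hc v) (hd v)
    rwa [add_sub_add_comm]
  | monomial n a h =>
    have e : ∀ k : Module.End F V, Polynomial.aeval k (Polynomial.C a * Polynomial.X ^ (n+1)) v = k (Polynomial.aeval k (Polynomial.C a * Polynomial.X ^ n) v) := by
      intro k
      rw [pow_succ', mul_left_comm, map_mul, Polynomial.aeval_X]; rfl
    rw [e, e]
    have h1 : (p + u.1) (Polynomial.aeval (p + u.1) (Polynomial.C a * Polynomial.X ^ n) v) - p (Polynomial.aeval p (Polynomial.C a * Polynomial.X ^ n) v) =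
      p (Polynomial.aeval (p + u.1) (Polynomial.C a * Polynomial.X ^ n) v - Polynomial.aeval p (Polynomial.C a * Polynomial.X ^ n) v) + u.1 (Polynomial.aeval (p + u.1) (Polynomial.C a * Polynomial.X ^ n) v) := by
      rw [LinearMap.add_apply, map_sub]; abel
    rw [h1]
    exact A.add_mem (hA _ (h v)) (u.2.2 _)

theorem ker_stab (g : Module.End F V) (c : Polynomial F) : ∀ w ∈ LinearMap.ker (Polynomial.aeval g c), g w ∈ LinearMap.ker (Polynomial.aeval g c) := by
  intro w hw
  rw [LinearMap.mem_ker] at hw ⊢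
  have : Polynomial.aeval g c * g = g * Polynomial.aeval g c := by
    have h1 := congrArg (Polynomial.aeval g) (mul_comm c Polynomial.X)
    rwa [map_mul, map_mul, Polynomial.aeval_X] at h1
  have h2 := LinearMap.congr_fun this w
  rw [Module.End.mul_apply, Module.End.mul_apply, hw, map_zero] at h2
  exact h2

theorem ker_HH (c1 c2 : Polynomial F) (hco : IsCoprime c1 c2) (g : Module.End F V) (u : HH (LinearMap.ker (Polynomial.aeval g c1)))
    (hg : g.charpoly = c1 * c2) : LinearMap.ker (Polynomial.aeval (g + u.1) c1) = LinearMap.ker (Polynomial.aeval g c1) := by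
  have hst := ker_stab g c1
  have hu : ∀ w ∈ LinearMap.ker (Polynomial.aeval g c1), (g + u.1) w = g w := fun w hw => by rw [LinearMap.add_apply, u.2.1 w hw, add_zero]
  have hCH : Polynomial.aeval g (c1 * c2) = 0 := by rw [← hg]; exact LinearMap.aeval_self_charpoly g
  apply le_antisymm
  · intro v hv
    rw [LinearMap.mem_ker] at hv
    have h1 := aeval_HH _ g hst u c1 v
    rw [hv, zero_sub, Submodule.neg_mem_iff, LinearMap.mem_ker] at h1
    obtain ⟨a, b, hab⟩ := hco
    have h2 : c1 = (a * c1) * c1 + b * (c1 * c2) := by linear_combination (-c1) * hab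
    have h3 : Polynomial.aeval g c1 v = 0 := by
      rw [h2, map_add, map_mul _ b, hCH, mul_zero, add_zero, mul_assoc, map_mul, map_mul, Module.End.mul_apply, Module.End.mul_apply, h1, map_zero]
    exact h3
  · intro v hv
    rw [LinearMap.mem_ker, (aeval_agree _ g (g + u.1) hst hu c1 v hv).1]
    exact hv

open scoped Classical in
theorem lemmaP {v : Module.End F V → ℂ} (hv : Prim v) (c1 c2 : Polynomial F) (hco : IsCoprime c1 c2) (h1 : 0 < c1.natDegree)
    (h2 : 0 < c2.natDegree) : (∑ g : Module.End F V, if g.charpoly = c1 * c2 then v g else 0) = 0 := by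
  have e1 : ∀ g : Module.End F V, (if g.charpoly = c1 * c2 then v g else 0) =
      ∑ W : Submodule F V, if ∀ w ∈ W, g w ∈ W then (if g.charpoly = c1 * c2 ∧ LinearMap.ker (Polynomial.aeval g c1) = W then 1 else 0) * v g else 0 := by
    intro g
    rw [Finset.sum_eq_single (LinearMap.ker (Polynomial.aeval g c1)), if_pos (ker_stab g c1)]
    · by_cases h : g.charpoly = c1 * c2 <;> simp [h]
    · intro W _ hW
      rw [if_neg (c := g.charpoly = c1 * c2 ∧ LinearMap.ker (Polynomial.aeval g c1) = W) (fun h => hW h.2.symm), zero_mul, ite_self]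
    · intro h; exact absurd (Finset.mem_univ _) h
  rw [Finset.sum_congr rfl (fun g _ => e1 g), Finset.sum_comm]
  refine Finset.sum_eq_zero fun W _ => ?_
  have hrt : ∀ (d : Polynomial F), 0 < d.natDegree → ∃ l : AlgebraicClosure F, Polynomial.aeval l d = 0 := fun d hd =>
    IsAlgClosed.exists_aeval_eq_zero _ d (Polynomial.natDegree_pos_iff_degree_pos.1 hd).ne'
  have key : ∀ d1 d2 : Polynomial F, IsCoprime d1 d2 → 0 < d2.natDegree → ∀ g : Module.End F V, g.charpoly = d1 * d2 → Polynomial.aeval g d1 ≠ 0 := by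
    intro d1 d2 hd hd2 g hg h0
    obtain ⟨l, hl⟩ := hrt d2 hd2
    have h3 := ann_root g d1 h0 l (by rw [hg, map_mul, hl, mul_zero])
    obtain ⟨a, b, hab⟩ := hd
    have h4 := congrArg (Polynomial.aeval l) hab
    rw [map_add, map_mul, map_mul, hl, h3, map_one, mul_zero, mul_zero, add_zero] at h4
    exact zero_ne_one h4
  by_cases hb : W = ⊥
  · refine Finset.sum_eq_zero fun g _ => ?_
    rw [if_neg (c := g.charpoly = c1 * c2 ∧ LinearMap.ker (Polynomial.aeval g c1) = W), zero_mul, ite_self]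
    rintro ⟨h3, h4⟩
    rw [hb] at h4
    refine key c2 c1 hco.symm h1 g (by rw [h3, mul_comm]) ?_
    refine LinearMap.ext fun w => ?_
    have h5 : Polynomial.aeval g c1 (Polynomial.aeval g c2 w) = 0 := by
      have h6 := LinearMap.aeval_self_charpoly g
      rw [h3, map_mul] at h6
      exact LinearMap.congr_fun h6 w
    exact (Submodule.mem_bot F).1 (h4 ▸ LinearMap.mem_ker.2 h5)
  by_cases ht : W = ⊤
  · refine Finset.sum_eq_zero fun g _ => ?_
    rw [if_neg (c := g.charpoly = c1 * c2 ∧ LinearMap.ker (Polynomial.aeval g c1) = W), zero_mul, ite_self]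
    rintro ⟨h3, h4⟩
    rw [ht] at h4
    exact key c1 c2 hco h2 g h3 (LinearMap.ker_eq_top.1 h4)
  refine prim_sum hv W hb ht _ ?_
  intro g hg u
  have hback : ∀ (g : Module.End F V) (hg : ∀ w ∈ W, g w ∈ W) (u : HH W), g.charpoly = c1 * c2 → LinearMap.ker (Polynomial.aeval g c1) = W →
      LinearMap.ker (Polynomial.aeval (g + u.1) c1) = W := by
    intro g hg u h3 h4
    subst h4
    exact ker_HH c1 c2 hco g u h3
  have h5 : ((g + u.1).charpoly = c1 * c2 ∧ LinearMap.ker (Polynomial.aeval (g + u.1) c1) = W) ↔ (g.charpoly = c1 * c2 ∧ LinearMap.ker (Polynomial.aeval g c1) = W) := by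
    rw [charpoly_HH W g hg u]
    refine and_congr_right fun h3 => ⟨fun h4 => ?_, fun h4 => hback g hg u h3 h4⟩
    have := hback (g + u.1) (stab_add W g hg u) (-u) (by rw [charpoly_HH W g hg u, h3]) h4
    rw [show g + u.1 + (-u).1 = g by show g + u.1 + -u.1 = g; rw [add_neg_cancel_right]] at this
    exact this
  simp only [h5]

end
end KL

namespace KL

section
variable {F : Type} [Field F] {V : Type} [AddCommGroup V] [Module F V]

noncomputable def evw (g : Module.End F V) (w : V) : Polynomial F →ₗ[F] V :=
  (LinearMap.applyₗ w).comp (Polynomial.aeval g).toLinearMap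

theorem evw_apply (g : Module.End F V) (w : V) (p : Polynomial F) : evw g w p = Polynomial.aeval g p w := rfl

noncomputable def cyc (g : Module.End F V) (w : V) : Submodule F V := LinearMap.range (evw g w)

theorem mem_cyc (g : Module.End F V) (w : V) : w ∈ cyc g w := ⟨1, by rw [evw_apply, map_one]; rfl⟩

theorem cyc_stab (g : Module.End F V) (w : V) : ∀ x ∈ cyc g w, g x ∈ cyc g w := by
  rintro _ ⟨p, rfl⟩
  refine ⟨Polynomial.X * p, ?_⟩
  rw [evw_apply, evw_apply, map_mul, Polynomial.aeval_X]; rfl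

theorem cyc_bot (g : Module.End F V) (w : V) : cyc g w = ⊥ ↔ w = 0 := by
  constructor
  · intro h
    have := mem_cyc g w
    rw [h] at this
    exact (Submodule.mem_bot F).1 this
  · rintro rfl
    rw [eq_bot_iff]
    rintro _ ⟨p, rfl⟩
    rw [evw_apply, map_zero]; exact Submodule.zero_mem _

theorem cyc_agree (W : Submodule F V) (g g' : Module.End F V) (h1 : ∀ w ∈ W, g w ∈ W) (h2 : ∀ w ∈ W, g' w = g w) (w : V) (hw : w ∈ W) :
    cyc g' w = cyc g w := by
  have : evw g' w = evw g w := LinearMap.ext fun p => (aeval_agree W g g' h1 h2 p w hw).1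
  unfold cyc; rw [this]

variable [Finite V]

open scoped Classical in
theorem krylov {v : Module.End F V → ℂ} (hv : Prim v) (c : Polynomial F) (hV : 0 < Module.finrank F V) :
    ((Nat.card V : ℂ) - 1) * (∑ g : Module.End F V, if g.charpoly = c then v g else 0) =
    ∑ g : Module.End F V, (Nat.card {w // cyc g w = ⊤} : ℂ) * (if g.charpoly = c then v g else 0) := by
  have hbt : (⊥ : Submodule F V) ≠ ⊤ := by
    intro h
    have := finrank_bot F V
    rw [h, finrank_top] at this
    omega
  have hcard : ∀ g : Module.End F V, (Nat.card V : ℂ) = ∑ W : Submodule F V, (Nat.card {w // cyc g w = W} : ℂ) := by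
    intro g
    haveI := Fintype.ofFinite V
    rw [← Nat.cast_sum, Nat.cast_inj, Nat.card_eq_fintype_card, ← Finset.card_univ,
      Finset.card_eq_sum_card_fiberwise (f := fun w => cyc g w) (t := Finset.univ) (fun _ _ => Finset.mem_univ _)]
    refine Finset.sum_congr rfl fun W _ => ?_
    rw [Nat.card_eq_fintype_card, Fintype.card_subtype]
  have hb : ∀ g : Module.End F V, Nat.card {w // cyc g w = ⊥} = 1 := by
    intro g
    rw [Nat.card_eq_one_iff_unique]
    refine ⟨⟨fun a b => Subtype.ext (((cyc_bot g _).1 a.2).trans ((cyc_bot g _).1 b.2).symm)⟩, ⟨0, (cyc_bot g 0).2 rfl⟩⟩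
  have hmid : ∀ W : Submodule F V, W ≠ ⊥ → W ≠ ⊤ →
      ∑ g : Module.End F V, (Nat.card {w // cyc g w = W} : ℂ) * (if g.charpoly = c then v g else 0) = 0 := by
    intro W h1 h2
    have e := prim_sum hv W h1 h2 (fun g => (Nat.card {w // cyc g w = W} : ℂ) * (if g.charpoly = c then 1 else 0)) ?_
    · refine Eq.trans (Finset.sum_congr rfl fun g _ => ?_) e
      by_cases hg : ∀ w ∈ W, g w ∈ W
      · rw [if_pos hg]; split_ifs <;> ring
      · rw [if_neg hg]
        have : IsEmpty {w // cyc g w = W} := ⟨fun a => hg (by have := cyc_stab g a.1; rwa [a.2] at this)⟩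
        rw [Nat.card_of_isEmpty]; simp
    · intro g hg u
      show (Nat.card {w // cyc (g + u.1) w = W} : ℂ) * (if (g + u.1).charpoly = c then 1 else 0) = (Nat.card {w // cyc g w = W} : ℂ) * (if g.charpoly = c then 1 else 0)
      rw [charpoly_HH W g hg u]
      congr 2
      refine Nat.card_congr (Equiv.subtypeEquivRight fun w => ?_)
      have hu : ∀ w ∈ W, (g + u.1) w = g w := fun w hw => by rw [LinearMap.add_apply, u.2.1 w hw, add_zero]
      constructor
      · intro h
        rw [← cyc_agree W g (g + u.1) hg hu w (h ▸ mem_cyc _ w)]; exact h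
      · intro h
        rw [cyc_agree W g (g + u.1) hg hu w (h ▸ mem_cyc _ w)]; exact h
  have e1 : (Nat.card V : ℂ) * (∑ g : Module.End F V, if g.charpoly = c then v g else 0) =
      ∑ W : Submodule F V, ∑ g : Module.End F V, (Nat.card {w // cyc g w = W} : ℂ) * (if g.charpoly = c then v g else 0) := by
    rw [Finset.mul_sum, Finset.sum_comm]
    refine Finset.sum_congr rfl fun g _ => ?_
    rw [← Finset.sum_mul, ← hcard]
  rw [sub_mul, e1, one_mul, Finset.sum_eq_add ⊥ ⊤ hbt (fun W _ h => hmid W h.1 h.2) (fun h => absurd (Finset.mem_univ _) h) (fun h => absurd (Finset.mem_univ _) h)]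
  simp only [hb, Nat.cast_one, one_mul]
  ring

/-- the standard cyclic operator -/
noncomputable def mulRoot (c : Polynomial F) : Module.End F (AdjoinRoot c) := LinearMap.mulLeft F (AdjoinRoot.root c)

theorem adj_finrank (c : Polynomial F) (hc : c.Monic) : Module.finrank F (AdjoinRoot c) = c.natDegree := by
  rw [(AdjoinRoot.powerBasis' hc).finrank, AdjoinRoot.powerBasis'_dim]

theorem mulRoot_charpoly (c : Polynomial F) (hc : c.Monic) [Module.Finite F (AdjoinRoot c)] : (mulRoot c).charpoly = c := by
  have h1 := charpoly_leftMulMatrix (AdjoinRoot.powerBasis' hc)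
  rw [Algebra.leftMulMatrix_apply, LinearMap.charpoly_toMatrix, AdjoinRoot.powerBasis'_gen] at h1
  refine Eq.trans h1 ?_
  have h2 := AdjoinRoot.minpoly_powerBasis_gen_of_monic hc
  rw [AdjoinRoot.powerBasis_gen] at h2
  exact h2

theorem mulRoot_aeval (c p : Polynomial F) (x : AdjoinRoot c) : Polynomial.aeval (mulRoot c) p x = AdjoinRoot.mk c p * x := by
  have h1 : mulRoot c = Algebra.lmul F (AdjoinRoot c) (AdjoinRoot.root c) := rfl
  rw [h1, Polynomial.aeval_algHom_apply, AdjoinRoot.aeval_eq]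
  rfl

theorem conj_aeval {V' : Type} [AddCommGroup V'] [Module F V'] (e : V' ≃ₗ[F] V) (g : Module.End F V') (p : Polynomial F) (x : V) :
    Polynomial.aeval (e.conj g) p x = e (Polynomial.aeval g p (e.symm x)) := by
  have := Polynomial.aeval_algHom_apply (e.conjAlgEquiv F).toAlgHom g p
  exact LinearMap.congr_fun this x

noncomputable def pairEquiv (c : Polynomial F) (hc : c.Monic) (hd : c.natDegree = Module.finrank F V) :
    (AdjoinRoot c ≃ₗ[F] V) ≃ {gw : Module.End F V × V // gw.1.charpoly = c ∧ cyc gw.1 gw.2 = ⊤} :=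
  haveI : Module.Finite F (AdjoinRoot c) := (AdjoinRoot.powerBasis' hc).finite
  Equiv.ofBijective (fun e => ⟨(e.conj (mulRoot c), e 1), by
    constructor
    · show (e.conj (mulRoot c)).charpoly = c
      rw [LinearEquiv.charpoly_conj, mulRoot_charpoly c hc]
    · rw [eq_top_iff]
      intro x _
      obtain ⟨p, hp⟩ := AdjoinRoot.mk_surjective (e.symm x)
      refine ⟨p, ?_⟩
      show Polynomial.aeval (e.conj (mulRoot c)) p (e 1) = x
      rw [conj_aeval, mulRoot_aeval, e.symm_apply_apply, mul_one, hp, e.apply_symm_apply]⟩) (by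
    constructor
    · intro e e' h
      have h1 := congrArg (fun z => z.1.1) h
      have h2 := congrArg (fun z => z.1.2) h
      change e.conj (mulRoot c) = e'.conj (mulRoot c) at h1
      change e 1 = e' 1 at h2
      refine LinearEquiv.ext fun y => ?_
      obtain ⟨p, rfl⟩ := AdjoinRoot.mk_surjective y
      have h3 := conj_aeval e (mulRoot c) p (e 1)
      rw [h1, h2, conj_aeval, mulRoot_aeval, mulRoot_aeval, ← h2, e.symm_apply_apply, h2, e'.symm_apply_apply, mul_one] at h3
      exact h3.symm
    · rintro ⟨⟨g, w⟩, h1, h2⟩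
      change g.charpoly = c at h1
      change cyc g w = ⊤ at h2
      have h0 : ∀ p ∈ Ideal.span {c}, evw g w p = 0 := by
        intro p hp
        obtain ⟨d, rfl⟩ := Ideal.mem_span_singleton.1 hp
        rw [evw_apply, map_mul, ← h1, LinearMap.aeval_self_charpoly, zero_mul]; rfl
      let f0 : AdjoinRoot c →ₗ[F] V :=
        { toFun := Quotient.lift (fun p => evw g w p) (by
            intro a b hab
            have := h0 (a - b) ((Submodule.quotientRel_def _).1 hab)
            rw [map_sub] at this
            exact sub_eq_zero.1 this)
          map_add' := by
            intro a b
            obtain ⟨p, rfl⟩ := AdjoinRoot.mk_surjective a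
            obtain ⟨q, rfl⟩ := AdjoinRoot.mk_surjective b
            exact map_add (evw g w) p q
          map_smul' := by
            intro r a
            obtain ⟨p, rfl⟩ := AdjoinRoot.mk_surjective a
            exact map_smul (evw g w) r p }
      have hf0 : ∀ p, f0 (AdjoinRoot.mk c p) = Polynomial.aeval g p w := fun p => rfl
      have hs : Function.Surjective f0 := by
        intro x
        have : x ∈ cyc g w := by rw [h2]; trivial
        obtain ⟨p, rfl⟩ := this
        exact ⟨AdjoinRoot.mk c p, rfl⟩
      have hi := (LinearMap.injective_iff_surjective_of_finrank_eq_finrank (f := f0) (by rw [adj_finrank c hc, hd])).2 hs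
      let e := LinearEquiv.ofBijective f0 ⟨hi, hs⟩
      have he : ∀ p, e (AdjoinRoot.mk c p) = Polynomial.aeval g p w := hf0
      refine ⟨e, Subtype.ext (Prod.ext ?_ ?_)⟩
      · show e.conj (mulRoot c) = g
        refine LinearMap.ext fun x => ?_
        obtain ⟨y, rfl⟩ := e.surjective x
        obtain ⟨p, rfl⟩ := AdjoinRoot.mk_surjective y
        rw [LinearEquiv.conj_apply_apply, e.symm_apply_apply]
        show e (AdjoinRoot.mk c Polynomial.X * AdjoinRoot.mk c p) = _
        rw [← map_mul, he, he, map_mul, Polynomial.aeval_X]; rfl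
      · show e 1 = w
        rw [← map_one (AdjoinRoot.mk c), he, map_one]; rfl)

open scoped Classical in
theorem cyc_sum {v : Module.End F V → ℂ} (hcl : ∀ g (x : (Module.End F V)ˣ), v (x.1 * g * (x⁻¹).1) = v g) (c : Polynomial F) (hc : c.Monic) (e : AdjoinRoot c ≃ₗ[F] V) :
    ∑ g : Module.End F V, (Nat.card {w // cyc g w = ⊤} : ℂ) * (if g.charpoly = c then v g else 0) =
    (Nat.card (Module.End F V)ˣ : ℂ) * v (e.conj (mulRoot c)) := by
  haveI := Fintype.ofFinite V
  have hd : c.natDegree = Module.finrank F V := by rw [← e.finrank_eq, adj_finrank c hc]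
  have e1 : ∀ g : Module.End F V, (Nat.card {w // cyc g w = ⊤} : ℂ) * (if g.charpoly = c then v g else 0) =
      ∑ w : V, if g.charpoly = c ∧ cyc g w = ⊤ then v g else 0 := by
    intro g
    by_cases h : g.charpoly = c
    · simp only [h, true_and, if_true]
      rw [← Finset.sum_filter, Finset.sum_const, nsmul_eq_mul, Nat.card_eq_fintype_card, Fintype.card_subtype]
    · simp [h]
  rw [Finset.sum_congr rfl (fun g _ => e1 g), ← Fintype.sum_prod_type' (fun g w => if g.charpoly = c ∧ cyc g w = ⊤ then v g else 0),
    ← Finset.sum_filter, ← Finset.sum_subtype_eq_sum_filter]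
  have hfin : Finite (AdjoinRoot c ≃ₗ[F] V) := Finite.of_equiv _ (pairEquiv c hc hd).symm
  haveI := Fintype.ofFinite (AdjoinRoot c ≃ₗ[F] V)
  have e2 : ∀ e' : AdjoinRoot c ≃ₗ[F] V, v (e'.conj (mulRoot c)) = v (e.conj (mulRoot c)) := by
    intro e'
    let x : (Module.End F V)ˣ := LinearMap.GeneralLinearGroup.ofLinearEquiv (e.symm.trans e')
    rw [← hcl (e.conj (mulRoot c)) x]
    congr 1
    refine LinearMap.ext fun y => ?_
    show e' (mulRoot c (e'.symm y)) = e' (e.symm (e (mulRoot c (e.symm (e (e'.symm y))))))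
    rw [e.symm_apply_apply, e.symm_apply_apply]
  have e3 := Equiv.sum_comp (pairEquiv c hc hd) (fun z => v z.1.1)
  have e4 : ∑ e' : AdjoinRoot c ≃ₗ[F] V, v (((pairEquiv c hc hd) e').1.1) = (Nat.card (Module.End F V)ˣ : ℂ) * v (e.conj (mulRoot c)) := by
    rw [Finset.sum_congr rfl (fun e' _ => show v (((pairEquiv c hc hd) e').1.1) = _ from e2 e'), Finset.sum_const, nsmul_eq_mul, Finset.card_univ, ← Nat.card_eq_fintype_card]
    congr 2
    refine Nat.card_congr (Equiv.trans ?_ (LinearMap.GeneralLinearGroup.generalLinearEquiv F V).symm.toEquiv)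
    exact ⟨fun e' => e.symm.trans e', fun e' => e.trans e', fun e' => by ext; simp, fun e' => by ext; simp⟩
  rw [← e4, e3]
  refine Finset.sum_bij' (i := fun z hz => ⟨z.1, z.2⟩) (j := fun z hz => ⟨z.1, z.2⟩) ?_ ?_ ?_ ?_ ?_ <;> simp
end
end KL

namespace KL

section
variable {F : Type} [Field F] {V : Type} [AddCommGroup V] [Module F V]

theorem cyc_le (g : Module.End F V) (w : V) (hw : ∀ y, ∃ p : Polynomial F, Polynomial.aeval g p w = y) (d : Polynomial F) (hd : d.Monic)
    (h0 : Polynomial.aeval g d w = 0) : Module.finrank F V ≤ d.natDegree := by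
  let φ : Polynomial.degreeLT F d.natDegree →ₗ[F] V := (evw g w).domRestrict _
  have hs : Function.Surjective φ := by
    intro y
    obtain ⟨p, rfl⟩ := hw y
    refine ⟨⟨p %ₘ d, ?_⟩, ?_⟩
    · rw [Polynomial.mem_degreeLT, ← Polynomial.degree_eq_natDegree hd.ne_zero]
      exact Polynomial.degree_modByMonic_lt p hd
    · show Polynomial.aeval g (p %ₘ d) w = Polynomial.aeval g p w
      conv_rhs => rw [← Polynomial.modByMonic_add_div p d]
      rw [map_add, LinearMap.add_apply, mul_comm d, map_mul, Module.End.mul_apply, h0, map_zero, add_zero]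
  haveI : Module.Finite F (Polynomial.degreeLT F d.natDegree) := Module.Finite.equiv (Polynomial.degreeLTEquiv F d.natDegree).symm
  have h1 := LinearMap.finrank_le_finrank_of_surjective hs
  rwa [(Polynomial.degreeLTEquiv F d.natDegree).finrank_eq, Module.finrank_fin_fun] at h1

theorem aeval_mapQ (A : Submodule F V) (g : Module.End F V) (hA : ∀ w ∈ A, g w ∈ A) (p : Polynomial F) (v : V) :
    Polynomial.aeval (A.mapQ A g hA) p (A.mkQ v) = A.mkQ (Polynomial.aeval g p v) := by
  induction p using Polynomial.induction_on generalizing v with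
  | C a => simp only [Polynomial.aeval_C]; rfl
  | add p q hp hq => simp only [map_add, LinearMap.add_apply, hp, hq]
  | monomial n a h =>
    rw [pow_succ, ← mul_assoc, map_mul, map_mul _ _ Polynomial.X, Polynomial.aeval_X, Polynomial.aeval_X]
    exact h (g v)

variable {K : Type} [Field K] [Algebra F K] [Finite V]

theorem R_cyc (f : K → ℂ) (P : Polynomial F) (hP : Irreducible P) (hPm : P.Monic) (r : ℕ) (hr : 0 < r) (g : Module.End F V) (w0 : V)
    (hc : g.charpoly = P ^ r) (hw : cyc g w0 = ⊤) : R K f g = ((P.aroots K).map f).sum := by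
  classical
  have hw' : ∀ y, ∃ p : Polynomial F, Polynomial.aeval g p w0 = y := by
    intro y
    have : y ∈ cyc g w0 := by rw [hw]; trivial
    exact this
  have hdeg : Module.finrank F V = r * P.natDegree := by
    rw [← LinearMap.charpoly_natDegree g, hc, hPm.natDegree_pow]
  have hPd := hP.natDegree_pos
  have hCH : Polynomial.aeval g (P ^ r) = 0 := by rw [← hc]; exact LinearMap.aeval_self_charpoly g
  obtain ⟨r, rfl⟩ : ∃ s, r = s + 1 := ⟨r - 1, by omega⟩
  set M := LinearMap.ker (Polynomial.aeval g (P ^ r)) with hM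
  have hMst : ∀ w ∈ M, g w ∈ M := ker_stab g _
  have hMt : M ≠ ⊤ := by
    intro h
    have h1 : Polynomial.aeval g (P ^ r) w0 = 0 := by
      have : w0 ∈ M := by rw [h]; trivial
      exact this
    have := cyc_le g w0 hw' _ (hPm.pow r) h1
    rw [hPm.natDegree_pow, hdeg] at this
    nlinarith
  have hmax : ∀ W : Submodule F V, (∀ w ∈ W, g w ∈ W) → W ≠ ⊤ → W ≤ M := by
    intro W hW hWt w hwW
    obtain ⟨p, rfl⟩ := hw' w
    by_cases hp : P ∣ p
    · obtain ⟨q, rfl⟩ := hp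
      show Polynomial.aeval g (P ^ r) (Polynomial.aeval g (P * q) w0) = 0
      rw [← Module.End.mul_apply, ← map_mul, ← mul_assoc, ← pow_succ, map_mul, hCH, zero_mul]; rfl
    · exfalso
      apply hWt
      have hco : IsCoprime p (P ^ (r+1)) := (IsCoprime.pow_left ((hP.coprime_iff_not_dvd).2 hp)).symm
      obtain ⟨a, b, hab⟩ := hco
      have h1 : w0 ∈ W := by
        have h2 : Polynomial.aeval g (a * p + b * P ^ (r+1)) w0 = w0 := by rw [hab, map_one]; rfl
        rw [map_add, map_mul _ b, hCH, mul_zero, add_zero, map_mul, Module.End.mul_apply] at h2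
        rw [← h2]
        exact (aeval_agree W g g hW (fun _ _ => rfl) a _ hwW).2
      rw [eq_top_iff]
      intro y _
      obtain ⟨q, rfl⟩ := hw' y
      exact (aeval_agree W g g hW (fun _ _ => rfl) q _ h1).2
  have e1 : bF K f g = R K f g + bF K f (g.restrict hMst) := by
    rw [bF_restrict_eq_sum f g M hMst, bF_eq_sum, ← Rr_top f g, ← Finset.add_sum_erase _ _ (Finset.mem_univ (⊤ : Submodule F V))]
    congr 1
    rw [← Finset.add_sum_erase (a := (⊤ : Submodule F V)) _ (fun W => if W ≤ M then Rr K f g W else 0) (Finset.mem_univ _), if_neg (fun h => hMt (top_le_iff.1 h)), zero_add]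
    refine Finset.sum_congr rfl fun W hW => ?_
    by_cases h : ∀ w ∈ W, g w ∈ W
    · rw [if_pos (hmax W h (Finset.ne_of_mem_erase hW))]
    · rw [Rr_of_not f g W h, ite_self]
  have e2 := bF_add (K := K) f M g hMst
  have e3 := charpoly_mul M g hMst
  rw [hc] at e3
  have e4 : (M.mapQ M g hMst).charpoly ∣ P ^ (r+1) := ⟨_, by rw [mul_comm]; exact e3⟩
  obtain ⟨j, _, hj⟩ := (dvd_prime_pow hP.prime _).1 e4
  have e5 := Polynomial.eq_of_monic_of_associated (LinearMap.charpoly_monic _) (hPm.pow j) hj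
  have e6 : Module.finrank F (V ⧸ M) = j * P.natDegree := by
    rw [← LinearMap.charpoly_natDegree (M.mapQ M g hMst), e5, hPm.natDegree_pow]
  have e7 : Module.finrank F (V ⧸ M) ≤ P.natDegree := by
    refine cyc_le (M.mapQ M g hMst) (M.mkQ w0) ?_ P hPm ?_
    · intro y
      obtain ⟨v, rfl⟩ := Submodule.mkQ_surjective M y
      obtain ⟨p, rfl⟩ := hw' v
      exact ⟨p, aeval_mapQ M g hMst p w0⟩
    · rw [aeval_mapQ, Submodule.mkQ_apply, Submodule.Quotient.mk_eq_zero]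
      show Polynomial.aeval g (P ^ r) (Polynomial.aeval g P w0) = 0
      rw [← Module.End.mul_apply, ← map_mul, ← pow_succ, hCH]; rfl
  have e8 : 0 < Module.finrank F (V ⧸ M) := by
    have h1 := Submodule.finrank_quotient_add_finrank M
    have h2 := Submodule.finrank_lt hMt
    omega
  have e9 : j = 1 := by
    rw [e6] at e7 e8
    have h1 : j ≤ 1 := by
      by_contra h
      have : 2 * P.natDegree ≤ j * P.natDegree := Nat.mul_le_mul_right _ (by omega)
      omega
    have h2 : j ≠ 0 := by rintro rfl; omega
    omega
  rw [e9, pow_one] at e5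
  have e10 : bF K f (M.mapQ M g hMst) = ((P.aroots K).map f).sum := by unfold bF; rw [e5]
  rw [← e10]
  linear_combination -e1 + e2

open scoped Classical in
theorem R_primary (f : K → ℂ) (P : Polynomial F) (hP : Irreducible P) (hPm : P.Monic) (r : ℕ) (hr : 0 < r)
    (hdeg : r * P.natDegree = Module.finrank F V) :
    ((Nat.card V : ℂ) - 1) * (∑ g : Module.End F V, if g.charpoly = P ^ r then R K f g else 0) =
    (Nat.card (Module.End F V)ˣ : ℂ) * ((P.aroots K).map f).sum := by
  have hc : (P ^ r).Monic := hPm.pow r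
  have hpos : 0 < Module.finrank F V := by rw [← hdeg]; exact Nat.mul_pos hr hP.natDegree_pos
  rw [krylov (R_prim f _ V le_rfl) (P ^ r) hpos]
  haveI : Module.Finite F (AdjoinRoot (P ^ r)) := (AdjoinRoot.powerBasis' hc).finite
  let e : AdjoinRoot (P ^ r) ≃ₗ[F] V := LinearEquiv.ofFinrankEq _ _ (by rw [adj_finrank _ hc, hPm.natDegree_pow, hdeg])
  rw [cyc_sum (fun g x => R_class f g x) (P ^ r) hc e]
  have h := (pairEquiv (V := V) (P ^ r) hc (by rw [hPm.natDegree_pow, hdeg]) e).2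
  rw [R_cyc f P hP hPm r hr (e.conj (mulRoot (P ^ r))) (e 1) h.1 h.2]
end
end KL

namespace KL

section
variable {F : Type} [Field F] [Finite F] {E : Type} [Field E] [Finite E] [Algebra F E]

noncomputable def Mt (F : Type) [Field F] {E : Type} [Field E] [Algebra F E] (t : E) : Polynomial F :=
  minpoly F t ^ (Module.finrank F E / (minpoly F t).natDegree)

theorem min_irr (t : E) : Irreducible (minpoly F t) := minpoly.irreducible (Algebra.IsIntegral.isIntegral t)
theorem min_monic (t : E) : (minpoly F t).Monic := minpoly.monic (Algebra.IsIntegral.isIntegral t)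
theorem min_dvd (t : E) : (minpoly F t).natDegree ∣ Module.finrank F E := minpoly.degree_dvd (Algebra.IsIntegral.isIntegral t)

theorem frob_fixed (t : E) (i : ℕ) : t ^ (Nat.card F ^ i) = t ↔ (minpoly F t).natDegree ∣ i := by
  rw [(min_irr t).natDegree_dvd_iff_dvd_X_pow_card_pow_sub_X, minpoly.dvd_iff, map_sub, map_pow, Polynomial.aeval_X, sub_eq_zero]

theorem frob_add (t : E) (i j : ℕ) : t ^ (Nat.card F ^ (i + j)) = (t ^ (Nat.card F ^ i)) ^ (Nat.card F ^ j) := by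
  rw [pow_add, pow_mul]

theorem frob_inj (i : ℕ) : Function.Injective (fun t : E => t ^ (Nat.card F ^ i)) := by
  haveI := Fintype.ofFinite F
  have h := ((FiniteField.frobeniusAlgHom F E) ^ i).toRingHom.injective
  intro a b hab
  apply h
  have h2 : ∀ (i : ℕ) (x : E), ((FiniteField.frobeniusAlgHom F E) ^ i) x = x ^ (Nat.card F ^ i) := by
    intro i x
    induction i with
    | zero => simp
    | succ i ih =>
      rw [pow_succ', AlgHom.mul_apply, ih, FiniteField.frobeniusAlgHom_apply, ← Nat.card_eq_fintype_card, ← pow_mul, ← pow_succ]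
  show ((FiniteField.frobeniusAlgHom F E) ^ i) a = ((FiniteField.frobeniusAlgHom F E) ^ i) b
  rw [h2, h2]
  exact hab

theorem frob_root (p : Polynomial F) (t : E) (h : Polynomial.aeval t p = 0) (i : ℕ) : Polynomial.aeval (t ^ (Nat.card F ^ i)) p = 0 := by
  induction i with
  | zero => simpa using h
  | succ i ih =>
    haveI := Fintype.ofFinite F
    rw [pow_succ, pow_mul, Nat.card_eq_fintype_card, ← FiniteField.frobeniusAlgHom_apply F E, Polynomial.aeval_algHom_apply, ← Nat.card_eq_fintype_card, ih, map_zero]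

theorem min_aroots (t : E) : (minpoly F t).aroots E = (Multiset.range (minpoly F t).natDegree).map (fun i => t ^ (Nat.card F ^ i)) := by
  symm
  refine Multiset.eq_of_le_of_card_le ((Multiset.le_iff_subset ?_).2 ?_) ?_
  · refine Multiset.Nodup.map_on ?_ (Multiset.nodup_range _)
    have key : ∀ x y : ℕ, x < (minpoly F t).natDegree → y < (minpoly F t).natDegree → x ≤ y → t ^ (Nat.card F ^ x) = t ^ (Nat.card F ^ y) → x = y := by
      intro x y hx hy hxy h
      obtain ⟨d, rfl⟩ := Nat.exists_eq_add_of_le hxy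
      rw [add_comm x d, frob_add] at h
      have h2 := (frob_fixed t d).1 (frob_inj (F := F) x h.symm)
      have := Nat.eq_zero_of_dvd_of_lt h2 (by omega)
      omega
    intro x hx y hy h
    rw [Multiset.mem_range] at hx hy
    rcases le_total x y with hxy | hxy
    · exact key x y hx hy hxy h
    · exact (key y x hy hx hxy h.symm).symm
  · intro s hs
    obtain ⟨i, _, rfl⟩ := Multiset.mem_map.1 hs
    rw [Polynomial.mem_aroots]
    exact ⟨(min_irr t).ne_zero, frob_root _ t (minpoly.aeval F t) i⟩
  · rw [Multiset.card_map, Multiset.card_range]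
    exact Polynomial.card_roots_map_le_natDegree _

theorem Mt_aroots (t : E) : (Mt F t).aroots E = (Multiset.range (Module.finrank F E)).map (fun i => t ^ (Nat.card F ^ i)) := by
  unfold Mt
  rw [Polynomial.aroots_pow, min_aroots]
  obtain ⟨k, hk⟩ := min_dvd (F := F) t
  have hd := (min_irr (F := F) t).natDegree_pos
  rw [hk, Nat.mul_div_cancel_left _ hd]
  set d := (minpoly F t).natDegree with hdd
  clear hk
  induction k with
  | zero => simp
  | succ k ih =>
    rw [succ_nsmul, ih, mul_add, mul_one, Multiset.range_add, Multiset.map_add, Multiset.map_map]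
    congr 1
    refine Multiset.map_congr rfl fun i _ => ?_
    rw [Function.comp_apply, frob_add, (frob_fixed t (d * k)).2 (Dvd.intro _ rfl)]

theorem split_E (P : Polynomial F) (hP : Irreducible P) (hd : P.natDegree ∣ Module.finrank F E) : (P.map (algebraMap F E)).Splits := by
  haveI := Fintype.ofFinite E
  have h1 := (FiniteField.isSplittingField_sub E F).splits
  refine h1.of_dvd ?_ (Polynomial.map_dvd _ ?_)
  · rw [Polynomial.map_sub, Polynomial.map_pow, Polynomial.map_X]
    exact FiniteField.X_pow_card_sub_X_ne_zero E Fintype.one_lt_card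
  · have := hP.natDegree_dvd_iff_dvd_X_pow_card_pow_sub_X.1 hd
    rwa [← Module.natCard_eq_pow_finrank, Nat.card_eq_fintype_card] at this

variable {K : Type} [Field K] [Algebra F K] [Algebra E K] [IsScalarTower F E K]

open scoped Classical in
theorem sum_min [Fintype E] (f : K → ℂ) (P : Polynomial F) (hP : Irreducible P) (hPm : P.Monic) (hd : P.natDegree ∣ Module.finrank F E) :
    ((P.aroots K).map f).sum = ∑ t : E, if minpoly F t = P then f (algebraMap E K t) else 0 := by
  rw [← (split_E (E := E) P hP hd).map_aroots_algebraMap, Multiset.map_map, ← Finset.sum_filter]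
  have hn : (P.aroots E).Nodup := Polynomial.nodup_roots ((PerfectField.separable_of_irreducible hP).map)
  have : (P.aroots E) = (Finset.univ.filter fun t : E => minpoly F t = P).val := by
    refine (Multiset.Nodup.ext hn (Finset.nodup _)).2 fun t => ?_
    rw [Polynomial.mem_aroots, Finset.mem_val, Finset.mem_filter]
    constructor
    · rintro ⟨_, h⟩
      exact ⟨Finset.mem_univ _, (minpoly.eq_of_irreducible_of_monic hP h hPm).symm⟩
    · rintro ⟨_, rfl⟩
      exact ⟨hP.ne_zero, minpoly.aeval F t⟩
  rw [this]; rfl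

theorem Mt_eq_iff (t : E) (P d : Polynomial F) (hP : Irreducible P) (hPm : P.Monic) (r : ℕ) (hr : 0 < r) (hd : ¬ P ∣ d) (h : Mt F t = P ^ r * d) :
    minpoly F t = P ∧ IsUnit d := by
  have h1 : P ∣ Mt F t := by rw [h]; exact Dvd.dvd.mul_right (dvd_pow_self P hr.ne') d
  have h2 : P ∣ minpoly F t := hP.prime.dvd_of_dvd_pow h1
  have h3 : minpoly F t = P := (Polynomial.eq_of_monic_of_associated hPm (min_monic t) (hP.associated_of_dvd (min_irr t) h2)).symm
  refine ⟨h3, ?_⟩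
  have h4 : d ∣ P ^ (Module.finrank F E / (minpoly F t).natDegree) := ⟨P ^ r, by rw [mul_comm d, ← h]; unfold Mt; rw [h3]⟩
  have hco : IsCoprime d (P ^ (Module.finrank F E / (minpoly F t).natDegree)) := (IsCoprime.pow_left ((hP.coprime_iff_not_dvd).2 hd)).symm
  exact hco.isUnit_of_dvd' dvd_rfl h4

variable {V : Type} [AddCommGroup V] [Module F V] [Finite V]

open scoped Classical in
theorem fib_eq [Fintype E] (f : K → ℂ) (hV : Module.finrank F V = Module.finrank F E) (c : Polynomial F) (hc : c.Monic) (hcd : c.natDegree = Module.finrank F V) :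
    ((Nat.card V : ℂ) - 1) * (∑ g : Module.End F V, if g.charpoly = c then R K f g else 0) =
    (Nat.card (Module.End F V)ˣ : ℂ) * ∑ t : E, if Mt F t = c then f (algebraMap E K t) else 0 := by
  have hpos : 0 < Module.finrank F V := by rw [hV]; exact Module.finrank_pos
  have hnu : ¬ IsUnit c := fun h => by
    have := Polynomial.natDegree_eq_zero_of_isUnit h
    omega
  obtain ⟨P, hPm, hP, hPc⟩ := Polynomial.exists_monic_irreducible_factor c hnu
  have hfm := Polynomial.finiteMultiplicity_of_degree_pos_of_monic (Polynomial.natDegree_pos_iff_degree_pos.1 hP.natDegree_pos) hPm hc.ne_zero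
  obtain ⟨d, hd, hPd⟩ := hfm.exists_eq_pow_mul_and_not_dvd
  set r := multiplicity P c with hr
  have hr0 : 0 < r := by
    rw [Nat.pos_iff_ne_zero]
    intro h0
    rw [h0, pow_zero, one_mul] at hd
    exact hPd (hd ▸ hPc)
  have hdm : d.Monic := (hPm.pow r).of_mul_monic_left (by rw [← hd]; exact hc)
  rw [hd]
  by_cases hdd : d.natDegree = 0
  · have hd1 : d = 1 := hdm.natDegree_eq_zero.1 hdd
    subst hd1
    rw [mul_one] at hd ⊢
    have hdeg : r * P.natDegree = Module.finrank F V := by rw [← hcd, hd, hPm.natDegree_pow]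
    rw [R_primary f P hP hPm r hr0 hdeg, sum_min (E := E) f P hP hPm ⟨r, by rw [← hV, ← hdeg, mul_comm]⟩]
    congr 1
    refine Finset.sum_congr rfl fun t _ => ?_
    refine if_congr ?_ rfl rfl
    constructor
    · intro h
      unfold Mt
      rw [h, ← hV, ← hdeg, Nat.mul_div_cancel _ hP.natDegree_pos]
    · intro h
      exact (Mt_eq_iff t P 1 hP hPm r hr0 hPd (by rw [h, mul_one])).1
  · rw [lemmaP (R_prim f _ V le_rfl) (P ^ r) d (IsCoprime.pow_left ((hP.coprime_iff_not_dvd).2 hPd)) ?_ (Nat.pos_of_ne_zero hdd), mul_zero]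
    · symm
      refine mul_eq_zero_of_right _ (Finset.sum_eq_zero fun t _ => if_neg fun h => ?_)
      exact hdd (Polynomial.natDegree_eq_zero_of_isUnit (Mt_eq_iff t P d hP hPm r hr0 hPd h).2)
    · rw [hPm.natDegree_pow]; exact Nat.mul_pos hr0 hP.natDegree_pos

theorem Mt_monic (t : E) : (Mt F t).Monic := (min_monic t).pow _
theorem Mt_natDegree (t : E) : (Mt F t).natDegree = Module.finrank F E := by
  unfold Mt
  rw [(min_monic t).natDegree_pow, Nat.div_mul_cancel (min_dvd t)]

theorem pairing [Fintype E] (f : K → ℂ) (hV : Module.finrank F V = Module.finrank F E) (η : Polynomial F → ℂ) :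
    ((Nat.card V : ℂ) - 1) * (∑ g : Module.End F V, R K f g * η g.charpoly) =
    (Nat.card (Module.End F V)ˣ : ℂ) * ∑ t : E, f (algebraMap E K t) * η (Mt F t) := by
  classical
  set S : Finset (Polynomial F) := (Finset.univ.image fun g : Module.End F V => g.charpoly) ∪ Finset.univ.image fun t : E => Mt F t with hS
  have e1 : (∑ g : Module.End F V, R K f g * η g.charpoly) = ∑ c ∈ S, η c * ∑ g : Module.End F V, if g.charpoly = c then R K f g else 0 := by
    simp only [Finset.mul_sum]
    rw [Finset.sum_comm]
    refine Finset.sum_congr rfl fun g _ => ?_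
    rw [Finset.sum_eq_single g.charpoly, if_pos rfl, mul_comm]
    · intro c _ hc; rw [if_neg (Ne.symm hc), mul_zero]
    · intro h; exact absurd (Finset.mem_union_left _ (Finset.mem_image_of_mem _ (Finset.mem_univ g))) h
  have e2 : (∑ t : E, f (algebraMap E K t) * η (Mt F t)) = ∑ c ∈ S, η c * ∑ t : E, if Mt F t = c then f (algebraMap E K t) else 0 := by
    simp only [Finset.mul_sum]
    rw [Finset.sum_comm]
    refine Finset.sum_congr rfl fun g _ => ?_
    rw [Finset.sum_eq_single (Mt F g), if_pos rfl, mul_comm]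
    · intro c _ hc; rw [if_neg (Ne.symm hc), mul_zero]
    · intro h; exact absurd (Finset.mem_union_right _ (Finset.mem_image_of_mem _ (Finset.mem_univ g))) h
  rw [e1, e2, Finset.mul_sum, Finset.mul_sum]
  refine Finset.sum_congr rfl fun c hc => ?_
  have h : c.Monic ∧ c.natDegree = Module.finrank F V := by
    rw [hS, Finset.mem_union, Finset.mem_image, Finset.mem_image] at hc
    rcases hc with ⟨g, _, rfl⟩ | ⟨t, _, rfl⟩
    · exact ⟨LinearMap.charpoly_monic g, LinearMap.charpoly_natDegree g⟩
    · exact ⟨Mt_monic t, by rw [Mt_natDegree, hV]⟩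
  have h2 := fib_eq (E := E) (V := V) f hV c h.1 h.2
  linear_combination (η c) * h2
end
end KL

namespace KL
section
variable {F : Type} [Field F] [Finite F] {E : Type} [Field E] [Finite E] [Algebra F E]
variable {V : Type} [AddCommGroup V] [Module F V] [Finite V]

open Classical in
theorem prim_fib {v : Module.End F V → ℂ} (hv : Prim v) (hV : Module.finrank F V = Module.finrank F E) (c : Polynomial F) (hc : c.Monic) (hcd : c.natDegree = Module.finrank F V) (hn : ∀ t : E, Mt F t ≠ c) :
    (∑ g : Module.End F V, if g.charpoly = c then v g else 0) = 0 := by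
  have hpos : 0 < Module.finrank F V := by rw [hV]; exact Module.finrank_pos
  have hnu : ¬ IsUnit c := fun h => by
    have := Polynomial.natDegree_eq_zero_of_isUnit h
    omega
  obtain ⟨P, hPm, hP, hPc⟩ := Polynomial.exists_monic_irreducible_factor c hnu
  have hfm := Polynomial.finiteMultiplicity_of_degree_pos_of_monic (Polynomial.natDegree_pos_iff_degree_pos.1 hP.natDegree_pos) hPm hc.ne_zero
  obtain ⟨d, hd, hPd⟩ := hfm.exists_eq_pow_mul_and_not_dvd
  set r := multiplicity P c with hr
  have hr0 : 0 < r := by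
    rw [Nat.pos_iff_ne_zero]
    intro h0
    rw [h0, pow_zero, one_mul] at hd
    exact hPd (hd ▸ hPc)
  have hdm : d.Monic := (hPm.pow r).of_mul_monic_left (by rw [← hd]; exact hc)
  by_cases hdd : d.natDegree = 0
  · exfalso
    have hd1 : d = 1 := hdm.natDegree_eq_zero.1 hdd
    subst hd1
    rw [mul_one] at hd
    have hdeg : r * P.natDegree = Module.finrank F V := by rw [← hcd, hd, hPm.natDegree_pow]
    have hsp := split_E (E := E) P hP ⟨r, by rw [← hV, ← hdeg, mul_comm]⟩
    have hdg : (P.map (algebraMap F E)).degree ≠ 0 := by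
      rw [Polynomial.degree_map]
      exact (Polynomial.degree_pos_of_irreducible hP).ne'
    obtain ⟨t, ht⟩ := hsp.exists_eval_eq_zero hdg
    have ht2 : Polynomial.aeval t P = 0 := by
      rw [Polynomial.aeval_def, ← Polynomial.eval_map]; exact ht
    have h := minpoly.eq_of_irreducible_of_monic hP ht2 hPm
    refine hn t ?_
    unfold Mt
    rw [← h, hd, ← hV, ← hdeg, Nat.mul_div_cancel _ hP.natDegree_pos]
  · rw [hd]
    exact lemmaP hv (P ^ r) d (IsCoprime.pow_left ((hP.coprime_iff_not_dvd).2 hPd))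
      (by rw [hPm.natDegree_pow]; exact Nat.mul_pos hr0 hP.natDegree_pos) (Nat.pos_of_ne_zero hdd)

theorem prim_pair {v : Module.End F V → ℂ} (hv : Prim v) (hV : Module.finrank F V = Module.finrank F E) (η : Polynomial F → ℂ)
    (hη : ∀ t : E, η (Mt F t) = 0) : ∑ g : Module.End F V, v g * η g.charpoly = 0 := by
  classical
  set S : Finset (Polynomial F) := (Finset.univ.image fun g : Module.End F V => g.charpoly) with hS
  have e1 : (∑ g : Module.End F V, v g * η g.charpoly) = ∑ c ∈ S, η c * ∑ g : Module.End F V, if g.charpoly = c then v g else 0 := by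
    simp only [Finset.mul_sum]
    rw [Finset.sum_comm]
    refine Finset.sum_congr rfl fun g _ => ?_
    rw [Finset.sum_eq_single g.charpoly, if_pos rfl, mul_comm]
    · intro c _ hc; rw [if_neg (Ne.symm hc), mul_zero]
    · intro h; exact absurd ((Finset.mem_image_of_mem _ (Finset.mem_univ g))) h
  rw [e1]
  refine Finset.sum_eq_zero fun c hc => ?_
  by_cases h : ∃ t : E, Mt F t = c
  · obtain ⟨t, rfl⟩ := h
    rw [hη, zero_mul]
  · push Not at h
    rw [hS, Finset.mem_image] at hc
    obtain ⟨g, _, rfl⟩ := hc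
    have := prim_fib (E := E) hv hV g.charpoly (LinearMap.charpoly_monic g) (LinearMap.charpoly_natDegree g) h
    rw [mul_eq_zero]; right
    convert this
end

section
variable {F : Type} [Field F] {K : Type} [Field K] [Algebra F K] (f : K → ℂ)
variable {V : Type} [AddCommGroup V] [Module F V] [Finite V]

theorem prim_bF {v : Module.End F V → ℂ} (hv : Prim v) (ε : Polynomial F → ℂ) :
    ∑ g : Module.End F V, v g * R K f g * ε g.charpoly = ∑ g : Module.End F V, v g * bF K f g * ε g.charpoly := by
  classical
  have e : ∀ g : Module.End F V, v g * R K f g * ε g.charpoly = v g * bF K f g * ε g.charpoly - ∑ W : Submodule F V, if W ≠ ⊥ ∧ W ≠ ⊤ then v g * Rr K f g W * ε g.charpoly else 0 := by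
    intro g
    rw [R_rec, mul_sub, sub_mul, Finset.mul_sum, Finset.sum_mul]
    congr 1
    refine Finset.sum_congr rfl fun W _ => ?_
    split_ifs
    · rfl
    · rw [mul_zero, zero_mul]
  rw [Finset.sum_congr rfl (fun g _ => e g), Finset.sum_sub_distrib, Finset.sum_comm, sub_eq_self]
  refine Finset.sum_eq_zero fun W _ => ?_
  by_cases hW : W ≠ ⊥ ∧ W ≠ ⊤
  swap
  · exact Finset.sum_eq_zero fun g _ => if_neg hW
  have := prim_sum hv W hW.1 hW.2 (fun g => Rr K f g W * ε g.charpoly) (fun g hg u => by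
    show Rr K f (g + u.1) W * ε (g + u.1).charpoly = _
    rw [claim1 f W g u W le_rfl, charpoly_HH W g hg u])
  rw [← this]
  refine Finset.sum_congr rfl fun g _ => ?_
  rw [if_pos hW]
  by_cases h : ∀ w ∈ W, g w ∈ W
  · rw [if_pos h]; ring
  · rw [if_neg h, Rr_of_not f g W h, mul_zero, zero_mul]
end
end KL

namespace KL
theorem roots_reverse {K : Type} [Field K] : ∀ (m : ℕ) (P : Polynomial K), P.natDegree ≤ m → P.coeff 0 ≠ 0 → P.reverse.roots = P.roots.map (fun x => x⁻¹) := by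
  intro m
  induction m with
  | zero =>
    intro P hP h0
    rw [Polynomial.eq_C_of_natDegree_eq_zero (Nat.le_zero.1 hP)]
    simp
  | succ m ih =>
    intro P hP h0
    have hPn : P ≠ 0 := fun h => h0 (by rw [h, Polynomial.coeff_zero])
    by_cases hr : ∃ r, P.IsRoot r
    · obtain ⟨r, hr⟩ := hr
      obtain ⟨Q, rfl⟩ := Polynomial.dvd_iff_isRoot.2 hr
      have hr0 : r ≠ 0 := by
        rintro rfl
        apply h0; simp
      have hQ0 : Q.coeff 0 ≠ 0 := by
        intro h; apply h0; rw [Polynomial.mul_coeff_zero, h, mul_zero]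
      have hQn : Q ≠ 0 := fun h => hQ0 (by rw [h, Polynomial.coeff_zero])
      have hd : Q.natDegree ≤ m := by
        rw [Polynomial.natDegree_mul (Polynomial.X_sub_C_ne_zero r) hQn, Polynomial.natDegree_X_sub_C] at hP
        omega
      have e : (Polynomial.X - Polynomial.C r).reverse = Polynomial.C (-r) * (Polynomial.X - Polynomial.C r⁻¹) := by
        have h1 : (Polynomial.X - Polynomial.C r) = Polynomial.X * 1 + Polynomial.C (-r) := by simp [sub_eq_add_neg]
        rw [Polynomial.reverse, Polynomial.natDegree_X_sub_C]
        ext i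
        rw [Polynomial.coeff_reflect]
        rcases i with _ | _ | i
        · simp [Polynomial.coeff_C, hr0, Polynomial.revAt_le]
        · simp [Polynomial.coeff_C, hr0, Polynomial.revAt_le, Polynomial.coeff_X]
        · rw [Polynomial.revAt_eq_self_of_lt (by omega)]
          simp [Polynomial.coeff_C, Polynomial.coeff_X, mul_sub]
      rw [Polynomial.reverse_mul_of_domain, e, Polynomial.roots_mul, Polynomial.roots_mul hPn, ih Q hd hQ0, Multiset.map_add,
        Polynomial.roots_C_mul _ (neg_ne_zero.2 hr0), Polynomial.roots_X_sub_C, Polynomial.roots_X_sub_C, Multiset.map_singleton]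
      refine mul_ne_zero (mul_ne_zero ?_ (Polynomial.X_sub_C_ne_zero _)) ?_
      · rw [Ne, Polynomial.C_eq_zero, neg_eq_zero]; exact hr0
      · rw [Ne, Polynomial.reverse_eq_zero]; exact hQn
    · push Not at hr
      have h1 : P.roots = 0 := Multiset.eq_zero_of_forall_notMem fun r h => hr r (Polynomial.isRoot_of_mem_roots h)
      rw [h1, Multiset.map_zero]
      refine Multiset.eq_zero_of_forall_notMem fun r h => ?_
      have h2 := Polynomial.isRoot_of_mem_roots h
      have hr0 : r ≠ 0 := by
        rintro rfl
        rw [Polynomial.IsRoot, ← Polynomial.coeff_zero_eq_eval_zero, Polynomial.coeff_zero_reverse] at h2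
        exact hPn (Polynomial.leadingCoeff_eq_zero.1 h2)
      apply hr r⁻¹
      letI : Invertible (r⁻¹) := invertibleOfNonzero (inv_ne_zero hr0)
      have h3 := Polynomial.eval₂_reverse_eq_zero_iff (RingHom.id K) r⁻¹ P
      rw [invOf_eq_inv, inv_inv] at h3
      exact h3.1 h2

theorem bF_inv {F : Type} [Field F] {K : Type} [Field K] [Algebra F K] (f : K → ℂ)
    {V : Type} [AddCommGroup V] [Module F V] [Finite V] (g : (Module.End F V)ˣ) :
    bF K f (g⁻¹).1 = bF K (fun x => f x⁻¹) g.1 := by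
  classical
  have hF := Module.Free.of_divisionRing F V
  set b := Module.finBasis F V
  set A := LinearMap.toMatrix b b g.1 with hA
  have h1 : A * LinearMap.toMatrix b b (g⁻¹).1 = 1 := by
    rw [hA, ← LinearMap.toMatrix_mul]; simp
  have hu : IsUnit A := IsUnit.of_mul_eq_one _ h1
  have h2 : LinearMap.toMatrix b b (g⁻¹).1 = A⁻¹ := (Matrix.inv_eq_right_inv h1).symm
  have h3 : (g⁻¹).1.charpoly = A⁻¹.charpoly := by rw [← h2, LinearMap.charpoly_toMatrix]
  have h4 : g.1.charpoly = A.charpoly := by rw [hA, LinearMap.charpoly_toMatrix]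
  have hd : IsUnit A.det := (Matrix.isUnit_iff_isUnit_det A).1 hu
  unfold bF
  have h5 : (A⁻¹.charpoly).aroots K = (A.charpoly.aroots K).map (fun x => x⁻¹) := by
    rw [Matrix.charpoly_inv A hu, ← Matrix.reverse_charpoly, ← Polynomial.C_1, ← Polynomial.C_neg, ← Polynomial.C_pow, ← Polynomial.C_mul, Polynomial.aroots_C_mul]
    · rw [Polynomial.aroots, Polynomial.aroots, ← roots_reverse _ _ le_rfl]
      · congr 1
        rw [Polynomial.reverse, Polynomial.reverse, Polynomial.reflect_map, Polynomial.natDegree_map]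
      · rw [Polynomial.coeff_map]
        intro h
        have h6 := (FaithfulSMul.algebraMap_injective F K) (h.trans (map_zero _).symm)
        have h7 := Matrix.det_eq_sign_charpoly_coeff A
        rw [h6, mul_zero] at h7
        rw [h7] at hd
        exact not_isUnit_zero hd
    · refine mul_ne_zero (pow_ne_zero _ (neg_ne_zero.2 one_ne_zero)) ?_
      rw [Ring.inverse_eq_inv]
      exact inv_ne_zero hd.ne_zero
  rw [h3, h4, h5, Multiset.map_map]
  rfl

section
variable {F : Type} [Field F] {K : Type} [Field K] [Algebra F K] (f : K → ℂ)

theorem R_inv : ∀ (m : ℕ) (V : Type) [AddCommGroup V] [Module F V] [Finite V] (g : (Module.End F V)ˣ), Module.finrank F V ≤ m →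
    R K f (g⁻¹).1 = R K (fun x => f x⁻¹) g.1 := by
  classical
  intro m
  induction m with
  | zero =>
    intro V _ _ _ g h
    rw [R_zero f _ (Nat.le_zero.1 h), R_zero _ _ (Nat.le_zero.1 h)]
  | succ m ih =>
    intro V _ _ _ g h
    rw [R_rec, R_rec, bF_inv]
    congr 1
    refine Finset.sum_congr rfl fun W _ => ?_
    split_ifs with hW
    swap
    · rfl
    have hfin : Module.finrank F W < Module.finrank F V := Submodule.finrank_lt hW.2
    by_cases hs : ∀ w ∈ W, g.1 w ∈ W
    · have hs2 : ∀ w ∈ W, (g⁻¹).1 w ∈ W := stab_inv W g hs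
      rw [Rr_of _ _ _ hs, Rr_of _ _ _ hs2]
      exact ih W ⟨g.1.restrict hs, (g⁻¹).1.restrict hs2,
        LinearMap.ext fun w => Subtype.ext (LinearMap.congr_fun g.mul_inv (w : V)),
        LinearMap.ext fun w => Subtype.ext (LinearMap.congr_fun g.inv_mul (w : V))⟩ (by omega)
    · rw [Rr_of_not _ _ _ hs, Rr_of_not]
      intro hs2
      apply hs
      have := stab_inv W g⁻¹ hs2
      rwa [inv_inv] at this
end
end KL

namespace KL
section
variable {F : Type} [Field F] [Fintype F] [DecidableEq F] (ψ : AddChar F ℂ)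

noncomputable def SW (ι : Type) [Fintype ι] [DecidableEq ι] : ℂ := ∑ M : Matrix ι ι F, if M.det ≠ 0 then ψ M.trace else 0

theorem SW_equiv {ι κ : Type} [Fintype ι] [DecidableEq ι] [Fintype κ] [DecidableEq κ] (e : ι ≃ κ) : SW ψ ι = SW ψ κ := by
  unfold SW
  refine Fintype.sum_equiv (Matrix.reindex e e) _ _ fun M => ?_
  have ht : ((Matrix.reindex e e) M).trace = M.trace := by
    unfold Matrix.trace
    exact Fintype.sum_equiv e.symm _ _ fun i => rfl
  rw [Matrix.det_reindex_self, ht]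

def blk {l m : Type} : (Matrix l m F) × (Matrix m m F × Matrix m l F × Matrix l l F) ≃ Matrix (m ⊕ l) (m ⊕ l) F where
  toFun x := Matrix.fromBlocks x.2.1 x.2.2.1 x.1 x.2.2.2
  invFun M := (M.toBlocks₂₁, M.toBlocks₁₁, M.toBlocks₁₂, M.toBlocks₂₂)
  left_inv x := by simp
  right_inv M := Matrix.fromBlocks_toBlocks M

theorem tr_blk {l m : Type} [Fintype l] [Fintype m] (A : Matrix m m F) (B : Matrix m l F) (C : Matrix l m F) (D : Matrix l l F) :
    (Matrix.fromBlocks A B C D).trace = A.trace + D.trace := by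
  unfold Matrix.trace
  rw [Fintype.sum_sum_type]
  rfl

theorem SW_step {l m : Type} [Fintype l] [DecidableEq l] [Fintype m] [DecidableEq m] (hψ : ∃ a, ψ a ≠ 1) :
    SW ψ (m ⊕ l) = (Fintype.card F : ℂ) ^ (Fintype.card m * Fintype.card l) * SW ψ m * SW ψ l := by
  have e0 : SW ψ (m ⊕ l) = ∑ C : Matrix l m F, ∑ y : Matrix m m F × Matrix m l F × Matrix l l F,
      if (Matrix.fromBlocks y.1 y.2.1 C y.2.2).det ≠ 0 then ψ (Matrix.fromBlocks y.1 y.2.1 C y.2.2).trace else 0 := by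
    rw [← Fintype.sum_prod_type']
    unfold SW
    exact (Fintype.sum_equiv blk _ _ fun x => rfl).symm
  rw [e0, Finset.sum_eq_single 0]
  · rw [Fintype.sum_prod_type]
    have : ∀ A : Matrix m m F, (∑ z : Matrix m l F × Matrix l l F, if (Matrix.fromBlocks A z.1 0 z.2).det ≠ 0 then ψ (Matrix.fromBlocks A z.1 0 z.2).trace else 0)
      = (if A.det ≠ 0 then ψ A.trace else 0) * ((Fintype.card F : ℂ) ^ (Fintype.card m * Fintype.card l) * SW ψ l) := by
      intro A
      rw [Fintype.sum_prod_type]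
      simp only [Matrix.det_fromBlocks_zero₂₁, tr_blk, AddChar.map_add_eq_mul]
      rw [Finset.sum_const, Finset.card_univ, nsmul_eq_mul]
      have h1 : (Fintype.card (Matrix m l F) : ℂ) = (Fintype.card F : ℂ) ^ (Fintype.card m * Fintype.card l) := by
        rw [Fintype.card_congr (Matrix.of.symm : Matrix m l F ≃ (m → l → F)), Fintype.card_fun, Fintype.card_fun, mul_comm (Fintype.card m), pow_mul]
        push_cast
        rfl
      rw [h1, ← mul_assoc, mul_comm (ite _ _ _), mul_assoc]
      congr 1
      unfold SW
      rw [Finset.mul_sum]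
      refine Finset.sum_congr rfl fun D _ => ?_
      by_cases hA : A.det = 0 <;> by_cases hD : D.det = 0 <;> simp [hA, hD]
    rw [Finset.sum_congr rfl (fun A _ => this A), ← Finset.sum_mul]
    unfold SW
    ring
  · intro C _ hC
    obtain ⟨c, hc⟩ := hψ
    obtain ⟨i, j, hij⟩ : ∃ i j, C i j ≠ 0 := by
      by_contra h; push Not at h
      exact hC (Matrix.ext h)
    set lam : Matrix m l F := Matrix.single j i ((C i j)⁻¹ * c) with hl
    have ht : (C * lam).trace = c := by
      rw [hl, Matrix.trace_mul_single]
      simp [hij]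
    set e : (Matrix m m F × Matrix m l F × Matrix l l F) ≃ (Matrix m m F × Matrix m l F × Matrix l l F) :=
      { toFun := fun y => (y.1, y.1 * lam + y.2.1, C * lam + y.2.2)
        invFun := fun y => (y.1, y.2.1 - y.1 * lam, y.2.2 - C * lam)
        left_inv := fun y => by simp
        right_inv := fun y => by simp } with he
    set Z := ∑ y : Matrix m m F × Matrix m l F × Matrix l l F,
      if (Matrix.fromBlocks y.1 y.2.1 C y.2.2).det ≠ 0 then ψ (Matrix.fromBlocks y.1 y.2.1 C y.2.2).trace else 0 with hZ
    have h1 : Z = ψ c * Z := by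
      rw [hZ, Finset.mul_sum, ← Equiv.sum_comp e]
      refine Finset.sum_congr rfl fun y _ => ?_
      have h2 : Matrix.fromBlocks (e y).1 (e y).2.1 C (e y).2.2 = Matrix.fromBlocks y.1 y.2.1 C y.2.2 * Matrix.fromBlocks 1 lam 0 1 := by
        rw [Matrix.fromBlocks_multiply]
        simp [he]
      have h3 : (Matrix.fromBlocks (e y).1 (e y).2.1 C (e y).2.2).det = (Matrix.fromBlocks y.1 y.2.1 C y.2.2).det := by
        rw [h2, Matrix.det_mul, Matrix.det_fromBlocks_zero₂₁]
        simp
      have h4 : (Matrix.fromBlocks (e y).1 (e y).2.1 C (e y).2.2).trace = c + (Matrix.fromBlocks y.1 y.2.1 C y.2.2).trace := by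
        rw [tr_blk, tr_blk]
        show y.1.trace + (C * lam + y.2.2).trace = _
        rw [Matrix.trace_add, ht]; ring
      rw [h3, h4, AddChar.map_add_eq_mul, mul_ite, mul_zero]
    have h2 : (ψ c - 1) * Z = 0 := by linear_combination -h1
    rcases mul_eq_zero.1 h2 with h | h
    · exact absurd (sub_eq_zero.1 h) hc
    · exact h
  · intro h; exact absurd (Finset.mem_univ _) h

theorem psi_sum (hψ : ∃ a, ψ a ≠ 1) : ∑ a : F, ψ a = 0 := by
  refine AddChar.sum_eq_zero_of_ne_one ?_
  rintro rfl
  obtain ⟨a, ha⟩ := hψ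
  exact ha (AddChar.one_apply a)

theorem SW_val (hψ : ∃ a, ψ a ≠ 1) (n : ℕ) : ∀ (ι : Type) [Fintype ι] [DecidableEq ι], Fintype.card ι = n →
    SW ψ ι = (-1) ^ n * (Fintype.card F : ℂ) ^ (n * (n - 1) / 2) := by
  induction n with
  | zero =>
    intro ι _ _ h
    haveI := Fintype.card_eq_zero_iff.1 h
    unfold SW
    haveI : Subsingleton (Matrix ι ι F) := ⟨fun A B => Matrix.ext fun i => isEmptyElim i⟩
    rw [Fintype.sum_subsingleton _ (0 : Matrix ι ι F)]
    simp
  | succ n ih =>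
    intro ι _ _ h
    have e : ι ≃ (Unit ⊕ Fin n) := Fintype.equivOfCardEq (by rw [h]; simp [add_comm])
    rw [SW_equiv ψ e, SW_step ψ hψ, ih (Fin n) (Fintype.card_fin n)]
    have h1 : SW ψ Unit = -1 := by
      unfold SW
      have h2 : ∀ M : Matrix Unit Unit F, (if M.det ≠ 0 then ψ M.trace else 0) = ψ (M () ()) - if M () () = 0 then 1 else 0 := by
        intro M
        rw [Matrix.det_unique, show M.trace = M () () by simp [Matrix.trace]]
        by_cases hM : M () () = 0
        · simp [hM]
        · simp [hM]
      rw [Finset.sum_congr rfl (fun M _ => h2 M)]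
      refine (Fintype.sum_equiv (Matrix.uniqueEquiv : Matrix Unit Unit F ≃ F) (fun M : Matrix Unit Unit F => ψ (M () ()) - if M () () = 0 then 1 else 0) (fun a : F => ψ a - if a = 0 then 1 else 0) (fun M => rfl)).trans ?_
      rw [Finset.sum_sub_distrib, psi_sum ψ hψ]
      simp
    rw [h1]
    have h3 : (n + 1) * (n + 1 - 1) / 2 = n + n * (n - 1) / 2 := by
      rw [Nat.add_sub_cancel]
      rcases n with _ | n
      · rfl
      · rw [Nat.add_sub_cancel, show (n + 1 + 1) * (n + 1) = (n + 1) * n + (n + 1) * 2 by ring, Nat.add_mul_div_right _ _ (by norm_num)]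
        ring
    rw [h3, pow_add, pow_succ]
    simp
    ring
end
end KL

namespace KL

theorem vander {r : ℕ} (w y : Fin r → ℂ) (h : ∀ k : ℕ, ∑ i, w i ^ k * y i = 0) (z : ℂ) : (∑ i, if w i = z then y i else 0) = 0 := by
  classical
  have h1 : ∀ P : Polynomial ℂ, ∑ i, P.eval (w i) * y i = 0 := by
    intro P
    simp only [Polynomial.eval_eq_sum_range, Finset.sum_mul]
    rw [Finset.sum_comm]
    refine Finset.sum_eq_zero fun k _ => ?_
    simp only [mul_assoc, ← Finset.mul_sum]
    rw [h k, mul_zero]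
  set S := (Finset.univ.image w).erase z with hS
  set P : Polynomial ℂ := ∏ s ∈ S, (Polynomial.X - Polynomial.C s) with hP
  have h2 := h1 P
  have h3 : P.eval z ≠ 0 := by
    rw [hP, Polynomial.eval_prod, Finset.prod_ne_zero_iff]
    intro s hs
    rw [Polynomial.eval_sub, Polynomial.eval_X, Polynomial.eval_C, sub_ne_zero]
    exact (Finset.ne_of_mem_erase hs).symm
  have h4 : ∀ i, P.eval (w i) * y i = P.eval z * (if w i = z then y i else 0) := by
    intro i
    by_cases hi : w i = z
    · rw [if_pos hi, hi]
    · rw [if_neg hi, mul_zero, hP, Polynomial.eval_prod, Finset.prod_eq_zero (i := w i), zero_mul]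
      · rw [hS, Finset.mem_erase]; exact ⟨hi, Finset.mem_image_of_mem _ (Finset.mem_univ i)⟩
      · simp
  rw [Finset.sum_congr rfl (fun i _ => h4 i), ← Finset.mul_sum] at h2
  exact (mul_eq_zero.1 h2).resolve_left h3

theorem contra_virt {G : Type} [Group G] [Finite G] {R : Subring ℂ} {f : G → ℂ} (hf : Virt R f) {ι : Type} [Fintype ι] [DecidableEq ι]
    (ρ : G →* Matrix ι ι ℂ) : BB f (fun g => (ρ g⁻¹).trace) ∈ R := by
  have := hf ι ({ toFun := fun g => (ρ g⁻¹).transpose, map_mul' := fun a b => by rw [mul_inv_rev, map_mul, Matrix.transpose_mul] } : G →ₙ* Matrix ι ι ℂ)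
  have h2 : (fun g => (ρ g⁻¹).trace) = fun g => (ρ g⁻¹).transpose.trace := funext fun g => (Matrix.trace_transpose _).symm
  rw [h2]
  exact this

theorem eigen {G : Type} [Group G] [Fintype G] (φ : G → ℂ) (hφ : IsClass φ) (u : ℕ → G → ℂ) (hu : ∀ k x, u (k+1) x = ∑ h, φ (x * h⁻¹) * u k h)
    (hc : IsClass (u 0)) (hv : Virt ZZ (u 0)) (m : ℕ) (hm : 0 < m) (η : G → ℂ) (hη : Virt OO η)
    (h1 : ∀ k, ∑ g, u k g * u 0 g⁻¹ = m * ∑ g, u k g * η g) (h2 : ∑ g, u 0 g * u 0 g⁻¹ = m * Fintype.card G) :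
    ∃ w : ℂ, ∀ k x, u k x = w ^ k * u 0 x := by
  classical
  obtain ⟨r, d, ρ, hρ1, hρ2⟩ := wedderburn G
  choose w hw using hρ2 φ hφ
  set χ : Fin r → G → ℂ := fun i g => (ρ i g).trace with hχ
  have ha : ∀ i, ∃ a : ℤ, BB (u 0) (χ i) = a := fun i => (mem_ZZ _).1 (hv _ ((ρ i).toMulHom))
  choose a ha using ha
  have hconv : ∀ i x, ∑ h, φ (x * h⁻¹) * χ i h = w i * χ i x := by
    intro i x
    have e1 : ∑ h, φ (x * h⁻¹) * χ i h = ∑ y, φ y * χ i (y⁻¹ * x) := by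
      refine Fintype.sum_equiv ((Equiv.inv G).trans (Equiv.mulLeft x)) _ _ fun h => ?_
      show φ (x * h⁻¹) * χ i h = φ (x * h⁻¹) * χ i ((x * h⁻¹)⁻¹ * x)
      congr 2; group
    have e2 : (∑ y, φ y • ρ i y⁻¹) * ρ i x = ∑ y, φ y • ρ i (y⁻¹ * x) := by
      rw [Finset.sum_mul]
      refine Finset.sum_congr rfl fun y _ => ?_
      rw [Matrix.smul_mul, map_mul]
    rw [hw i, Matrix.smul_mul, one_mul] at e2
    have e3 := congrArg Matrix.trace e2
    rw [Matrix.trace_smul, Matrix.trace_sum] at e3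
    rw [e1]
    simp only [Matrix.trace_smul, smul_eq_mul] at e3
    exact e3.symm
  have hk : ∀ k x, u k x = ∑ i, (a i : ℂ) * w i ^ k * χ i x := by
    intro k
    induction k with
    | zero =>
      intro x
      rw [hρ1 _ hc x]
      refine Finset.sum_congr rfl fun i _ => ?_
      rw [pow_zero, mul_one, ← ha i]
    | succ k ih =>
      intro x
      rw [hu]
      simp only [ih, Finset.mul_sum]
      rw [Finset.sum_comm]
      refine Finset.sum_congr rfl fun i _ => ?_
      have := hconv i x
      calc ∑ h, φ (x * h⁻¹) * (↑(a i) * w i ^ k * χ i h) = ∑ h, (a i * w i ^ k) * (φ (x * h⁻¹) * χ i h) := Finset.sum_congr rfl fun _ _ => by ring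
        _ = _ := by rw [← Finset.mul_sum, this]; ring
  have hG : (Fintype.card G : ℂ) ≠ 0 := Nat.cast_ne_zero.2 Fintype.card_ne_zero
  set c : Fin r → ℂ := fun i => BB η (fun g => χ i g⁻¹) with hcdef
  have hcO : ∀ i, c i ∈ OO := fun i => contra_virt hη (ρ i)
  have s1 : ∀ k, ∑ g, u k g * u 0 g⁻¹ = Fintype.card G * ∑ i, w i ^ k * ((a i : ℂ) * a i) := by
    intro k
    simp only [hk k, Finset.sum_mul]
    rw [Finset.sum_comm, Finset.mul_sum]
    refine Finset.sum_congr rfl fun i _ => ?_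
    have e : BB (χ i) (u 0) = a i := by rw [BB_comm, ha i]
    rw [BB_eq] at e
    have e2 : ∑ g, χ i g * u 0 g⁻¹ = Fintype.card G * a i := by rw [← e, mul_inv_cancel_left₀ hG]
    simp only [mul_assoc, ← Finset.mul_sum]
    rw [e2]; ring
  have s2 : ∀ k, ∑ g, u k g * η g = Fintype.card G * ∑ i, w i ^ k * ((a i : ℂ) * c i) := by
    intro k
    simp only [hk k, Finset.sum_mul]
    rw [Finset.sum_comm, Finset.mul_sum]
    refine Finset.sum_congr rfl fun i _ => ?_
    have e : c i = c i := rfl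
    nth_rewrite 1 [hcdef] at e
    simp only [BB_eq, inv_inv] at e
    have e2 : ∑ g, χ i g * η g = Fintype.card G * c i := by
      rw [← e, mul_inv_cancel_left₀ hG]
      exact Finset.sum_congr rfl fun g _ => mul_comm _ _
    simp only [mul_assoc, ← Finset.mul_sum]
    rw [e2]; ring
  have s3 : ∀ k : ℕ, ∑ i, w i ^ k * ((a i : ℂ) * a i - m * (a i * c i)) = 0 := by
    intro k
    have := h1 k
    rw [s1, s2, mul_left_comm] at this
    have := mul_left_cancel₀ hG this
    simp only [mul_sub, Finset.sum_sub_distrib]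
    rw [this, Finset.mul_sum, sub_eq_zero]
    exact Finset.sum_congr rfl fun i _ => by ring
  have s4 : ∑ i, a i * a i = (m : ℤ) := by
    have := h2
    rw [s1 0, mul_comm] at this
    have := mul_right_cancel₀ hG this
    simp only [pow_zero, one_mul] at this
    exact_mod_cast this
  obtain ⟨i0, hi0⟩ : ∃ i, a i ≠ 0 := by
    by_contra h; push Not at h
    simp only [h, mul_zero, Finset.sum_const_zero] at s4
    omega
  have s5 := vander w _ s3 (w i0)
  set X : ℤ := ∑ i, if w i = w i0 then a i * a i else 0 with hX
  have s6 : (X : ℂ) = m * ∑ i, if w i = w i0 then (a i : ℂ) * c i else 0 := by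
    rw [hX, Finset.mul_sum, ← sub_eq_zero]
    push_cast
    rw [← Finset.sum_sub_distrib]
    refine Eq.trans ?_ s5
    refine Finset.sum_congr rfl fun i _ => ?_
    split_ifs <;> ring
  have hmC : (m : ℂ) ≠ 0 := Nat.cast_ne_zero.2 hm.ne'
  have hmemOO : (∑ i, if w i = w i0 then (a i : ℂ) * c i else 0) ∈ OO := by
    refine Subring.sum_mem _ fun i _ => ?_
    split_ifs
    · exact Subring.mul_mem _ (intCast_mem _ _) (hcO i)
    · exact Subring.zero_mem _
  obtain ⟨k, hk2⟩ := rat_integral ((X : ℚ) / m) (by push_cast; rw [s6, mul_div_cancel_left₀ _ hmC]) (mem_OO.1 hmemOO)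
  have s7 : X = m * k := by
    rw [hk2] at s6; exact_mod_cast s6
  have hXpos : 0 < X := by
    refine Finset.sum_pos' (fun i _ => ?_) ⟨i0, Finset.mem_univ _, ?_⟩
    · split_ifs
      · exact mul_self_nonneg _
      · exact le_rfl
    · rw [if_pos rfl]; exact mul_self_pos.2 hi0
  have hk1 : 1 ≤ k := by
    by_contra h; push Not at h
    nlinarith
  have hXm : (m : ℤ) ≤ X := by nlinarith
  have s8 : ∑ i, (if w i = w i0 then 0 else a i * a i) = m - X := by
    rw [← s4, hX, ← Finset.sum_sub_distrib]
    refine Finset.sum_congr rfl fun i _ => ?_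
    split_ifs <;> ring
  have s9 : ∀ i, w i ≠ w i0 → a i = 0 := by
    intro i hi
    have h0 : ∀ i ∈ Finset.univ, 0 ≤ (if w i = w i0 then 0 else a i * a i) := fun i _ => by
      split_ifs
      · exact le_rfl
      · exact mul_self_nonneg _
    have h3 : ∑ i, (if w i = w i0 then 0 else a i * a i) = 0 := le_antisymm (by rw [s8]; omega) (Finset.sum_nonneg h0)
    have h4 := (Finset.sum_eq_zero_iff_of_nonneg h0).1 h3 i (Finset.mem_univ _)
    rw [if_neg hi] at h4
    exact mul_self_eq_zero.1 h4
  refine ⟨w i0, fun k x => ?_⟩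
  rw [hk k, hk 0, Finset.mul_sum]
  refine Finset.sum_congr rfl fun i _ => ?_
  by_cases hi : w i = w i0
  · rw [hi]; ring
  · rw [s9 i hi]; simp
end KL

namespace KL
theorem orbit_decomp {A X : Type} [AddCommGroup A] [Fintype A] [AddAction A X] [Fintype X] (f : X → ℂ) :
    ∑ x, f x = ∑ᶠ ω : Quotient (AddAction.orbitRel A X), (Nat.card (AddAction.stabilizer A ω.out) : ℂ)⁻¹ * ∑ a : A, f (a +ᵥ ω.out) := by
  classical
  haveI : Fintype (Quotient (AddAction.orbitRel A X)) := Fintype.ofFinite _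
  rw [finsum_eq_sum_of_fintype, ← Finset.sum_fiberwise (s := Finset.univ) (g := fun x => (Quotient.mk (AddAction.orbitRel A X) x)) (f := f)]
  refine Finset.sum_congr rfl fun ω _ => ?_
  have hmem : ∀ a : A, Quotient.mk (AddAction.orbitRel A X) (a +ᵥ ω.out) = ω := by
    intro a
    conv_rhs => rw [← Quotient.out_eq ω]
    exact Quotient.sound (AddAction.orbitRel_apply.2 ⟨a, rfl⟩)
  have hs : (Nat.card (AddAction.stabilizer A ω.out) : ℂ) ≠ 0 := by
    rw [Nat.card_eq_fintype_card]
    exact Nat.cast_ne_zero.2 Fintype.card_ne_zero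
  rw [eq_inv_mul_iff_mul_eq₀ hs]
  rw [← Finset.sum_fiberwise_of_maps_to (s := (Finset.univ : Finset A)) (t := Finset.univ.filter fun x => (Quotient.mk (AddAction.orbitRel A X) x) = ω) (g := fun a => a +ᵥ ω.out)
    (fun a _ => by rw [Finset.mem_filter]; exact ⟨Finset.mem_univ _, hmem a⟩), Finset.mul_sum]
  refine Finset.sum_congr rfl fun x hx => ?_
  rw [Finset.mem_filter] at hx
  have h1 : ∃ b : A, b +ᵥ ω.out = x := by
    have h2 : Quotient.mk (AddAction.orbitRel A X) x = Quotient.mk _ ω.out := by rw [hx.2, Quotient.out_eq]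
    exact AddAction.orbitRel_apply.1 (Quotient.exact h2)
  obtain ⟨b, hb⟩ := h1
  have h3 : ∑ a ∈ Finset.univ.filter (fun a : A => a +ᵥ ω.out = x), f (a +ᵥ ω.out) = ∑ a ∈ Finset.univ.filter (fun a : A => a +ᵥ ω.out = x), f x := by
    refine Finset.sum_congr rfl fun a ha => ?_
    rw [Finset.mem_filter] at ha
    rw [ha.2]
  rw [h3, Finset.sum_const, nsmul_eq_mul]
  congr 2
  rw [Nat.card_eq_fintype_card, ← Fintype.card_subtype]
  refine Fintype.card_congr ⟨fun a => ⟨b + a.1, ?_⟩, fun a => ⟨-b + a.1, ?_⟩, fun a => ?_, fun a => ?_⟩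
  · rw [add_vadd, AddAction.mem_stabilizer_iff.1 a.2, hb]
  · rw [AddAction.mem_stabilizer_iff, add_vadd, a.2, ← hb, neg_vadd_vadd]
  · exact Subtype.ext (by simp)
  · exact Subtype.ext (by simp)

theorem stab_card {n : ℕ} [NeZero n] (S : AddSubgroup (ZMod n)) (i : ZMod n) : i ∈ S ↔ Nat.card S • i = 0 := by
  classical
  constructor
  · intro h
    have := card_nsmul_eq_zero' (G := S) (x := ⟨i, h⟩)
    exact congrArg Subtype.val this
  · intro h
    have h1 := IsAddCyclic.card_nsmul_eq_zero_le (α := ZMod n) (n := Nat.card S) Nat.card_pos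
    have h2 : (Finset.univ.filter fun i : ZMod n => i ∈ S) ⊆ Finset.univ.filter fun i : ZMod n => Nat.card S • i = 0 := by
      intro j hj
      rw [Finset.mem_filter] at hj ⊢
      refine ⟨Finset.mem_univ _, ?_⟩
      have := card_nsmul_eq_zero' (G := S) (x := ⟨j, hj.2⟩)
      exact congrArg Subtype.val this
    have h3 : (Finset.univ.filter fun i : ZMod n => i ∈ S).card = Nat.card S := by
      rw [Nat.card_eq_fintype_card, Fintype.card_subtype]
    have h4 := Finset.eq_of_subset_of_card_le h2 (by rw [h3]; exact h1)
    have h5 : i ∈ Finset.univ.filter fun i : ZMod n => i ∈ S := by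
      rw [h4, Finset.mem_filter]; exact ⟨Finset.mem_univ _, h⟩
    exact (Finset.mem_filter.1 h5).2

theorem Hs_img {n : ℕ} [NeZero n] (s d : ℕ) (h : n = s * d) :
    Set.BijOn (fun j : ℕ => ((d * j : ℕ) : ZMod n)) (Finset.range s) (Finset.univ.filter fun i : ZMod n => s • i = 0) ∧ ∀ j ∈ Finset.range s, ((d * j : ℕ) : ZMod n).val = d * j := by
  classical
  have hn : 0 < n := Nat.pos_of_ne_zero (NeZero.ne n)
  have hd : 0 < d := Nat.pos_of_ne_zero fun h0 => by rw [h0, mul_zero] at h; omega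
  have hs : 0 < s := Nat.pos_of_ne_zero fun h0 => by rw [h0, zero_mul] at h; omega
  have hv : ∀ j ∈ Finset.range s, ((d * j : ℕ) : ZMod n).val = d * j := by
    intro j hj
    rw [Finset.mem_range] at hj
    refine ZMod.val_cast_of_lt ?_
    rw [h, mul_comm]; exact Nat.mul_lt_mul_of_pos_right hj hd
  have hinj : Set.InjOn (fun j : ℕ => ((d * j : ℕ) : ZMod n)) (Finset.range s) := by
    intro i hi j hj hij
    have := congrArg ZMod.val hij
    simp only at this
    rw [hv i hi, hv j hj] at this
    exact Nat.eq_of_mul_eq_mul_left hd this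
  have hmaps : (Finset.range s).image (fun j : ℕ => ((d * j : ℕ) : ZMod n)) ⊆ Finset.univ.filter fun i : ZMod n => s • i = 0 := by
    intro x hx
    obtain ⟨j, hj, rfl⟩ := Finset.mem_image.1 hx
    rw [Finset.mem_filter]
    refine ⟨Finset.mem_univ _, ?_⟩
    rw [nsmul_eq_mul, ← Nat.cast_mul, ← mul_assoc, ← h]
    simp
  have heq := Finset.eq_of_subset_of_card_le hmaps (by
    rw [Finset.card_image_of_injOn hinj, Finset.card_range]
    exact IsAddCyclic.card_nsmul_eq_zero_le hs)
  refine ⟨⟨fun j hj => ?_, hinj, ?_⟩, hv⟩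
  · exact hmaps (Finset.mem_image_of_mem _ hj)
  · intro x hx
    rw [Finset.mem_coe, ← heq, Finset.mem_image] at hx
    exact hx

section
variable {n q M : ℕ} [NeZero n] (hM : M + 1 = q ^ n)

def eJ (q : ℕ) (J : Finset (ZMod n)) : ℕ := ∑ j ∈ J, q ^ j.val

theorem pw_add (hM : M + 1 = q ^ n) (i j : ZMod n) : q ^ (i + j).val ≡ q ^ i.val * q ^ j.val [MOD M] := by
  have h1 : q ^ n ≡ 1 [MOD M] := by rw [← hM]; simp [Nat.ModEq]
  rw [ZMod.val_add, ← pow_add]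
  conv_rhs => rw [← Nat.div_add_mod (i.val + j.val) n, pow_add, pow_mul]
  have h2 := ((h1.pow ((i.val + j.val) / n)).mul_right (q ^ ((i.val + j.val) % n)))
  rw [one_pow, one_mul] at h2
  exact h2.symm

open scoped Pointwise

theorem eJ_vadd (hM : M + 1 = q ^ n) (i : ZMod n) (J : Finset (ZMod n)) : eJ q (i +ᵥ J) ≡ eJ q J * q ^ i.val [MOD M] := by
  unfold eJ
  rw [← Finset.image_vadd, Finset.sum_image (fun a _ b _ h => by simpa using h), Finset.sum_mul]
  refine Nat.ModEq.sum fun j _ => ?_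
  rw [vadd_eq_add, mul_comm]
  exact pw_add hM i j

theorem eH (hM : M + 1 = q ^ n) (s d : ℕ) (h : n = s * d) : (eJ q (Finset.univ.filter fun i : ZMod n => s • i = 0)) * (q ^ d - 1) = M := by
  obtain ⟨h1, h2⟩ := Hs_img s d h
  have h3 : (Finset.univ.filter fun i : ZMod n => s • i = 0) = (Finset.range s).image (fun j : ℕ => ((d * j : ℕ) : ZMod n)) := by
    rw [← Finset.coe_inj, Finset.coe_image, h1.image_eq]
  rw [h3, eJ, Finset.sum_image h1.injOn, Finset.sum_congr rfl (fun j hj => by rw [h2 j hj, pow_mul])]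
  have h4 : (∑ j ∈ Finset.range s, (q ^ d) ^ j) * (q ^ d - 1) = (q ^ d) ^ s - 1 := by
    have hq0 : q ≠ 0 := by
      rintro rfl
      rw [zero_pow (NeZero.ne n)] at hM
      omega
    obtain ⟨x, hx⟩ := Nat.exists_eq_succ_of_ne_zero (pow_ne_zero d hq0)
    rw [hx, Nat.succ_eq_add_one, ← geom_sum_mul_add, Nat.add_sub_cancel, Nat.add_sub_cancel]
  rw [h4, ← pow_mul, mul_comm d s, ← h, ← hM, Nat.add_sub_cancel]

theorem chi_mod {T : Type} (χ : T → ℂ) (hχ : ∀ t, χ t ^ M = 1) {a b : ℕ} (h : a ≡ b [MOD M]) (t : T) : χ t ^ a = χ t ^ b := by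
  rw [← Nat.div_add_mod a M, ← Nat.div_add_mod b M, pow_add, pow_add, pow_mul, pow_mul, hχ, one_pow, one_pow, h]

theorem target_abs (hM : M + 1 = q ^ n) (hq : 2 ≤ q) {T : Type} (χ : T → ℂ) (hχ : ∀ t, χ t ^ M = 1) (U : (T → ℂ) → Prop)
    (hsub : ∀ u v, U u → U v → U (fun t => u t - v t)) (hsum : ∀ (κ : Type) (S : Finset κ) (u : κ → T → ℂ), (∀ i ∈ S, U (u i)) → U (fun t => ∑ i ∈ S, u i t))
    (he : ∀ s b, U (fun t => ∑ J ∈ (Finset.univ : Finset (ZMod n)).powersetCard s, χ t ^ (b * eJ q J))) :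
    ∀ s d, n = s * d → ∀ a, a * q ^ d ≡ a [MOD M] → ∃ u, U u ∧ ∀ t, s * u t = ∑ i : ZMod n, χ t ^ (a * q ^ i.val) := by
  classical
  intro s
  induction s using Nat.strong_induction_on with
  | _ s ih =>
  intro d hsd a ha
  have hn : 0 < n := Nat.pos_of_ne_zero (NeZero.ne n)
  have hd : 0 < d := Nat.pos_of_ne_zero fun h0 => by rw [h0, mul_zero] at hsd; omega
  have hs : 0 < s := Nat.pos_of_ne_zero fun h0 => by rw [h0, zero_mul] at hsd; omega
  set H := Finset.univ.filter fun i : ZMod n => s • i = 0 with hH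
  have hHc : H.card = s := by
    obtain ⟨h1, _⟩ := Hs_img (n := n) s d hsd
    have h3 : H = (Finset.range s).image (fun j : ℕ => ((d * j : ℕ) : ZMod n)) := by
      rw [← Finset.coe_inj, Finset.coe_image, h1.image_eq]
    rw [h3, Finset.card_image_of_injOn h1.injOn, Finset.card_range]
  have hqd : 1 < q ^ d := Nat.one_lt_pow hd.ne' (by omega)
  obtain ⟨b, hb⟩ : ∃ b, a = eJ q H * b := by
    have h1 : M ∣ a * (q ^ d - 1) := by
      rw [Nat.mul_sub, mul_one]
      exact (Nat.modEq_iff_dvd' (Nat.le_mul_of_pos_right a (by omega))).1 ha.symm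
    rw [← eH hM s d hsd] at h1
    exact Nat.dvd_of_mul_dvd_mul_right (by omega) h1
  set f : T → Finset (ZMod n) → ℂ := fun t J => if J.card = s then χ t ^ (b * eJ q J) else 0 with hf
  have hf1 : ∀ t, ∑ J ∈ (Finset.univ : Finset (ZMod n)).powersetCard s, χ t ^ (b * eJ q J) = ∑ J, f t J := by
    intro t
    rw [hf, ← Finset.sum_filter]
    congr 1
    ext J
    rw [Finset.mem_powersetCard, Finset.mem_filter]
    simp
  haveI : Fintype (Quotient (AddAction.orbitRel (ZMod n) (Finset (ZMod n)))) := Fintype.ofFinite _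
  set Q := Quotient (AddAction.orbitRel (ZMod n) (Finset (ZMod n)))
  set w0 : Q := Quotient.mk _ H with hw0
  set sg : Q → ℕ := fun ω => Nat.card (AddAction.stabilizer (ZMod n) ω.out) with hsg
  set Fo : Q → T → ℂ := fun ω t => ∑ i : ZMod n, f t (i +ᵥ ω.out) with hFo
  have hFo1 : ∀ ω : Q, ω.out.card = s → ∀ t, Fo ω t = ∑ i : ZMod n, χ t ^ (b * eJ q ω.out * q ^ i.val) := by
    intro ω hω t
    refine Finset.sum_congr rfl fun i _ => ?_
    simp only [hf]
    rw [if_pos (by rw [Finset.card_vadd_finset, hω])]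
    rw [mul_assoc]
    exact chi_mod χ hχ ((eJ_vadd hM i _).mul_left b) t
  -- the orbit of H
  have hHorb : ∃ j : ZMod n, j +ᵥ H = w0.out := by
    have h2 : Quotient.mk (AddAction.orbitRel (ZMod n) (Finset (ZMod n))) w0.out = Quotient.mk _ H := by rw [Quotient.out_eq]
    exact AddAction.orbitRel_apply.1 (Quotient.exact h2)
  obtain ⟨j0, hj0⟩ := hHorb
  have hw0c : w0.out.card = s := by rw [← hj0, Finset.card_vadd_finset, hHc]
  have hw0F : ∀ t, Fo w0 t = ∑ i : ZMod n, χ t ^ (a * q ^ i.val) := by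
    intro t
    rw [hFo1 w0 hw0c, ← hj0, hb]
    rw [← Equiv.sum_comp (Equiv.addRight j0) (fun i : ZMod n => χ t ^ (eJ q H * b * q ^ i.val))]
    refine Finset.sum_congr rfl fun i _ => ?_
    refine chi_mod χ hχ ?_ t
    show b * eJ q (j0 +ᵥ H) * q ^ i.val ≡ eJ q H * b * q ^ (i + j0).val [MOD M]
    refine (((eJ_vadd hM j0 H).mul_left b).mul_right _).trans ?_
    refine Nat.ModEq.trans ?_ ((pw_add hM i j0).mul_left (eJ q H * b)).symm
    rw [show b * (eJ q H * q ^ j0.val) * q ^ i.val = eJ q H * b * (q ^ i.val * q ^ j0.val) by ring]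
  -- stabilizers
  have hdvd : ∀ ω : Q, ω.out.card = s → sg ω ∣ n := by
    intro ω _
    have := AddSubgroup.card_addSubgroup_dvd_card (AddAction.stabilizer (ZMod n) ω.out)
    rwa [Nat.card_zmod] at this
  have hcos : ∀ ω : Q, ∀ j ∈ ω.out, (Finset.univ.filter fun i : ZMod n => sg ω • i = 0).image (fun i => i + j) ⊆ ω.out := by
    intro ω j hj x hx
    obtain ⟨i, hi, rfl⟩ := Finset.mem_image.1 hx
    have h1 : i ∈ AddAction.stabilizer (ZMod n) ω.out := (stab_card _ i).2 (Finset.mem_filter.1 hi).2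
    rw [AddAction.mem_stabilizer_iff] at h1
    rw [← h1]
    exact Finset.mem_vadd_finset.2 ⟨j, hj, rfl⟩
  have hcardH : ∀ ω : Q, ω.out.card = s → (Finset.univ.filter fun i : ZMod n => sg ω • i = 0).card = sg ω := by
    intro ω hω
    obtain ⟨d', hd'⟩ := hdvd ω hω
    obtain ⟨h1, _⟩ := Hs_img (n := n) (sg ω) d' hd'
    have h3 : (Finset.univ.filter fun i : ZMod n => sg ω • i = 0) = (Finset.range (sg ω)).image (fun j : ℕ => ((d' * j : ℕ) : ZMod n)) := by
      rw [← Finset.coe_inj, Finset.coe_image, h1.image_eq]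
    rw [h3, Finset.card_image_of_injOn h1.injOn, Finset.card_range]
  have hlt : ∀ ω : Q, ω.out.card = s → ω ≠ w0 → sg ω < s := by
    intro ω hω hne
    obtain ⟨j, hj⟩ := Finset.card_pos.1 (by rw [hω]; exact hs)
    have h1 := Finset.card_le_card (hcos ω j hj)
    rw [Finset.card_image_of_injective _ (add_left_injective j), hcardH ω hω, hω] at h1
    refine lt_of_le_of_ne h1 fun h2 => hne ?_
    have h3 := Finset.eq_of_subset_of_card_le (hcos ω j hj) (by
      rw [Finset.card_image_of_injective _ (add_left_injective j), hcardH ω hω, hω, h2])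
    rw [← Quotient.out_eq ω, hw0]
    refine Quotient.sound (AddAction.orbitRel_apply.2 ⟨j, ?_⟩)
    show j +ᵥ H = ω.out
    rw [← h3, ← Finset.image_vadd, h2]
    refine Finset.image_congr fun x _ => ?_
    show j + x = x + j
    exact add_comm _ _
  have hIH : ∀ ω : Q, ω.out.card = s ∧ ω ≠ w0 → ∃ u, U u ∧ ∀ t, (sg ω : ℂ) * u t = Fo ω t := by
    rintro ω ⟨hω, hne⟩
    obtain ⟨d', hd'⟩ := hdvd ω hω
    obtain ⟨u, hu1, hu2⟩ := ih (sg ω) (hlt ω hω hne) d' hd' (b * eJ q ω.out) (by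
      rw [mul_assoc]
      refine Nat.ModEq.mul_left b ?_
      have h1 : ((d' : ℕ) : ZMod n) ∈ AddAction.stabilizer (ZMod n) ω.out := by
        rw [stab_card]
        rw [nsmul_eq_mul, ← Nat.cast_mul]
        show ((sg ω * d' : ℕ) : ZMod n) = 0
        rw [← hd']; simp
      rw [AddAction.mem_stabilizer_iff] at h1
      have h2 := eJ_vadd hM ((d' : ℕ) : ZMod n) ω.out
      rw [h1] at h2
      refine Nat.ModEq.trans ?_ h2.symm
      refine Nat.ModEq.mul_left _ ?_
      rw [ZMod.val_natCast]
      have h3 : q ^ n ≡ 1 [MOD M] := by rw [← hM]; simp [Nat.ModEq]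
      conv_lhs => rw [← Nat.div_add_mod d' n, pow_add, pow_mul]
      have h4 := ((h3.pow (d' / n)).mul_right (q ^ (d' % n)))
      rw [one_pow, one_mul] at h4
      exact h4)
    exact ⟨u, hu1, fun t => by rw [hu2 t, hFo1 ω hω t]⟩
  choose! u hu1 hu2 using hIH
  have hspos : ∀ ω : Q, (sg ω : ℂ) ≠ 0 := fun ω => Nat.cast_ne_zero.2 Nat.card_pos.ne'
  have hsw0 : sg w0 = s := by
    apply le_antisymm
    · obtain ⟨j, hj⟩ := Finset.card_pos.1 (by rw [hw0c]; exact hs)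
      have h1 := Finset.card_le_card (hcos w0 j hj)
      rwa [Finset.card_image_of_injective _ (add_left_injective j), hcardH w0 hw0c, hw0c] at h1
    · have h1 : H ⊆ Finset.univ.filter fun i : ZMod n => sg w0 • i = 0 := by
        intro i hi
        rw [Finset.mem_filter]
        refine ⟨Finset.mem_univ _, (stab_card _ i).1 ?_⟩
        rw [AddAction.mem_stabilizer_iff, ← hj0, vadd_comm]
        congr 1
        refine Finset.eq_of_subset_of_card_le ?_ (by rw [Finset.card_vadd_finset])
        intro x hx
        obtain ⟨y, hy, rfl⟩ := Finset.mem_vadd_finset.1 hx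
        rw [hH, Finset.mem_filter] at hi hy ⊢
        refine ⟨Finset.mem_univ _, ?_⟩
        rw [vadd_eq_add, nsmul_add, hi.2, hy.2, add_zero]
      have h2 := Finset.card_le_card h1
      rwa [hHc, hcardH w0 hw0c] at h2
  refine ⟨fun t => (∑ J ∈ (Finset.univ : Finset (ZMod n)).powersetCard s, χ t ^ (b * eJ q J)) - ∑ ω ∈ Finset.univ.filter (fun ω : Q => ω.out.card = s ∧ ω ≠ w0), u ω t,
    hsub _ _ (he s b) (hsum _ _ _ fun ω hω => hu1 ω (Finset.mem_filter.1 hω).2), fun t => ?_⟩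
  show (s : ℂ) * ((∑ J ∈ (Finset.univ : Finset (ZMod n)).powersetCard s, χ t ^ (b * eJ q J)) - ∑ ω ∈ Finset.univ.filter (fun ω : Q => ω.out.card = s ∧ ω ≠ w0), u ω t) = _
  rw [hf1, orbit_decomp (A := ZMod n) (f t), finsum_eq_sum_of_fintype, Finset.sum_filter, ← Finset.sum_sub_distrib, Finset.sum_eq_single w0]
  · rw [if_neg (fun h => h.2 rfl), sub_zero]
    show (s : ℂ) * ((sg w0 : ℂ)⁻¹ * Fo w0 t) = _
    rw [hsw0, mul_inv_cancel_left₀ (by rw [← hsw0]; exact hspos w0), hw0F]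
  · intro ω _ hne
    show (sg ω : ℂ)⁻¹ * Fo ω t - _ = 0
    by_cases hω : ω.out.card = s
    · rw [if_pos ⟨hω, hne⟩, ← hu2 ω ⟨hω, hne⟩, inv_mul_cancel_left₀ (hspos ω), sub_self]
    · rw [if_neg (fun h => hω h.1), sub_zero]
      have : Fo ω t = 0 := by
        refine Finset.sum_eq_zero fun i _ => ?_
        simp only [hf]
        rw [if_neg (by rw [Finset.card_vadd_finset]; exact hω)]
      rw [this, mul_zero]
  · intro h; exact absurd (Finset.mem_univ _) h
end
end KL

namespace KL

section
variable {F : Type} [Field F] [Finite F] {E : Type} [Field E] [Finite E] [Algebra F E]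
variable {K : Type} [Field K] [Algebra F K] [Algebra E K] [IsScalarTower F E K]

theorem Mt_splits (t : E) : ((Mt F t).map (algebraMap F E)).Splits := by
  rw [Mt, Polynomial.map_pow]
  exact (split_E _ (min_irr t) (min_dvd t)).pow _

theorem range_zmod {β : Type} (n : ℕ) [NeZero n] (f : ℕ → β) : (Multiset.range n).map f = (Finset.univ : Finset (ZMod n)).val.map (fun j => f j.val) := by
  have : (Multiset.range n) = (Finset.univ : Finset (ZMod n)).val.map (fun j => j.val) := by
    have h2 : (Finset.univ : Finset (ZMod n)).map ⟨ZMod.val, ZMod.val_injective n⟩ = Finset.range n := by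
      ext i
      simp only [Finset.mem_map, Finset.mem_univ, true_and, Function.Embedding.coeFn_mk, Finset.mem_range]
      constructor
      · rintro ⟨a, rfl⟩; exact ZMod.val_lt a
      · intro h; exact ⟨i, ZMod.val_cast_of_lt h⟩
    have := congrArg Finset.val h2
    rw [Finset.map_val] at this
    exact this.symm
  rw [this, Multiset.map_map]; rfl

theorem Mt_arootsK (n : ℕ) [NeZero n] (hn : Module.finrank F E = n) (t : E) :
    (Mt F t).aroots K = (Finset.univ : Finset (ZMod n)).val.map (fun i => algebraMap E K t ^ (Nat.card F ^ i.val)) := by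
  have h1 : (Mt F t).aroots K = ((Mt F t).aroots E).map (algebraMap E K) := by
    have := Polynomial.Splits.map_aroots_algebraMap (B := K) (Mt_splits (F := F) t)
    exact this.symm
  rw [h1, Mt_aroots, Multiset.map_map, hn, range_zmod]
  refine Multiset.map_congr rfl fun j _ => ?_
  show algebraMap E K (t ^ _) = _
  rw [map_pow]

theorem Mt_esymm (n : ℕ) [NeZero n] (hn : Module.finrank F E = n) (θ : MulChar K ℂ) (s b : ℕ) (t : E) (ht : t ≠ 0) :
    (((Mt F t).aroots K).map (θ ^ b)).esymm s = ∑ J ∈ (Finset.univ : Finset (ZMod n)).powersetCard s, (θ (algebraMap E K t)) ^ (b * eJ (Nat.card F) J) := by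
  classical
  rw [Mt_arootsK n hn, Multiset.map_map, Finset.esymm_map_val]
  refine Finset.sum_congr rfl fun J _ => ?_
  rw [eJ, Finset.mul_sum, ← Finset.prod_pow_eq_pow_sum]
  refine Finset.prod_congr rfl fun i _ => ?_
  show (θ ^ b) (algebraMap E K t ^ _) = _
  have : algebraMap E K t ≠ 0 := (map_ne_zero_iff _ (algebraMap E K).injective).2 ht
  obtain ⟨u, hu⟩ := (isUnit_iff_ne_zero.2 this)
  rw [map_pow, ← hu, MulChar.pow_apply_coe, ← pow_mul]

end

/-- target class functions -/
theorem target {F : Type} [Field F] [Finite F] {E : Type} [Field E] [Fintype E] [Algebra F E]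
    {K : Type} [Field K] [Fintype K] [Algebra F K] [Algebra E K] [IsScalarTower F E K]
    {V : Type} [AddCommGroup V] [Module F V] [Finite V]
    (n : ℕ) [NeZero n] (hn : Module.finrank F E = n)
    (p m0 : ℕ) [Fact p.Prime] (hm0 : 0 < m0) (hp : Fintype.card K = p ^ m0)
    (hM : ∀ d, d ∣ Nat.card (Module.End F V)ˣ → Nat.Coprime d p → d ∣ Fintype.card K - 1) (θ : MulChar K ℂ)
    (s d : ℕ) (hsd : n = s * d) (a : ℕ) (ha : a * Nat.card F ^ d ≡ a [MOD (Fintype.card E - 1)]) :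
    ∃ η : Polynomial F → ℂ, Virt OO (fun g : (Module.End F V)ˣ => η g.1.charpoly) ∧
      ∀ t : E, t ≠ 0 → s * η (Mt F t) = ∑ i : ZMod n, (θ (algebraMap E K t)) ^ (a * Nat.card F ^ i.val) := by
  have hE : Fintype.card E = Nat.card F ^ n := by
    rw [← Nat.card_eq_fintype_card, Module.natCard_eq_pow_finrank (K := F), hn]
  have hM1 : (Fintype.card E - 1) + 1 = Nat.card F ^ n := by
    have : 0 < Fintype.card E := Fintype.card_pos
    omega
  obtain ⟨u, ⟨η, h1, h2⟩, h3⟩ := target_abs hM1 (Finite.one_lt_card) (T := {t : E // t ≠ 0}) (fun t => θ (algebraMap E K t.1))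
    (by
      intro t
      rw [← map_pow, ← map_pow, FiniteField.pow_card_sub_one_eq_one _ t.2, map_one, map_one])
    (fun u => ∃ η : Polynomial F → ℂ, Virt OO (fun g : (Module.End F V)ˣ => η g.1.charpoly) ∧ ∀ t : {t : E // t ≠ 0}, η (Mt F t.1) = u t)
    (by
      rintro u v ⟨η, h1, h2⟩ ⟨η', h1', h2'⟩
      exact ⟨fun c => η c - η' c, h1.sub h1', fun t => by simp only [h2, h2']⟩)
    (by
      intro κ S u h
      choose! η h1 h2 using h
      exact ⟨fun c => ∑ i ∈ S, η i c, Virt.sum h1, fun t => Finset.sum_congr rfl fun i hi => h2 i hi t⟩)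
    (by
      intro s b
      exact ⟨fun c => ((c.aroots K).map (θ ^ b)).esymm s, es_virt p m0 hm0 hp hM s (θ ^ b), fun t => Mt_esymm n hn θ s b t.1 t.2⟩)
    s d hsd a ha
  exact ⟨η, h1, fun t ht => by rw [h2 ⟨t, ht⟩, h3 ⟨t, ht⟩]⟩

end KL

namespace KL

open Classical in
noncomputable def eps {F : Type} [Field F] (c : Polynomial F) : ℂ := if c.coeff 0 = 0 then 0 else 1

section
variable {F : Type} [Field F] [Finite F] {E : Type} [Field E] [Finite E] [Algebra F E]
variable {K : Type} [Field K] [Algebra F K] [Algebra E K] [IsScalarTower F E K]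
variable {V : Type} [AddCommGroup V] [Module F V] [Finite V]

theorem unit_iff (g : Module.End F V) : IsUnit g ↔ g.charpoly.coeff 0 ≠ 0 := by
  haveI : Module.Finite F V := Module.Finite.of_finite
  rw [LinearMap.isUnit_iff_isUnit_det, LinearMap.det_eq_sign_charpoly_coeff, isUnit_iff_ne_zero, mul_ne_zero_iff]
  simp

theorem sumG (φ : Module.End F V → ℂ) : ∑ h : (Module.End F V)ˣ, φ h.1 = ∑ g : Module.End F V, φ g * eps g.charpoly := by
  rw [← sum_units]
  · refine Finset.sum_congr rfl fun h _ => ?_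
    rw [eps, if_neg ((unit_iff h.1).1 h.isUnit), mul_one]
  · intro g hg
    rw [unit_iff, not_not] at hg
    rw [eps, if_pos hg, mul_zero]

theorem eps_Mt [DecidableEq E] (t : E) : eps (Mt F t) = if t = 0 then 0 else 1 := by
  have : (Mt F t).coeff 0 = 0 ↔ t = 0 := by
    rw [Mt, Polynomial.coeff_zero_eq_eval_zero, Polynomial.eval_pow, ← Polynomial.coeff_zero_eq_eval_zero]
    have h1 := min_dvd (F := F) t
    have h2 : 0 < Module.finrank F E := Module.finrank_pos
    have h3 := Nat.div_pos (Nat.le_of_dvd h2 h1) (min_irr (F := F) t).natDegree_pos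
    rw [pow_eq_zero_iff h3.ne', minpoly.coeff_zero_eq_zero (Algebra.IsIntegral.isIntegral t)]
  unfold eps
  simp only [this]

theorem pairG [Fintype E] [DecidableEq E] (f : K → ℂ) (hV : Module.finrank F V = Module.finrank F E) (η : Polynomial F → ℂ) :
    ((Nat.card V : ℂ) - 1) * (∑ g : (Module.End F V)ˣ, R K f g.1 * η g.1.charpoly) =
    (Nat.card (Module.End F V)ˣ : ℂ) * ∑ t : Eˣ, f (algebraMap E K t.1) * η (Mt F t.1) := by
  classical
  rw [sumG (fun g : Module.End F V => R K f g * η g.charpoly)]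
  have := pairing (E := E) (K := K) f hV (fun c => η c * eps c)
  simp only [← mul_assoc] at this
  rw [this]
  congr 1
  simp only [eps_Mt]
  symm
  refine Finset.sum_bij_ne_zero (fun t _ _ => t.1) (fun _ _ _ => Finset.mem_univ _) (fun a _ _ b _ _ h => Units.ext h) ?_ ?_
  · intro t _ h
    have ht : t ≠ 0 := by rintro rfl; simp at h
    refine ⟨Units.mk0 t ht, Finset.mem_univ _, ?_, rfl⟩
    rw [if_neg ht, mul_one] at h
    exact h
  · intro t _ _
    rw [if_neg t.ne_zero, mul_one]

theorem prim_bF_G (f : K → ℂ) {v : Module.End F V → ℂ} (hv : Prim v) :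
    ∑ g : (Module.End F V)ˣ, v g.1 * R K f g.1 = ∑ g : (Module.End F V)ˣ, v g.1 * bF K f g.1 := by
  rw [sumG (fun g : Module.End F V => v g * R K f g), sumG (fun g : Module.End F V => v g * bF K f g), prim_bF f hv]

theorem prim_pair_G {v : Module.End F V → ℂ} (hv : Prim v) (hV : Module.finrank F V = Module.finrank F E) (η : Polynomial F → ℂ)
    (hη : ∀ t : E, t ≠ 0 → η (Mt F t) = 0) : ∑ g : (Module.End F V)ˣ, v g.1 * η g.1.charpoly = 0 := by
  classical
  rw [sumG (fun g : Module.End F V => v g * η g.charpoly)]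
  have := prim_pair (E := E) hv hV (fun c => η c * eps c) ?_
  · simpa only [← mul_assoc] using this
  · intro t
    show η (Mt F t) * eps (Mt F t) = 0
    rw [eps_Mt]
    split_ifs with h
    · simp
    · rw [hη t h, zero_mul]

theorem bF_Mt (n : ℕ) [NeZero n] (hn : Module.finrank F E = n) (f : K → ℂ) (t : E) :
   (((Mt F t).aroots K).map f).sum = ∑ i : ZMod n, f (algebraMap E K t ^ (Nat.card F ^ i.val)) := by
  rw [Mt_arootsK n hn, Multiset.map_map]; rfl

theorem R_minv (m : MulChar K ℂ) (g : (Module.End F V)ˣ) : R K m (g⁻¹).1 = R K (m⁻¹ : MulChar K ℂ) g.1 := by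
  rw [R_inv _ _ V g le_rfl]
  congr 1
  funext x
  rw [MulChar.inv_apply']

end

end KL

namespace KL

section
variable {F : Type} [Field F] [Finite F] {E : Type} [Field E] [Fintype E] [DecidableEq E] [Algebra F E]
variable {K : Type} [Field K] [Fintype K] [Algebra F K] [Algebra E K] [IsScalarTower F E K]

theorem theta_nz (θ : MulChar K ℂ) (t : E) (ht : t ≠ 0) : θ (algebraMap E K t) ≠ 0 := by
  have h : (θ (algebraMap E K t)) ^ (Fintype.card E - 1) = 1 := by
    rw [← map_pow, ← map_pow, FiniteField.pow_card_sub_one_eq_one _ ht, map_one, map_one]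
  intro h0
  rw [h0, zero_pow] at h
  · exact zero_ne_one h
  · have : 1 < Fintype.card E := Fintype.one_lt_card
    omega

theorem theta_mod (θ : MulChar K ℂ) (hθ : ∀ y z : K, y ≠ 0 → θ y = θ z → y = z) (x y : ℕ) :
    (∀ t : Eˣ, (θ (algebraMap E K t.1)) ^ x = (θ (algebraMap E K t.1)) ^ y) ↔ x ≡ y [MOD (Fintype.card E - 1)] := by
  constructor
  · intro h
    obtain ⟨g, hg⟩ := IsCyclic.exists_generator (α := Eˣ)
    have h1 := h g
    rw [← map_pow, ← map_pow, ← map_pow, ← map_pow] at h1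
    have h2 := hθ _ _ ((map_ne_zero_iff _ (algebraMap E K).injective).2 (pow_ne_zero _ g.ne_zero)) h1
    have h3 := (algebraMap E K).injective h2
    have h4 : g ^ x = g ^ y := Units.ext (by simpa using h3)
    rw [pow_eq_pow_iff_modEq, orderOf_eq_card_of_forall_mem_zpowers hg, Nat.card_eq_fintype_card, Fintype.card_units] at h4
    exact h4
  · intro h t
    refine chi_mod (M := Fintype.card E - 1) (fun t : Eˣ => θ (algebraMap E K t.1)) ?_ h t
    intro t
    show (θ _) ^ _ = 1
    rw [← map_pow, ← map_pow, FiniteField.pow_card_sub_one_eq_one _ t.ne_zero, map_one, map_one]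

open Classical in
theorem orth (θ : MulChar K ℂ) (hθ : ∀ y z : K, y ≠ 0 → θ y = θ z → y = z) (x y : ℕ) :
    ∑ t : Eˣ, ((θ (algebraMap E K t.1)) ^ x)⁻¹ * (θ (algebraMap E K t.1)) ^ y = if y ≡ x [MOD (Fintype.card E - 1)] then ((Nat.card E : ℂ) - 1) else 0 := by
  let f : Eˣ →* ℂ :=
    { toFun := fun t => ((θ (algebraMap E K t.1)) ^ x)⁻¹ * (θ (algebraMap E K t.1)) ^ y
      map_one' := by simp
      map_mul' := by
        intro s t
        simp only [Units.val_mul, map_mul, mul_pow, mul_inv]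
        ring }
  have h := sum_hom_units f
  show ∑ t, f t = _
  have hiff : f = 1 ↔ y ≡ x [MOD (Fintype.card E - 1)] := by
    rw [← theta_mod θ hθ]
    constructor
    · intro h t
      have := DFunLike.congr_fun h t
      change ((θ (algebraMap E K t.1)) ^ x)⁻¹ * (θ (algebraMap E K t.1)) ^ y = 1 at this
      rw [inv_mul_eq_one₀ (pow_ne_zero _ (theta_nz θ _ t.ne_zero))] at this
      exact this.symm
    · intro h
      ext t
      show ((θ (algebraMap E K t.1)) ^ x)⁻¹ * (θ (algebraMap E K t.1)) ^ y = 1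
      rw [h t, inv_mul_cancel₀ (pow_ne_zero _ (theta_nz θ _ t.ne_zero))]
  rw [h]
  simp only [hiff]
  rw [Fintype.card_units, Nat.card_eq_fintype_card]
  have : 1 ≤ Fintype.card E := Fintype.card_pos
  split_ifs <;> push_cast [this] <;> ring

end

def Sst {n q M : ℕ} [NeZero n] (hM : M + 1 = q ^ n) (a : ℕ) : AddSubgroup (ZMod n) where
  carrier := {i | a * q ^ i.val ≡ a [MOD M]}
  zero_mem' := by
    show a * q ^ (0 : ZMod n).val ≡ a [MOD M]
    simp [Nat.ModEq]
  add_mem' := by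
    intro i j hi hj
    show a * q ^ (i + j).val ≡ a [MOD M]
    change a * q ^ i.val ≡ a [MOD M] at hi
    change a * q ^ j.val ≡ a [MOD M] at hj
    refine ((pw_add hM i j).mul_left a).trans ?_
    rw [← mul_assoc]
    exact (hi.mul_right _).trans hj
  neg_mem' := by
    intro i hi
    show a * q ^ (-i).val ≡ a [MOD M]
    change a * q ^ i.val ≡ a [MOD M] at hi
    have h1 := (pw_add hM i (-i)).mul_left a
    rw [add_neg_cancel, ← mul_assoc] at h1
    have h2 := (hi.mul_right (q ^ (-i).val))
    have h3 := h1.trans h2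
    have h4 : a * q ^ (0 : ZMod n).val = a := by simp
    rw [h4] at h3
    exact h3.symm

theorem Sst_d {n q M : ℕ} [NeZero n] (hM : M + 1 = q ^ n) (a : ℕ) : ∃ d, n = Nat.card (Sst hM a) * d ∧ a * q ^ d ≡ a [MOD M] := by
  have h1 := AddSubgroup.card_addSubgroup_dvd_card (Sst hM a)
  rw [Nat.card_zmod] at h1
  obtain ⟨d, hd⟩ := h1
  refine ⟨d, hd, ?_⟩
  have h2 : (d : ZMod n) ∈ Sst hM a := by
    rw [stab_card, nsmul_eq_mul, ← Nat.cast_mul, ← hd]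
    simp
  change a * q ^ (d : ZMod n).val ≡ a [MOD M] at h2
  rcases lt_or_ge d n with h | h
  · rwa [ZMod.val_cast_of_lt h] at h2
  · have : d = n := le_antisymm (Nat.le_of_dvd (NeZero.pos n) ⟨_, by rw [mul_comm]; exact hd⟩) h
    rw [this, ← hM]
    have : a * (M + 1) = a + M * a := by ring
    rw [this]
    simp [Nat.ModEq]

end KL

namespace KL

theorem sum_orth {F : Type} [Field F] [Finite F] {E : Type} [Field E] [Fintype E] [DecidableEq E] [Algebra F E]
    {K : Type} [Field K] [Fintype K] [Algebra F K] [Algebra E K] [IsScalarTower F E K]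
    (n : ℕ) [NeZero n] (hM1 : (Fintype.card E - 1) + 1 = Nat.card F ^ n)
    (θ : MulChar K ℂ) (hθ : ∀ y z : K, y ≠ 0 → θ y = θ z → y = z) (a : ℕ) :
    ∑ t : Eˣ, ((θ (algebraMap E K t.1)) ^ a)⁻¹ * ∑ i : ZMod n, (θ (algebraMap E K t.1)) ^ (a * Nat.card F ^ i.val) =
      (Nat.card (Sst hM1 a) : ℂ) * ((Nat.card E : ℂ) - 1) := by
  classical
  simp only [Finset.mul_sum]
  rw [Finset.sum_comm, Finset.sum_congr rfl (fun i _ => orth θ hθ a _), ← Finset.sum_filter, Finset.sum_const, nsmul_eq_mul]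
  congr 2
  refine Eq.trans ?_ (Nat.card_eq_fintype_card (α := Sst hM1 a)).symm
  rw [Fintype.card_subtype]
  congr 1
  ext i
  simp only [Finset.mem_filter, Finset.mem_univ, true_and]
  exact Iff.rfl

theorem eig {F : Type} [Field F] [Finite F] {E : Type} [Field E] [Fintype E] [DecidableEq E] [Algebra F E]
    {K : Type} [Field K] [Fintype K] [Algebra F K] [Algebra E K] [IsScalarTower F E K]
    {V : Type} [AddCommGroup V] [Module F V] [Finite V]
    (n : ℕ) [NeZero n] (hn : Module.finrank F E = n) (hV : Module.finrank F V = n)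
    (p m0 : ℕ) [Fact p.Prime] (hm0 : 0 < m0) (hp : Fintype.card K = p ^ m0)
    (hK : ∀ (V : Type) [AddCommGroup V] [Module F V] [Finite V], Module.finrank F V ≤ n →
      ∀ d, d ∣ Nat.card (Module.End F V)ˣ → Nat.Coprime d p → d ∣ Fintype.card K - 1)
    (θ : MulChar K ℂ) (hθ : ∀ y z : K, y ≠ 0 → θ y = θ z → y = z)
    (ψ : AddChar F ℂ) (hψ : ∃ a : F, ψ a ≠ 1) (a : ℕ) (α : MulChar K ℂ) (hα : α⁻¹ = θ ^ a) :
    ∃ w : ℂ, ∀ k (x : (Module.End F V)ˣ), (TT ψ)^[k] (R K α) x.1 = w ^ k * R K α x.1 := by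
  classical
  have hE : Fintype.card E = Nat.card F ^ n := by
    rw [← Nat.card_eq_fintype_card, Module.natCard_eq_pow_finrank (K := F), hn]
  have hVE : Nat.card V = Nat.card E := by
    rw [Module.natCard_eq_pow_finrank (K := F) (V := V), Module.natCard_eq_pow_finrank (K := F) (V := E), hn, hV]
  have hM1 : (Fintype.card E - 1) + 1 = Nat.card F ^ n := by
    have : 0 < Fintype.card E := Fintype.card_pos
    omega
  have hM0 : (Nat.card E : ℂ) - 1 ≠ 0 := by
    have : 1 < Nat.card E := Finite.one_lt_card
    rw [sub_ne_zero]
    exact_mod_cast this.ne'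
  obtain ⟨d, hd1, hd2⟩ := Sst_d hM1 a
  set m := Nat.card (Sst hM1 a) with hm
  obtain ⟨η, hη1, hη2⟩ := target (V := V) n hn p m0 hm0 hp (hK V hV.le) θ m d hd1 a hd2
  have hinv : ∀ (t : E), t ≠ 0 → ∀ i : ZMod n, (α⁻¹) (algebraMap E K t ^ (Nat.card F ^ i.val)) = (θ (algebraMap E K t)) ^ (a * Nat.card F ^ i.val) := by
    intro t ht i
    have : algebraMap E K t ≠ 0 := (map_ne_zero_iff _ (algebraMap E K).injective).2 ht
    obtain ⟨u, hu⟩ := (isUnit_iff_ne_zero.2 this)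
    rw [hα, map_pow, ← hu, MulChar.pow_apply_coe, ← pow_mul]
  have hal : ∀ t : Eˣ, α (algebraMap E K t.1) = ((θ (algebraMap E K t.1)) ^ a)⁻¹ := by
    intro t
    have : algebraMap E K t.1 ≠ 0 := (map_ne_zero_iff _ (algebraMap E K).injective).2 t.ne_zero
    obtain ⟨u, hu⟩ := (isUnit_iff_ne_zero.2 this)
    rw [← inv_inv α, hα, MulChar.inv_apply_eq_inv', ← hu, MulChar.pow_apply_coe]
  have hbM : ∀ (t : E), t ≠ 0 → (((Mt F t).aroots K).map (α⁻¹ : MulChar K ℂ)).sum = ∑ i : ZMod n, (θ (algebraMap E K t)) ^ (a * Nat.card F ^ i.val) := by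
    intro t ht
    rw [bF_Mt n hn]
    exact Finset.sum_congr rfl fun i _ => hinv t ht i
  have hprim : ∀ k, Prim ((TT ψ)^[k] (R K α) : Module.End F V → ℂ) := by
    intro k
    induction k with
    | zero => exact R_prim α _ V le_rfl
    | succ k ih => rw [Function.iterate_succ_apply']; exact TT_prim ψ hψ ih
  have key : ∀ k, ∑ g : (Module.End F V)ˣ, (TT ψ)^[k] (R K α) g.1 * R K α (g⁻¹).1 = ∑ g : (Module.End F V)ˣ, (TT ψ)^[k] (R K α) g.1 * ((g.1.charpoly.aroots K).map (α⁻¹ : MulChar K ℂ)).sum := by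
    intro k
    simp only [R_minv]
    exact prim_bF_G _ (hprim k)
  refine eigen (G := (Module.End F V)ˣ) (fun g => ψ (LinearMap.trace F V g.1)) ?_ (fun k g => (TT ψ)^[k] (R K α) g.1) ?_ ?_ ?_ m Nat.card_pos (fun g => η g.1.charpoly) hη1 ?_ ?_
  · intro g h
    show ψ (LinearMap.trace F V (h.1 * g.1 * (h⁻¹).1)) = _
    rw [LinearMap.trace_mul_comm, ← mul_assoc]
    rw [show (h⁻¹).1 * h.1 = 1 from h.inv_mul, one_mul]
  · intro k x
    show (TT ψ)^[k+1] (R K α) x.1 = _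
    rw [Function.iterate_succ_apply']
    rfl
  · intro g x
    exact R_class α g.1 x
  · refine R_virt _ n (fun V _ _ _ h => ?_) n V hV.le le_rfl
    haveI : Module.Finite F V := Module.Finite.of_finite
    exact bF_virt p m0 hm0 hp (hK V h) α
  · intro k
    show ∑ g : (Module.End F V)ˣ, (TT ψ)^[k] (R K α) g.1 * R K α (g⁻¹).1 = m * ∑ g : (Module.End F V)ˣ, (TT ψ)^[k] (R K α) g.1 * η g.1.charpoly
    rw [key, ← sub_eq_zero, Finset.mul_sum, ← Finset.sum_sub_distrib]
    have := prim_pair_G (E := E) (hprim k) (hV.trans hn.symm) (fun c => ((c.aroots K).map (α⁻¹ : MulChar K ℂ)).sum - m * η c) ?_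
    · refine Eq.trans (Finset.sum_congr rfl fun g _ => ?_) this
      ring
    · intro t ht
      show (((Mt F t).aroots K).map (α⁻¹ : MulChar K ℂ)).sum - m * η (Mt F t) = 0
      rw [hbM t ht, hη2 t ht, sub_self]
  · show ∑ g : (Module.End F V)ˣ, R K α g.1 * R K α (g⁻¹).1 = m * Fintype.card (Module.End F V)ˣ
    refine (key 0).trans ?_
    have h := pairG (E := E) (K := K) (V := V) α (hV.trans hn.symm) (fun c => ((c.aroots K).map (α⁻¹ : MulChar K ℂ)).sum)
    apply mul_left_cancel₀ hM0
    rw [← hVE]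
    refine h.trans ?_
    simp only [hal, hbM _ (Units.ne_zero _)]
    rw [sum_orth n hM1 θ hθ, Nat.card_eq_fintype_card (α := (Module.End F V)ˣ), ← hm, hVE]
    ring

end KL

namespace KL

section
variable {F : Type} [Field F] [Finite F] {E : Type} [Field E] [Fintype E] [DecidableEq E] [Algebra F E]
variable {K : Type} [Field K] [Fintype K] [Algebra F K] [Algebra E K] [IsScalarTower F E K]
variable {V : Type} [AddCommGroup V] [Module F V] [Finite V]

theorem trace_next (g : Module.End F V) : LinearMap.trace F V g = - g.charpoly.nextCoeff := by
  haveI : Module.Finite F V := Module.Finite.of_finite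
  let b := Module.finBasis F V
  rw [LinearMap.trace_eq_matrix_trace F b, Matrix.trace_eq_neg_charpoly_nextCoeff, LinearMap.charpoly_toMatrix]

theorem trace_Mt (t : E) : Algebra.trace F E t = - (Mt F t).nextCoeff := by
  rw [trace_eq_finrank_mul_minpoly_nextCoeff, Mt, Polynomial.Monic.nextCoeff_pow (min_monic t)]
  have h1 := Module.finrank_mul_finrank F (IntermediateField.adjoin F {t}) E
  rw [IntermediateField.adjoin.finrank (Algebra.IsIntegral.isIntegral t)] at h1
  have h2 : Module.finrank F E / (minpoly F t).natDegree = Module.finrank (IntermediateField.adjoin F {t}) E := by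
    rw [← h1, Nat.mul_div_cancel_left _ (min_irr t).natDegree_pos]
  rw [h2, nsmul_eq_mul]
  ring

theorem R_ext (f f' : K → ℂ) (g : Module.End F V) (h : ∀ x, Polynomial.aeval x g.charpoly = 0 → f x = f' x) : R K f g = R K f' g := by
  have h1 := R_lin (Finset.univ : Finset Bool) (fun b => if b then 1 else -1) (fun b => if b then f else f') g
  have h2 : R K (fun x => ∑ b : Bool, (if b then (1 : ℂ) else -1) * (if b then f else f') x) g = 0 := by
    refine R_vanish _ _ V g fun x hx => ?_
    simp [h x hx]
  rw [h2] at h1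
  simp at h1
  linear_combination -h1

theorem R_one_eq (f f' : K → ℂ) (h : f 1 = f' 1) : R K f (1 : Module.End F V) = R K f' (1 : Module.End F V) := by
  haveI : Module.Finite F V := Module.Finite.of_finite
  refine R_ext f f' _ fun x hx => ?_
  rw [LinearMap.charpoly_one, map_pow, map_sub, Polynomial.aeval_X, map_one] at hx
  have := eq_zero_of_pow_eq_zero hx
  rw [sub_eq_zero] at this
  rw [this, h]

noncomputable def GE (F : Type) [Field F] (E : Type) [Field E] [Fintype E] [DecidableEq E] [Algebra F E] {K : Type} [Field K] [Algebra E K] (ψ : AddChar F ℂ) (f : K → ℂ) : ℂ :=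
  ∑ t : Eˣ, f (algebraMap E K t.1) * ψ (Algebra.trace F E t.1)

noncomputable def WW (V : Type) [AddCommGroup V] {F : Type} [Field F] [Module F V] [Finite V] (ψ : AddChar F ℂ) : ℂ := ∑ h : (Module.End F V)ˣ, ψ (LinearMap.trace F V h.1)

theorem gauss (ψ : AddChar F ℂ) (f : K → ℂ) (hV : Module.finrank F V = Module.finrank F E) :
    ((Nat.card V : ℂ) - 1) * (∑ g : (Module.End F V)ˣ, R K f g.1 * ψ (LinearMap.trace F V g.1)) = (Nat.card (Module.End F V)ˣ : ℂ) * GE F E ψ f := by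
  have := pairG (E := E) (K := K) (V := V) f hV (fun c => ψ (- c.nextCoeff))
  simp only [← trace_next, ← trace_Mt] at this
  exact this

theorem psi_tr (ψ : AddChar F ℂ) (hψ : ∃ a : F, ψ a ≠ 1) : GE F E ψ (1 : MulChar K ℂ) = -1 := by
  have h1 : ∑ t : E, ψ (Algebra.trace F E t) = 0 := by
    have := psi_sum (ψ.compAddMonoidHom (Algebra.trace F E).toAddMonoidHom) ?_
    · exact this
    · obtain ⟨a, ha⟩ := hψ
      obtain ⟨t, ht⟩ := Algebra.trace_surjective F E a
      refine ⟨t, ?_⟩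
      show ψ (Algebra.trace F E t) ≠ 1
      rwa [ht]
  rw [← Finset.add_sum_erase _ _ (Finset.mem_univ 0)] at h1
  rw [map_zero, AddChar.map_zero_eq_one] at h1
  have h2 : GE F E ψ (1 : MulChar K ℂ) = ∑ t ∈ Finset.univ.erase (0 : E), ψ (Algebra.trace F E t) := by
    unfold GE
    refine Finset.sum_bij (fun t _ => t.1) (fun t _ => by simp) (fun a _ b _ h => Units.ext h) ?_ ?_
    · intro t ht
      exact ⟨Units.mk0 t (Finset.ne_of_mem_erase ht), Finset.mem_univ _, rfl⟩
    · intro t _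
      rw [MulChar.one_apply, one_mul]
      exact isUnit_iff_ne_zero.2 ((map_ne_zero_iff _ (algebraMap E K).injective).2 t.ne_zero)
  rw [h2]
  linear_combination h1

theorem sum_R1 (hV : Module.finrank F V = Module.finrank F E) (hM : (Nat.card V : ℂ) - 1 ≠ 0) (hVE : Nat.card V = Nat.card E) :
    ∑ g : (Module.End F V)ˣ, R K (1 : MulChar K ℂ) g.1 = (Nat.card (Module.End F V)ˣ : ℂ) := by
  have := pairG (E := E) (K := K) (V := V) (1 : MulChar K ℂ) hV (fun c => 1)
  simp only [mul_one] at this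
  apply mul_left_cancel₀ hM
  rw [this, mul_comm]
  congr 1
  have h1 : ∀ t : Eˣ, (1 : MulChar K ℂ) (algebraMap E K t.1) = 1 := fun t =>
     MulChar.one_apply (isUnit_iff_ne_zero.2 ((map_ne_zero_iff _ (algebraMap E K).injective).2 t.ne_zero))
  simp only [h1]
  rw [Finset.sum_const, Finset.card_univ, Fintype.card_units, nsmul_eq_mul, mul_one, hVE, Nat.card_eq_fintype_card]
  have : 1 ≤ Fintype.card E := Fintype.card_pos
  push_cast [this]; ring

theorem sum_TT (ψ : AddChar F ℂ) (v : Module.End F V → ℂ) : ∑ g : (Module.End F V)ˣ, TT ψ v g.1 = WW V ψ * ∑ g : (Module.End F V)ˣ, v g.1 := by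
  unfold TT WW
  rw [Finset.sum_comm, Finset.mul_sum]
  refine Finset.sum_congr rfl fun h _ => ?_
  rw [← Finset.sum_mul]
  congr 1
  exact Equiv.sum_comp (Equiv.mulRight h⁻¹) (fun x : (Module.End F V)ˣ => ψ (LinearMap.trace F V x.1))

theorem TT_one (ψ : AddChar F ℂ) (β : MulChar K ℂ) : TT ψ (R K (β⁻¹ : MulChar K ℂ)) (1 : Module.End F V) =
    ∑ g : (Module.End F V)ˣ, R K β g.1 * ψ (LinearMap.trace F V g.1) := by
  unfold TT
  rw [← Equiv.sum_comp (Equiv.inv (Module.End F V)ˣ)]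
  refine Finset.sum_congr rfl fun h _ => ?_
  show ψ (LinearMap.trace F V (1 * (h⁻¹⁻¹).1)) * R K (β⁻¹ : MulChar K ℂ) (h⁻¹).1 = _
  rw [R_minv, inv_inv, inv_inv, one_mul, mul_comm]

theorem main_eig
    (n : ℕ) [NeZero n] (hn : Module.finrank F E = n) (hV : Module.finrank F V = n)
    (p m0 : ℕ) [Fact p.Prime] (hm0 : 0 < m0) (hp : Fintype.card K = p ^ m0)
    (hK : ∀ (V : Type) [AddCommGroup V] [Module F V] [Finite V], Module.finrank F V ≤ n →
      ∀ d, d ∣ Nat.card (Module.End F V)ˣ → Nat.Coprime d p → d ∣ Fintype.card K - 1)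
    (θ : MulChar K ℂ) (hθ : ∀ y z : K, y ≠ 0 → θ y = θ z → y = z)
    (ψ : AddChar F ℂ) (hψ : ∃ a : F, ψ a ≠ 1) :
    ∃ ρ : ℂ, ρ ≠ 0 ∧ WW V ψ ≠ 0 ∧ ∀ (a k : ℕ), (TT ψ)^[k] (R K ((θ ^ a)⁻¹ : MulChar K ℂ)) (1 : Module.End F V) = ρ * (- WW V ψ * GE F E ψ (θ ^ a : MulChar K ℂ)) ^ k := by
  have hVE : Nat.card V = Nat.card E := by
    rw [Module.natCard_eq_pow_finrank (K := F) (V := V), Module.natCard_eq_pow_finrank (K := F) (V := E), hn, hV]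
  have hM0 : (Nat.card V : ℂ) - 1 ≠ 0 := by
    have : 1 < Nat.card E := Finite.one_lt_card
    rw [sub_ne_zero, hVE]
    exact_mod_cast this.ne'
  have hVn := hV.trans hn.symm
  have hN : (Nat.card (Module.End F V)ˣ : ℂ) ≠ 0 := by exact_mod_cast (Nat.card_pos).ne'
  have hew : ∀ a, _ := fun a => eig (V := V) n hn hV p m0 hm0 hp hK θ hθ ψ hψ a ((θ ^ a)⁻¹) (inv_inv _)
  choose w hw using hew
  set ρ := R K (1 : MulChar K ℂ) (1 : Module.End F V) with hρ
  have hρa : ∀ a, R K ((θ ^ a)⁻¹ : MulChar K ℂ) (1 : Module.End F V) = ρ := fun a => R_one_eq _ _ (by rw [map_one, map_one])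
  have h1 : ∀ a, ((Nat.card V : ℂ) - 1) * (w a * ρ) = (Nat.card (Module.End F V)ˣ : ℂ) * GE F E ψ (θ ^ a : MulChar K ℂ) := by
    intro a
    rw [← gauss ψ _ hVn, ← TT_one]
    congr 1
    have := hw a 1 1
    rw [pow_one, Units.val_one, hρa] at this
    exact this.symm
  have h2 : w 0 = WW V ψ := by
    have e1 := sum_TT (V := V) ψ (R K (1 : MulChar K ℂ))
    rw [sum_R1 (K := K) hVn hM0 hVE] at e1
    have e2 : ∀ g : (Module.End F V)ˣ, TT ψ (R K (1 : MulChar K ℂ)) g.1 = w 0 * R K (1 : MulChar K ℂ) g.1 := by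
      intro g
      have := hw 0 1 g
      rw [pow_one, pow_zero, inv_one] at this
      exact this
    rw [Finset.sum_congr rfl (fun g _ => e2 g), ← Finset.mul_sum, sum_R1 (K := K) hVn hM0 hVE] at e1
    exact mul_right_cancel₀ hN e1
  have h3 := h1 0
  rw [h2, pow_zero, psi_tr ψ hψ] at h3
  have h4 : ρ ≠ 0 ∧ WW V ψ ≠ 0 := by
    constructor
    · intro h; rw [h, mul_zero, mul_zero] at h3; exact hN (by linear_combination h3)
    · intro h; rw [h, zero_mul, mul_zero] at h3; exact hN (by linear_combination h3)
  refine ⟨ρ, h4.1, h4.2, fun a k => ?_⟩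
  have h5 : w a = - WW V ψ * GE F E ψ (θ ^ a : MulChar K ℂ) := by
    apply mul_right_cancel₀ h4.1
    apply mul_left_cancel₀ hM0
    rw [h1 a]
    linear_combination GE F E ψ (θ ^ a : MulChar K ℂ) * h3
  have := hw a k 1
  rw [Units.val_one, hρa, h5] at this
  rw [this]; ring

end
end KL

namespace KL

section
variable {F : Type} [Field F] {V : Type} [AddCommGroup V] [Module F V] [Finite V]

open Classical in
noncomputable def Ph {G : Type} [Group G] [Fintype G] (φ : G → ℂ) : ℕ → G → ℂ
  | 0 => fun x => if x = 1 then 1 else 0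
  | k+1 => fun x => ∑ h, φ (x * h⁻¹) * Ph φ k h

open Classical in
theorem Ph_zero {G : Type} [Group G] [Fintype G] (φ : G → ℂ) (x : G) : Ph φ 0 x = if x = 1 then 1 else 0 := rfl

theorem Ph_class {G : Type} [Group G] [Fintype G] (φ : G → ℂ) (hφ : IsClass φ) (k : ℕ) : IsClass (Ph φ k) := by
  induction k with
  | zero =>
    intro g h
    rw [Ph_zero, Ph_zero]
    by_cases hg : g = 1
    · rw [if_pos hg, if_pos]; rw [hg]; group
    · rw [if_neg hg, if_neg]; rwa [conj_eq_one_iff]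
  | succ k ih =>
    intro g h
    show ∑ y, φ (h * g * h⁻¹ * y⁻¹) * Ph φ k y = ∑ y, φ (g * y⁻¹) * Ph φ k y
    rw [← Equiv.sum_comp (MulAut.conj h).toEquiv (fun y => φ (h * g * h⁻¹ * y⁻¹) * Ph φ k y)]
    refine Finset.sum_congr rfl fun y _ => ?_
    show φ (h * g * h⁻¹ * (h * y * h⁻¹)⁻¹) * Ph φ k (h * y * h⁻¹) = _
    rw [ih, ← hφ (g * y⁻¹) h]
    congr 2
    group

theorem Ph_one {G : Type} [Group G] [Fintype G] (φ : G → ℂ) (x : G) : Ph φ 1 x = φ x := by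
  classical
  show ∑ h, φ (x * h⁻¹) * (if h = 1 then (1 : ℂ) else 0) = _
  rw [Finset.sum_eq_single 1]
  · simp
  · intro b _ hb; simp [hb]
  · simp

theorem TT_iter (ψ : AddChar F ℂ) (v : Module.End F V → ℂ) (k : ℕ) : ∀ (x : (Module.End F V)ˣ),
    (TT ψ)^[k] v x.1 = ∑ h : (Module.End F V)ˣ, Ph (fun g : (Module.End F V)ˣ => ψ (LinearMap.trace F V g.1)) k (x * h⁻¹) * v h.1 := by
  induction k with
  | zero =>
    intro x
    classical
    simp only [Ph_zero]
    show v x.1 = _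
    rw [Finset.sum_eq_single x]
    · simp
    · intro b _ hb
      rw [if_neg, zero_mul]
      rw [mul_inv_eq_one]; exact Ne.symm hb
    · simp
  | succ k ih =>
    intro x
    rw [Function.iterate_succ_apply']
    show ∑ y : (Module.End F V)ˣ, ψ (LinearMap.trace F V (x.1 * (y⁻¹).1)) * (TT ψ)^[k] v y.1 = ∑ h : (Module.End F V)ˣ, (∑ z : (Module.End F V)ˣ, ψ (LinearMap.trace F V (x * h⁻¹ * z⁻¹).1) * Ph (fun g : (Module.End F V)ˣ => ψ (LinearMap.trace F V g.1)) k z) * v h.1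
    simp only [ih, Finset.mul_sum, Finset.sum_mul]
    rw [Finset.sum_comm]
    refine Finset.sum_congr rfl fun h _ => ?_
    rw [← Equiv.sum_comp (Equiv.mulRight h)]
    refine Finset.sum_congr rfl fun z _ => ?_
    show ψ (LinearMap.trace F V (x.1 * ((z * h)⁻¹).1)) * (Ph _ k (z * h * h⁻¹) * v h.1) = _
    rw [mul_inv_cancel_right, mul_inv_rev, ← mul_assoc, mul_assoc x]
    rfl

theorem cyc_irr (g : Module.End F V) (hg : Irreducible g.charpoly) (w : V) (hw : w ≠ 0) : cyc g w = ⊤ := by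
  classical
  haveI : Module.Finite F V := Module.Finite.of_finite
  set W := cyc g w with hW
  have h := cyc_stab g w
  rw [← hW] at h
  have hb : W ≠ ⊥ := fun h => hw ((cyc_bot g w).1 h)
  have h1 := charpoly_mul W g h
  rw [h1] at hg
  rcases hg.isUnit_or_isUnit rfl with h2 | h2
  · have := (LinearMap.charpoly_monic (g.restrict h)).eq_one_of_isUnit h2
    have h3 := LinearMap.charpoly_natDegree (g.restrict h)
    rw [this, Polynomial.natDegree_one] at h3
    exact absurd (Submodule.finrank_eq_zero.1 h3.symm) hb
  · have := (LinearMap.charpoly_monic (W.mapQ W g h)).eq_one_of_isUnit h2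
    have h3 := LinearMap.charpoly_natDegree (W.mapQ W g h)
    rw [this, Polynomial.natDegree_one] at h3
    have h4 := Submodule.finrank_quotient_add_finrank W
    apply Submodule.eq_top_of_finrank_eq
    omega

theorem conj_irr (g g' : Module.End F V) (hg : Irreducible g.charpoly) (h : g'.charpoly = g.charpoly) : ∃ x : (Module.End F V)ˣ, g' = x.1 * g * (x⁻¹).1 := by
  haveI : Module.Finite F V := Module.Finite.of_finite
  have hd := LinearMap.charpoly_natDegree g
  have hpos := hg.natDegree_pos
  rw [hd] at hpos
  haveI : Nontrivial V := Module.finrank_pos_iff.1 hpos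
  obtain ⟨w, hw⟩ := exists_ne (0 : V)
  have hm := LinearMap.charpoly_monic g
  obtain ⟨c, hc⟩ : ∃ c, g.charpoly = c := ⟨_, rfl⟩
  have hci := cyc_irr g hg w hw
  have hci' := cyc_irr g' (h ▸ hg) w hw
  rw [hc] at hd hm h
  obtain ⟨e, he⟩ := (pairEquiv c hm hd).surjective ⟨(g, w), hc, hci⟩
  obtain ⟨e', he'⟩ := (pairEquiv c hm hd).surjective ⟨(g', w), h, hci'⟩
  have h1 : e.conj (mulRoot c) = g := congrArg (fun z => z.1.1) he
  have h2 : e'.conj (mulRoot c) = g' := congrArg (fun z => z.1.1) he'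
  refine ⟨LinearMap.GeneralLinearGroup.ofLinearEquiv (e.symm.trans e'), ?_⟩
  refine LinearMap.ext fun y => ?_
  conv_lhs => rw [← h2]
  conv_rhs => rw [← h1]
  show e' (mulRoot _ (e'.symm y)) = e' (e.symm (e (mulRoot _ (e.symm (e (e'.symm y))))))
  rw [e.symm_apply_apply, e.symm_apply_apply]

end
end KL

namespace KL

open Classical in
theorem fourier {K : Type} [Field K] [Fintype K] (θ : MulChar K ℂ) (hθ : ∀ y z : K, y ≠ 0 → θ y = θ z → y = z) (ξ y : K) (hξ : ξ ≠ 0) :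
    ∑ a ∈ Finset.range (Fintype.card K - 1), (((Fintype.card K - 1 : ℕ) : ℂ)⁻¹ * ((θ ^ a) ξ)⁻¹) * (θ ^ a) y = if y = ξ then 1 else 0 := by
  have hL : Fintype.card K - 1 ≠ 0 := by have : 1 < Fintype.card K := Fintype.one_lt_card; omega
  have hpow : ∀ (y : K), y ≠ 0 → ∀ a, (θ ^ a) y = θ y ^ a := by
    intro y hy a
    obtain ⟨u, rfl⟩ := isUnit_iff_ne_zero.2 hy
    rw [MulChar.pow_apply_coe]
  have h1 : ∀ y : K, y ≠ 0 → θ y ^ (Fintype.card K - 1) = 1 := by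
    intro y hy
    rw [← map_pow, FiniteField.pow_card_sub_one_eq_one _ hy, map_one]
  have hnz : ∀ y : K, y ≠ 0 → θ y ≠ 0 := by
    intro y hy h
    have := h1 y hy
    rw [h, zero_pow hL] at this
    exact zero_ne_one this
  by_cases hy : y = 0
  · subst hy
    rw [if_neg (Ne.symm hξ)]
    refine Finset.sum_eq_zero fun a _ => ?_
    rw [MulChar.map_zero, mul_zero]
  · have e : ∀ a ∈ Finset.range (Fintype.card K - 1), (((Fintype.card K - 1 : ℕ) : ℂ)⁻¹ * ((θ ^ a) ξ)⁻¹) * (θ ^ a) y = ((Fintype.card K - 1 : ℕ) : ℂ)⁻¹ * (θ y / θ ξ) ^ a := by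
      intro a _
      rw [hpow _ hy, hpow _ hξ, div_pow]
      field_simp
    rw [Finset.sum_congr rfl e, ← Finset.mul_sum]
    split_ifs with h
    · rw [h, div_self (hnz ξ hξ)]
      simp only [one_pow, Finset.sum_const, Finset.card_range, nsmul_eq_mul, mul_one]
      exact inv_mul_cancel₀ (by exact_mod_cast hL)
    · have hne : θ y / θ ξ ≠ 1 := by
        rw [Ne, div_eq_one_iff_eq (hnz ξ hξ)]
        exact fun h' => h (hθ _ _ hy h')
      rw [geom_sum_eq hne, div_pow, h1 y hy, h1 ξ hξ]
      simp

noncomputable def Kl (F : Type) [Field F] {E : Type} [Field E] [Fintype E] [DecidableEq E] [Algebra F E] (ψ : AddChar F ℂ) (k : ℕ) (ξ : E) : ℂ :=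
  ∑ t : Fin k → Eˣ, if ((∏ i, t i : Eˣ) : E) = ξ then ψ (Algebra.trace F E (∑ i, (t i : E))) else 0

section
variable {F : Type} [Field F] [Finite F] {E : Type} [Field E] [Fintype E] [DecidableEq E] [Algebra F E]
variable {K : Type} [Field K] [Fintype K] [Algebra F K] [Algebra E K] [IsScalarTower F E K]
variable {V : Type} [AddCommGroup V] [Module F V] [Finite V]

theorem psi_sum_prod (ψ : AddChar F ℂ) {ι : Type} (s : Finset ι) (f : ι → F) : ψ (∑ i ∈ s, f i) = ∏ i ∈ s, ψ (f i) := by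
  classical
  induction s using Finset.induction_on with
  | empty => simp
  | insert a s ha ih => rw [Finset.sum_insert ha, Finset.prod_insert ha, AddChar.map_add_eq_mul, ih]

theorem GE_pow (ψ : AddChar F ℂ) (β : MulChar K ℂ) (k : ℕ) : GE F E ψ β ^ k =
    ∑ t : Fin k → Eˣ, β (algebraMap E K ((∏ i, t i : Eˣ) : E)) * ψ (Algebra.trace F E (∑ i, (t i : E))) := by
  unfold GE
  rw [← Fin.prod_const, Finset.prod_univ_sum, Fintype.piFinset_univ]
  refine Finset.sum_congr rfl fun t _ => ?_
  rw [Finset.prod_mul_distrib, map_sum, psi_sum_prod, Units.coe_prod, map_prod, map_prod]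

theorem Kl_one (ψ : AddChar F ℂ) (ξ : E) (hξ : ξ ≠ 0) : Kl F ψ 1 ξ = ψ (Algebra.trace F E ξ) := by
  unfold Kl
  rw [Finset.sum_eq_single (fun _ => Units.mk0 ξ hξ)]
  · simp
  · intro t _ h
    rw [if_neg]
    intro h'
    apply h
    funext i
    apply Units.ext
    rw [Subsingleton.elim i 0]
    simpa using h'
  · simp

open Classical in
theorem R_ind (x : Module.End F V) (hx : Irreducible x.charpoly) (ξ : K) (hξ : Polynomial.aeval ξ x.charpoly = 0) (h : Module.End F V) :
    R K (fun y => if y = ξ then (1 : ℂ) else 0) h = if h.charpoly = x.charpoly then 1 else 0 := by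
  haveI : Module.Finite F V := Module.Finite.of_finite
  have hmin : x.charpoly = minpoly F ξ := minpoly.eq_of_irreducible_of_monic hx hξ (LinearMap.charpoly_monic x)
  split_ifs with hh
  · rw [R_irr _ _ (hh ▸ hx), bF, hh, Finset.sum_multiset_map_count]
    have hne : x.charpoly ≠ 0 := hx.ne_zero
    have hmem : ξ ∈ x.charpoly.aroots K := by rw [Polynomial.mem_aroots]; exact ⟨hne, hξ⟩
    rw [Finset.sum_eq_single ξ]
    · have hsep : x.charpoly.Separable := PerfectField.separable_of_irreducible hx
      have hnd : (x.charpoly.aroots K).Nodup := Polynomial.nodup_roots hsep.map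
      rw [if_pos rfl, Multiset.count_eq_one_of_mem hnd hmem, one_smul]
    · intro b _ hb; rw [if_neg hb, smul_zero]
    · intro h'; exact absurd (Multiset.mem_toFinset.2 hmem) h'
  · refine R_vanish _ _ V h fun y hy => ?_
    rw [if_neg]
    rintro rfl
    apply hh
    have hd : x.charpoly ∣ h.charpoly := by rw [hmin]; exact minpoly.dvd F y hy
    refine (Polynomial.eq_of_monic_of_dvd_of_natDegree_le (LinearMap.charpoly_monic x) (LinearMap.charpoly_monic h) hd ?_)
    rw [LinearMap.charpoly_natDegree, LinearMap.charpoly_natDegree]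

end
end KL

namespace KL

theorem final_End {F : Type} [Field F] [Finite F] {E : Type} [Field E] [Fintype E] [DecidableEq E] [Algebra F E]
    {K : Type} [Field K] [Fintype K] [Algebra F K] [Algebra E K] [IsScalarTower F E K]
    {V : Type} [AddCommGroup V] [Module F V] [Finite V]
    (n : ℕ) [NeZero n] (hn : Module.finrank F E = n) (hV : Module.finrank F V = n)
    (p m0 : ℕ) [Fact p.Prime] (hm0 : 0 < m0) (hp : Fintype.card K = p ^ m0)
    (hK : ∀ (V : Type) [AddCommGroup V] [Module F V] [Finite V], Module.finrank F V ≤ n →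
      ∀ d, d ∣ Nat.card (Module.End F V)ˣ → Nat.Coprime d p → d ∣ Fintype.card K - 1)
    (θ : MulChar K ℂ) (hθ : ∀ y z : K, y ≠ 0 → θ y = θ z → y = z)
    (ψ : AddChar F ℂ) (hψ : ∃ a : F, ψ a ≠ 1)
    (x : (Module.End F V)ˣ) (hx : Irreducible x.1.charpoly) (ξ : E) (hξ : Polynomial.aeval ξ x.1.charpoly = 0) (k : ℕ) :
    Ph (fun g : (Module.End F V)ˣ => ψ (LinearMap.trace F V g.1)) (k + 1) x = (- WW V ψ) ^ k * Kl F ψ (k + 1) ξ := by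
  classical
  obtain ⟨ρ, hρ, hW, hmain⟩ := main_eig (E := E) (V := V) n hn hV p m0 hm0 hp hK θ hθ ψ hψ
  set φ : (Module.End F V)ˣ → ℂ := fun g : (Module.End F V)ˣ => ψ (LinearMap.trace F V g.1) with hφ
  have hcl : IsClass φ := by
    intro g h
    show ψ (LinearMap.trace F V (h.1 * g.1 * (h⁻¹).1)) = _
    rw [LinearMap.trace_mul_comm, ← mul_assoc]
    rw [show (h⁻¹).1 * h.1 = 1 from h.inv_mul, one_mul]
  have hmin : x.1.charpoly = minpoly F ξ := by
    haveI : Module.Finite F V := Module.Finite.of_finite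
    exact minpoly.eq_of_irreducible_of_monic hx hξ (LinearMap.charpoly_monic x.1)
  have hMt : Mt F ξ = x.1.charpoly := by
    haveI : Module.Finite F V := Module.Finite.of_finite
    have hnp : 0 < n := NeZero.pos n
    rw [Mt, ← hmin, LinearMap.charpoly_natDegree, hn, hV, Nat.div_self hnp, pow_one]
  have hξ0 : ξ ≠ 0 := by
    intro h
    rw [h] at hξ
    have h1 := (unit_iff x.1).1 x.isUnit
    rw [Polynomial.aeval_def, Polynomial.eval₂_at_zero] at hξ
    rw [map_eq_zero_iff _ (algebraMap F E).injective] at hξ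
    exact h1 hξ
  have hξK : algebraMap E K ξ ≠ 0 := (map_ne_zero_iff _ (algebraMap E K).injective).2 hξ0
  have hξK' : Polynomial.aeval (algebraMap E K ξ) x.1.charpoly = 0 := by
    rw [Polynomial.aeval_algebraMap_apply, hξ, map_zero]
  -- pairing with characters
  have h1 : ∀ a k, ∑ h : (Module.End F V)ˣ, Ph φ k h * R K (θ ^ a : MulChar K ℂ) h.1 = ρ * (- WW V ψ * GE F E ψ (θ ^ a : MulChar K ℂ)) ^ k := by
    intro a k
    rw [← hmain a k, ← Units.val_one, TT_iter]
    rw [← Equiv.sum_comp (Equiv.inv (Module.End F V)ˣ)]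
    refine Finset.sum_congr rfl fun h _ => ?_
    show Ph φ k h⁻¹ * R K (θ ^ a : MulChar K ℂ) (h⁻¹).1 = Ph φ k (1 * h⁻¹) * _
    rw [R_minv, one_mul]
  have h2 : ∀ k, ∑ h : (Module.End F V)ˣ, Ph φ k h * (if h.1.charpoly = x.1.charpoly then 1 else 0) = ρ * (- WW V ψ) ^ k * Kl F ψ k ξ := by
    intro k
    have e1 : ∀ h : (Module.End F V)ˣ, (if h.1.charpoly = x.1.charpoly then (1 : ℂ) else 0) =
        ∑ a ∈ Finset.range (Fintype.card K - 1), (((Fintype.card K - 1 : ℕ) : ℂ)⁻¹ * ((θ ^ a) (algebraMap E K ξ))⁻¹) * R K (θ ^ a : MulChar K ℂ) h.1 := by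
      intro h
      rw [← R_ind x.1 hx (algebraMap E K ξ) hξK' h.1, ← R_lin]
      congr 1
      funext y
      rw [fourier θ hθ _ y hξK]
    simp only [e1, Finset.mul_sum]
    rw [Finset.sum_comm]
    have e2 : ∀ a ∈ Finset.range (Fintype.card K - 1), ∑ h : (Module.End F V)ˣ, Ph φ k h * ((((Fintype.card K - 1 : ℕ) : ℂ)⁻¹ * ((θ ^ a) (algebraMap E K ξ))⁻¹) * R K (θ ^ a : MulChar K ℂ) h.1) =
       ∑ t : Fin k → Eˣ, ρ * (- WW V ψ) ^ k * (((((Fintype.card K - 1 : ℕ) : ℂ)⁻¹ * ((θ ^ a) (algebraMap E K ξ))⁻¹) * (θ ^ a) (algebraMap E K ((∏ i, t i : Eˣ) : E))) * ψ (Algebra.trace F E (∑ i, (t i : E)))) := by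
      intro a _
      have : ∀ h : (Module.End F V)ˣ, Ph φ k h * ((((Fintype.card K - 1 : ℕ) : ℂ)⁻¹ * ((θ ^ a) (algebraMap E K ξ))⁻¹) * R K (θ ^ a : MulChar K ℂ) h.1) =
         (((Fintype.card K - 1 : ℕ) : ℂ)⁻¹ * ((θ ^ a) (algebraMap E K ξ))⁻¹) * (Ph φ k h * R K (θ ^ a : MulChar K ℂ) h.1) := fun h => by ring
      rw [Finset.sum_congr rfl (fun h _ => this h), ← Finset.mul_sum, h1, mul_pow, GE_pow]
      simp only [Finset.mul_sum]
      refine Finset.sum_congr rfl fun t _ => ?_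
      ring
    rw [Finset.sum_congr rfl e2, Finset.sum_comm, Kl, Finset.mul_sum]
    refine Finset.sum_congr rfl fun t _ => ?_
    rw [← Finset.mul_sum, ← Finset.sum_mul, fourier θ hθ _ _ hξK]
    congr 1
    by_cases ht : ((∏ i, t i : Eˣ) : E) = ξ
    · rw [if_pos ht, if_pos (congrArg _ ht), one_mul]
    · rw [if_neg ht, if_neg (fun h => ht ((algebraMap E K).injective h)), zero_mul]
  -- class constancy
  have h3 : ∀ k, ∑ h : (Module.End F V)ˣ, Ph φ k h * (if h.1.charpoly = x.1.charpoly then 1 else 0) = (∑ h : (Module.End F V)ˣ, if h.1.charpoly = x.1.charpoly then (1 : ℂ) else 0) * Ph φ k x := by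
    intro k
    rw [Finset.sum_mul]
    refine Finset.sum_congr rfl fun h _ => ?_
    split_ifs with hh
    · rw [mul_one, one_mul]
      obtain ⟨y, hy⟩ := conj_irr x.1 h.1 hx hh
      have : h = y * x * y⁻¹ := Units.ext hy
      rw [this]
      exact Ph_class φ hcl k x y
    · rw [mul_zero, zero_mul]
  simp only [h3] at h2
  have h4 := h2 1
  rw [Ph_one, Kl_one ψ ξ hξ0, pow_one, trace_Mt, hMt, ← trace_next] at h4
  have hnz : ψ (LinearMap.trace F V x.1) ≠ 0 := by
    intro h
    have := AddChar.map_add_eq_mul ψ (LinearMap.trace F V x.1) (- LinearMap.trace F V x.1)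
    rw [add_neg_cancel, AddChar.map_zero_eq_one, h, zero_mul] at this
    exact one_ne_zero this
  have h5 := mul_right_cancel₀ hnz h4
  have h6 := h2 (k + 1)
  rw [h5] at h6
  have h7 : ρ * - WW V ψ ≠ 0 := mul_ne_zero hρ (neg_ne_zero.2 hW)
  apply mul_left_cancel₀ h7
  rw [h6, pow_succ]
  ring

end KL

namespace KL

theorem card_units_dvd {F V : Type} [Field F] [Finite F] [AddCommGroup V] [Module F V] [Finite V] (p : ℕ) (n : ℕ)
    (hp : ∃ m, Nat.card F = p ^ m)
    (hV : Module.finrank F V ≤ n) (d : ℕ) (hd : d ∣ Nat.card (Module.End F V)ˣ) (hc : Nat.Coprime d p) :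
    d ∣ ∏ j ∈ Finset.range n, (Nat.card F ^ (j + 1) - 1) := by
  classical
  haveI : Module.Finite F V := Module.Finite.of_finite
  haveI := Fintype.ofFinite F
  obtain ⟨m, hm⟩ := hp
  set q := Nat.card F with hq
  set r := Module.finrank F V with hr
  have h1 : Nat.card (Module.End F V)ˣ = ∏ i : Fin r, (q ^ r - q ^ (i : ℕ)) := by
    have := Matrix.card_GL_field (𝔽 := F) r
    rw [← Nat.card_eq_fintype_card] at this
    rw [← this]
    exact Nat.card_congr (Units.mapEquiv (LinearMap.toMatrixAlgEquiv (Module.finBasis F V)).toMulEquiv).toEquiv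
  rw [h1, Fin.prod_univ_eq_prod_range (fun i => q ^ r - q ^ i) r] at hd
  have h2 : ∏ i ∈ Finset.range r, (q ^ r - q ^ i) = (∏ i ∈ Finset.range r, q ^ i) * ∏ j ∈ Finset.range r, (q ^ (j + 1) - 1) := by
    rw [← Finset.prod_range_reflect (fun j => q ^ (j + 1) - 1), ← Finset.prod_mul_distrib]
    refine Finset.prod_congr rfl fun i hi => ?_
    rw [Finset.mem_range] at hi
    rw [Nat.mul_sub, mul_one, ← pow_add]
    congr 2; omega
  rw [h2] at hd
  have h3 : Nat.Coprime d (∏ i ∈ Finset.range r, q ^ i) := by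
    apply Nat.Coprime.prod_right
    intro i _
    rw [hm]
    exact (hc.pow_right _).pow_right _
  refine (h3.dvd_of_dvd_mul_left hd).trans ?_
  exact Finset.prod_dvd_prod_of_subset _ _ _ (Finset.range_mono hV)

theorem exists_theta (K : Type) [Field K] [Fintype K] : ∃ θ : MulChar K ℂ, ∀ y z : K, y ≠ 0 → θ y = θ z → y = z := by
  classical
  have hL : Fintype.card K - 1 ≠ 0 := by have : 1 < Fintype.card K := Fintype.one_lt_card; omega
  obtain ⟨θ, hθ⟩ := MulChar.exists_mulChar_orderOf K (dvd_refl (Fintype.card K - 1)) (Complex.isPrimitiveRoot_exp _ hL)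
  refine ⟨θ, ?_⟩
  have key : ∀ u : Kˣ, θ u.1 = 1 → u = 1 := by
    intro u hu
    obtain ⟨g, hg⟩ := IsCyclic.exists_generator (α := Kˣ)
    obtain ⟨j, rfl⟩ := (Submonoid.mem_powers_iff _ _).1 ((mem_powers_iff_mem_zpowers).2 (hg u))
    have h1 : θ ^ j = 1 := by
      ext v
      obtain ⟨i, rfl⟩ := (Submonoid.mem_powers_iff _ _).1 ((mem_powers_iff_mem_zpowers).2 (hg v))
      rw [MulChar.pow_apply_coe, MulChar.one_apply_coe, Units.val_pow_eq_pow_val, map_pow, ← pow_mul, mul_comm, pow_mul, ← map_pow, ← Units.val_pow_eq_pow_val, hu, one_pow]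
    have h2 := orderOf_dvd_of_pow_eq_one h1
    rw [hθ, ← Fintype.card_units] at h2
    exact orderOf_dvd_iff_pow_eq_one.1 ((orderOf_dvd_card).trans h2)
  intro y z hy h
  have hz : z ≠ 0 := by
    rintro rfl
    rw [MulChar.map_zero] at h
    obtain ⟨u, rfl⟩ := isUnit_iff_ne_zero.2 hy
    have : IsUnit (θ u.1) := u.isUnit.map θ
    rw [h] at this
    exact not_isUnit_zero this
  have := key (Units.mk0 y hy * (Units.mk0 z hz)⁻¹) ?_
  · have h3 := mul_inv_eq_one.1 this
    exact congrArg Units.val h3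
  · have hz' : IsUnit (θ z) := (isUnit_iff_ne_zero.2 hz).map θ
    apply hz'.mul_right_cancel
    rw [← map_mul, one_mul]
    have : ((Units.mk0 y hy * (Units.mk0 z hz)⁻¹ : Kˣ) : K) * z = y := by
      simp [hz]
    rw [this, h]

theorem exists_K {F : Type} [Field F] [Finite F] (E : Type) [Field E] [Fintype E] [Algebra F E] (n : ℕ) (hn : 0 < n) (hE : Module.finrank F E = n) :
    ∃ (K : Type) (_ : Field K) (_ : Fintype K) (_ : Algebra F K) (_ : Algebra E K) (_ : IsScalarTower F E K) (p m0 : ℕ) (_ : Fact p.Prime), 0 < m0 ∧ Fintype.card K = p ^ m0 ∧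
    (∀ (V : Type) [AddCommGroup V] [Module F V] [Finite V], Module.finrank F V ≤ n →
      ∀ d, d ∣ Nat.card (Module.End F V)ˣ → Nat.Coprime d p → d ∣ Fintype.card K - 1) := by
  classical
  haveI := Fintype.ofFinite F
  obtain ⟨p, hpF⟩ := CharP.exists F
  haveI := hpF
  obtain ⟨mF, hpp, hcF⟩ := FiniteField.card F p
  haveI : Fact p.Prime := ⟨hpp⟩
  haveI : CharP E p := charP_of_injective_algebraMap (algebraMap F E).injective p
  set q := Nat.card F with hq
  have hq1 : 1 < q := Finite.one_lt_card
  set P := ∏ j ∈ Finset.range n, (q ^ (j + 1) - 1) with hP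
  have hpos : 0 < P := by
    refine Finset.prod_pos fun j _ => ?_
    have : 1 < q ^ (j + 1) := Nat.one_lt_pow (Nat.succ_ne_zero j) hq1
    omega
  have hcop : Nat.Coprime q P := by
    apply Nat.Coprime.prod_right
    intro j _
    have h1 : 1 ≤ q ^ (j + 1) := Nat.one_le_pow _ _ (by omega)
    have h2 : Nat.Coprime (q ^ (j+1)) (q ^ (j+1) - 1) := (Nat.coprime_self_sub_right h1).2 (Nat.coprime_one_right _)
    exact Nat.Coprime.coprime_dvd_left (dvd_pow_self q (Nat.succ_ne_zero j)) h2
  haveI : NeZero (Nat.totient P) := ⟨(Nat.totient_pos.2 hpos).ne'⟩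
  let K := FiniteField.Extension E p (Nat.totient P)
  letI : Algebra F K := ((algebraMap E K).comp (algebraMap F E)).toAlgebra
  haveI : IsScalarTower F E K := IsScalarTower.of_algebraMap_eq' rfl
  haveI : Finite K := inferInstance
  letI : Fintype K := Fintype.ofFinite K
  haveI : CharP K p := charP_of_injective_algebraMap (algebraMap F K).injective p
  obtain ⟨m0, _, hcK⟩ := FiniteField.card K p
  refine ⟨K, inferInstance, inferInstance, inferInstance, inferInstance, inferInstance, p, m0, inferInstance, m0.2, hcK, ?_⟩
  intro V _ _ _ hV d hd hc
  refine (card_units_dvd p n ⟨mF, by rw [Nat.card_eq_fintype_card, hcF]⟩ hV d hd hc).trans ?_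
  have h1 : Fintype.card K = (q ^ n) ^ (Nat.totient P) := by
    rw [← Nat.card_eq_fintype_card, FiniteField.natCard_extension, Module.natCard_eq_pow_finrank (K := F) (V := E), hE]
  rw [h1]
  have h2 := Nat.ModEq.pow_totient (hcop.pow_left n)
  exact (Nat.modEq_iff_dvd' (Nat.one_le_pow _ _ (by positivity))).1 h2.symm

end KL

namespace KL

open Classical in
theorem Ph_sum {G : Type} [Group G] [Fintype G] (φ : G → ℂ) (k : ℕ) : ∀ x : G,
    Ph φ k x = ∑ g : Fin k → G, if (List.ofFn g).prod = x then ∏ i, φ (g i) else 0 := by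
  induction k with
  | zero =>
    intro x
    rw [Ph_zero, Fintype.sum_unique]
    simp [eq_comm]
  | succ k ih =>
    intro x
    show ∑ h, φ (x * h⁻¹) * Ph φ k h = _
    rw [← Equiv.sum_comp (Fin.consEquiv (fun _ : Fin (k+1) => G)) (fun g : Fin (k+1) → G => if (List.ofFn g).prod = x then ∏ i, φ (g i) else 0)]
    rw [Fintype.sum_prod_type, Finset.sum_comm]
    simp only [ih, Finset.mul_sum]
    rw [Finset.sum_comm]
    refine Finset.sum_congr rfl fun g _ => ?_
    rw [Finset.sum_eq_single (List.ofFn g).prod, Finset.sum_eq_single (x * ((List.ofFn g).prod)⁻¹)]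
    · simp [Fin.consEquiv, Fin.prod_univ_succ, List.ofFn_succ]
    · intro b _ hb
      rw [if_neg]
      intro h
      apply hb
      simp [Fin.consEquiv, List.ofFn_succ] at h
      rw [← h]; group
    · simp
    · intro b _ hb
      rw [if_neg (Ne.symm hb), mul_zero]
    · simp

theorem Ph_equiv {G H : Type} [Group G] [Fintype G] [Group H] [Fintype H] (e : G ≃* H) (φ : H → ℂ) (k : ℕ) : ∀ x : G,
    Ph φ k (e x) = Ph (fun g => φ (e g)) k x := by
  induction k with
  | zero =>
    intro x
    rw [Ph_zero, Ph_zero]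
    by_cases h : x = 1
    · rw [if_pos h, if_pos (by simp [h])]
    · rw [if_neg h, if_neg (by simpa using h)]
  | succ k ih =>
    intro x
    show ∑ h, φ (e x * h⁻¹) * Ph φ k h = ∑ h, φ (e (x * h⁻¹)) * Ph (fun g => φ (e g)) k h
    rw [← Equiv.sum_comp e.toEquiv (fun h => φ (e x * h⁻¹) * Ph φ k h)]
    refine Finset.sum_congr rfl fun y _ => ?_
    show φ (e x * (e y)⁻¹) * Ph φ k (e y) = _
    rw [ih, map_mul, map_inv]

noncomputable def glE (F : Type) [Field F] (n : ℕ) : (Matrix (Fin n) (Fin n) F)ˣ ≃* (Module.End F (Fin n → F))ˣ :=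
  Units.mapEquiv (Matrix.toLinAlgEquiv' (R := F) (n := Fin n)).toRingEquiv.toMulEquiv

theorem glE_val {F : Type} [Field F] {n : ℕ} (g : (Matrix (Fin n) (Fin n) F)ˣ) : (glE F n g).1 = Matrix.toLin' g.1 := rfl

theorem glE_trace {F : Type} [Field F] {n : ℕ} (g : (Matrix (Fin n) (Fin n) F)ˣ) : LinearMap.trace F (Fin n → F) (glE F n g).1 = g.1.trace := by
  rw [glE_val, Matrix.trace_toLin'_eq]

theorem glE_charpoly {F : Type} [Field F] {n : ℕ} (g : (Matrix (Fin n) (Fin n) F)ˣ) : (glE F n g).1.charpoly = g.1.charpoly := by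
  rw [glE_val, Matrix.charpoly_toLin']

theorem WW_val {F : Type} [Field F] [Fintype F] [DecidableEq F] (ψ : AddChar F ℂ) (hψ : ∃ a, ψ a ≠ 1) (n : ℕ) :
    WW (Fin n → F) ψ = (-1) ^ n * (Fintype.card F : ℂ) ^ (n * (n - 1) / 2) := by
  classical
  rw [← SW_val ψ hψ n (Fin n) (Fintype.card_fin n)]
  unfold WW SW
  rw [← Equiv.sum_comp (glE F n).toEquiv (fun h : (Module.End F (Fin n → F))ˣ => ψ (LinearMap.trace F (Fin n → F) h.1)), ← Finset.sum_filter]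
  refine Finset.sum_bij (fun (g : (Matrix (Fin n) (Fin n) F)ˣ) _ => g.1) ?_ ?_ ?_ ?_
  · intro g _
    rw [Finset.mem_filter]
    exact ⟨Finset.mem_univ _, ((Matrix.isUnit_iff_isUnit_det _).1 g.isUnit).ne_zero⟩
  · intro a _ b _ h
    exact Units.ext h
  · intro b hb
    rw [Finset.mem_filter] at hb
    obtain ⟨u, hu⟩ := (Matrix.isUnit_iff_isUnit_det b).2 (isUnit_iff_ne_zero.2 hb.2)
    exact ⟨u, Finset.mem_univ _, hu⟩
  · intro g _
    show ψ (LinearMap.trace F (Fin n → F) (glE F n g).1) = _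
    rw [glE_trace]

end KL

theorem matrix_kloosterman_regular_elliptic_untwisted
    {F : Type} [Field F] [Fintype F] [DecidableEq F]
    (ψ : AddChar F ℂ) (hψ : ∃ a : F, ψ a ≠ 1)
    {n k : ℕ} (hk : 1 < k)
    (x : (Matrix (Fin n) (Fin n) F)ˣ)
    (hx : Irreducible (Matrix.charpoly (x : Matrix (Fin n) (Fin n) F)))
    (E : Type) [Field E] [Fintype E] [DecidableEq E] [Algebra F E]
    (hE : Module.finrank F E = n)
    (ξ : E)
    (hξ : Polynomial.aeval ξ (Matrix.charpoly (x : Matrix (Fin n) (Fin n) F)) = 0) :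
    (∑ g : Fin k → (Matrix (Fin n) (Fin n) F)ˣ,
      if ((List.ofFn g).prod : Matrix (Fin n) (Fin n) F) = (x : Matrix (Fin n) (Fin n) F) then
        ψ (Matrix.trace (∑ i, ((g i : Matrix (Fin n) (Fin n) F))))
      else 0)
    = (-1 : ℂ) ^ ((k - 1) * (n + 1)) *
        (Fintype.card F : ℂ) ^ ((k - 1) * (n * (n - 1) / 2)) *
        ∑ t : Fin k → Eˣ,
          if ((∏ i, t i : Eˣ) : E) = ξ then
            ψ (Algebra.trace F E (∑ i, (t i : E)))
          else 0 := by
  classical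
  have hn : 0 < n := by
    have h := hx.natDegree_pos
    rwa [Matrix.charpoly_natDegree_eq_dim, Fintype.card_fin] at h
  haveI : NeZero n := ⟨hn.ne'⟩
  obtain ⟨k, rfl⟩ : ∃ j, k = j + 1 := ⟨k - 1, by omega⟩
  obtain ⟨K, i1, i2, i3, i4, i5, p, m0, i6, hm0, hp, hK⟩ := KL.exists_K (F := F) E n hn hE
  obtain ⟨θ, hθ⟩ := KL.exists_theta K
  have main := KL.final_End (F := F) (E := E) (K := K) (V := Fin n → F) n hE (by simp) p m0 hm0 hp hK θ hθ ψ hψ (KL.glE F n x)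
    (by rw [KL.glE_charpoly]; exact hx) ξ (by rw [KL.glE_charpoly]; exact hξ) k
  rw [KL.Ph_equiv, KL.WW_val ψ hψ, KL.Ph_sum] at main
  have e1 : (-((-1 : ℂ) ^ n * (Fintype.card F : ℂ) ^ (n * (n - 1) / 2))) ^ k = (-1 : ℂ) ^ ((k + 1 - 1) * (n + 1)) *
        (Fintype.card F : ℂ) ^ ((k + 1 - 1) * (n * (n - 1) / 2)) := by
    rw [Nat.add_sub_cancel, mul_comm k (n+1), mul_comm k (n * (n - 1) / 2), pow_mul, pow_mul, ← mul_pow, pow_succ]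
    congr 1
    ring
  rw [e1] at main
  refine Eq.trans ?_ main
  refine Finset.sum_congr rfl fun g _ => ?_
  have e2 : ψ (Matrix.trace (∑ i, ((g i : Matrix (Fin n) (Fin n) F)))) = ∏ i, ψ (LinearMap.trace F (Fin n → F) (KL.glE F n (g i)).1) := by
    rw [Matrix.trace_sum, KL.psi_sum_prod]
    exact Finset.prod_congr rfl fun i _ => by rw [KL.glE_trace]
  by_cases h : (List.ofFn g).prod = x
  · rw [if_pos h, if_pos (by rw [h]), e2]
  · rw [if_neg h, if_neg (fun h' => h (Units.ext h'))]
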